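/- Under Assumptions 1 and 2, if in addition a_L τ_L → 0 as L → ∞, then for any fixed k ≥ 1, P(ℓ_L(k) = k) → 1 as L → ∞; that is, with probability tending to 1, the localisation centre of the k-th eigenfunction is the site of the k-th largest value of the potential. -/

import Mathlib

open MeasureTheory ProbabilityTheory Filter Finset

noncomputable section

/-- Euclidean (ℓ²) norm of a point of `ℤ^d`. -/
def znorm {d : ℕ} (x : Fin d → ℤ) : ℝ := Real.sqrt (∑ i, ((x i : ℝ)) ^ 2)

/-- The discrete box `[-a/2, a/2]^d ∩ ℤ^d`. -/
def QBox (d : ℕ) (a : ℝ) : Finset (Fin d → ℤ) :=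
  Finset.Icc (fun _ => Int.ceil (-(a / 2))) (fun _ => Int.floor (a / 2))

/-- The translated box `z + ([-a/2, a/2]^d ∩ ℤ^d)`. -/
def QBoxAt {d : ℕ} (a : ℝ) (z : Fin d → ℤ) : Finset (Fin d → ℤ) :=
  (QBox d a).image (fun x => z + x)

/-- The box `[-1,1]^d ⊂ ℝ^d`. -/
def unitBox (d : ℕ) : Set (Fin d → ℝ) := Set.univ.pi fun _ => Set.Icc (-1) 1

/-- Nearest-neighbour adjacency on `ℤ^d`. -/
def Adj {d : ℕ} (x y : Fin d → ℤ) : Prop := (∑ i, |x i - y i|) = 1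

instance {d : ℕ} (x y : Fin d → ℤ) : Decidable (Adj x y) := by
  unfold Adj; infer_instance

/-- `(lam, f)` is an eigenpair of the Anderson Hamiltonian `Δ + V` on `C ⊂ ℤ^d`
with Dirichlet boundary conditions (`f` vanishes outside `C`). -/
def IsDirichletEigenpair {d : ℕ} (C : Finset (Fin d → ℤ)) (V : (Fin d → ℤ) → ℝ)
    (lam : ℝ) (f : (Fin d → ℤ) → ℝ) : Prop :=
  (∀ x ∉ C, f x = 0) ∧
  ∀ x ∈ C, ((∑ y ∈ C, if Adj x y then f y else 0) - 2 * (d : ℝ) * f x) + V x * f x = lam * f x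

/-- `lam` is the largest Dirichlet eigenvalue of `Δ + V` on `C`. -/
def IsTopEigenvalue {d : ℕ} (C : Finset (Fin d → ℤ)) (V : (Fin d → ℤ) → ℝ) (lam : ℝ) : Prop :=
  (∃ f, f ≠ 0 ∧ IsDirichletEigenpair C V lam f) ∧
  ∀ mu g, g ≠ 0 → IsDirichletEigenpair C V mu g → mu ≤ lam

/-- `(lam, f)` is the principal Dirichlet eigenvalue of `Δ + V` on `C` together with its
ℓ²-normalised nonnegative principal eigenfunction. -/
def IsPrincipalEigenpair {d : ℕ} (C : Finset (Fin d → ℤ)) (V : (Fin d → ℤ) → ℝ)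
    (lam : ℝ) (f : (Fin d → ℤ) → ℝ) : Prop :=
  IsDirichletEigenpair C V lam f ∧ (∑ x ∈ C, f x ^ 2) = 1 ∧ (∀ x, 0 ≤ f x) ∧
  ∀ mu g, g ≠ 0 → IsDirichletEigenpair C V mu g → mu ≤ lam

/-- A complete orthonormal eigenbasis of `Δ + V` on `C` with Dirichlet boundary
conditions, the eigenvalues being listed in nonincreasing order: `lam k` is the
`(k+1)`-th largest eigenvalue (with multiplicity) and `phi k` the associated
normalised eigenfunction. -/
def IsDirichletEigenbasis {d : ℕ} (C : Finset (Fin d → ℤ)) (V : (Fin d → ℤ) → ℝ)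
    (lam : ℕ → ℝ) (phi : ℕ → (Fin d → ℤ) → ℝ) : Prop :=
  (∀ k < C.card, IsDirichletEigenpair C V (lam k) (phi k)) ∧
  (∀ j < C.card, ∀ k < C.card, j ≤ k → lam k ≤ lam j) ∧
  (∀ j < C.card, ∀ k < C.card, (∑ x ∈ C, phi j x * phi k x) = if j = k then 1 else 0)

/-- Covariance of two real random variables. -/
def covar {Ω : Type} [MeasurableSpace Ω] (P : Measure Ω) (X Y : Ω → ℝ) : ℝ :=
  ∫ ω, (X ω - ∫ ω', X ω' ∂P) * (Y ω - ∫ ω', Y ω' ∂P) ∂P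

/-- The basic setting of the paper: for each `L`, a centred stationary Gaussian field
`ξ_L` on `ℤ^d` with nonnegative covariance function `v_L`, `v_L(0) = 1`; `d_L` is defined
through `sup_{|x|=1} v_L(x) = 1 − 1/d_L` and `a_L > 0` through `P(ξ_L(0) > a_L) = L^{−d}`. -/
structure GaussSetting (d : ℕ) (Ω : Type) [MeasurableSpace Ω] where
  P : Measure Ω
  hP : IsProbabilityMeasure P
  ξ : ℕ → Ω → (Fin d → ℤ) → ℝ
  v : ℕ → (Fin d → ℤ) → ℝ
  meas : ∀ L x, Measurable fun ω => ξ L ω x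
  v_nonneg : ∀ L x, 0 ≤ v L x
  v_zero : ∀ L, v L 0 = 1
  gaussian : ∀ L, 2 ≤ L → ∀ (s : Finset (Fin d → ℤ)) (c : (Fin d → ℤ) → ℝ),
    Measure.map (fun ω => ∑ x ∈ s, c x * ξ L ω x) P
      = gaussianReal 0 (Real.toNNReal (∑ x ∈ s, ∑ y ∈ s, c x * c y * v L (x - y)))
  dL : ℕ → ℝ
  dL_pos : ∀ L, 2 ≤ L → 0 < dL L
  dL_def : ∀ L, 2 ≤ L →
    IsGreatest {t : ℝ | ∃ x : Fin d → ℤ, znorm x = 1 ∧ t = v L x} (1 - 1 / dL L)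
  aL : ℕ → ℝ
  aL_pos : ∀ L, 2 ≤ L → 0 < aL L
  aL_def : ∀ L, 2 ≤ L →
    P {ω | aL L < ξ L ω 0} = ENNReal.ofReal (1 / (L : ℝ) ^ d)

namespace GaussSetting

variable {d : ℕ} {Ω : Type} [MeasurableSpace Ω] (S : GaussSetting d Ω)

/-- The shape `S_L(x) = a_L (1 − v_L(x))`. -/
def shape (L : ℕ) (x : Fin d → ℤ) : ℝ := S.aL L * (1 - S.v L x)

/-- Long-range decay assumption (I):
`sup_{|x| ≥ exp(√(ln L))} v_L(x) ln|x| → 0` as `L → ∞`. -/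
def LongRangeDecay : Prop :=
  ∀ ε > (0 : ℝ), ∀ᶠ L : ℕ in atTop, ∀ x : Fin d → ℤ,
    Real.exp (Real.sqrt (Real.log L)) ≤ znorm x → S.v L x * Real.log (znorm x) ≤ ε

/-- Short-range decay assumption (II), with constants `c, c' > 0`. -/
def ShortRangeDecay (c c' : ℝ) : Prop :=
  0 < c ∧ 0 < c' ∧ ∀ L, 2 ≤ L → ∀ x : Fin d → ℤ, x ≠ 0 →
    1 - Real.exp (c' * znorm x) / S.dL L ≤ S.v L x ∧ S.v L x ≤ 1 - c / S.dL L

/-- Assumption 1: `d_L ≪ a_L`. -/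
def Assumption1 : Prop := Tendsto (fun L => S.dL L / S.aL L) atTop (nhds 0)

/-- The fluctuation field `ζ_{L,y}(x) = ξ_L(x) − ξ_L(y) v_L(x − y)`. -/
def zeta (L : ℕ) (y x : Fin d → ℤ) (ω : Ω) : ℝ :=
  S.ξ L ω x - S.ξ L ω y * S.v L (x - y)

/-- The field `Φ_L(y) = ∑_{x ∈ Q_{r_L}, x ≠ 0} φ̄_L(x)² ζ_{L,y}(x + y)`. -/
def Phi (r : ℕ → ℝ) (phiBar : ℕ → (Fin d → ℤ) → ℝ) (L : ℕ) (y : Fin d → ℤ)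
    (ω : Ω) : ℝ :=
  ∑ x ∈ (QBox d (r L)).erase 0, phiBar L x ^ 2 * S.zeta L y (x + y) ω

end GaussSetting

/-- The auxiliary mesoscopic data: the scales `r_L, R_L`, the principal eigenpair
`(λ̄_L, φ̄_L)` of `Δ − S_L` on `Q_{r_L}` and `τ_L` with `τ_L² = Var(Φ_L(0))`. -/
structure MesoData {d : ℕ} {Ω : Type} [MeasurableSpace Ω] (S : GaussSetting d Ω) where
  rL : ℕ → ℝ
  RL : ℕ → ℝ
  lamBar : ℕ → ℝ
  phiBar : ℕ → (Fin d → ℤ) → ℝ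
  tau : ℕ → ℝ
  rL_lower : ∀ L, 2 ≤ L → Real.log (S.aL L) ≤ Real.log (rL L)
  rL_upper : Tendsto (fun L => Real.log (rL L) / Real.sqrt (S.aL L)) atTop (nhds 0)
  RL_lower : Tendsto (fun L => S.aL L / Real.log (RL L)) atTop (nhds 0)
  RL_upper : Tendsto (fun L => Real.log (RL L) / (S.aL L * (S.aL L / S.dL L))) atTop (nhds 0)
  principal : ∀ L, 2 ≤ L →
    IsPrincipalEigenpair (QBox d (rL L)) (fun x => -(S.shape L x)) (lamBar L) (phiBar L)
  tau_nonneg : ∀ L, 0 ≤ tau L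
  tau_def : ∀ L, 2 ≤ L → tau L ^ 2 = variance (S.Phi rL phiBar L 0) S.P

/-- Assumption 2: `τ_L ≪ a_L^{-1} (a_L/d_L)^{1/2}`. -/
def Assumption2 {d : ℕ} {Ω : Type} [MeasurableSpace Ω] (S : GaussSetting d Ω)
    (M : MesoData S) : Prop :=
  Tendsto (fun L => S.aL L * M.tau L * Real.sqrt (S.dL L / S.aL L)) atTop (nhds 0)

/-- The event `E¹_{L,x₀} = {|ξ_L(x₀) − a_L| < θ}`, `θ = 2d+1`. -/
def EventE1 {d : ℕ} {Ω : Type} [MeasurableSpace Ω] (S : GaussSetting d Ω) (L : ℕ)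
    (x₀ : Fin d → ℤ) : Set Ω :=
  {ω | |S.ξ L ω x₀ - S.aL L| < 2 * (d : ℝ) + 1}

/-- The event `E²_{L,x₀} = {|ζ_{L,x₀}(x)| ≤ S_L(x−x₀)/10, ∀ x ∈ Q_{2R_L,x₀}}`. -/
def EventE2 {d : ℕ} {Ω : Type} [MeasurableSpace Ω] (S : GaussSetting d Ω) (RL : ℕ → ℝ)
    (L : ℕ) (x₀ : Fin d → ℤ) : Set Ω :=
  {ω | ∀ x ∈ QBoxAt (2 * RL L) x₀, |S.zeta L x₀ x ω| ≤ S.shape L (x - x₀) / 10}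

/-- The event `E³_{L,x₀}` controlling the fluctuation field on `Q_{R_L,x₀}`. -/
def EventE3 {d : ℕ} {Ω : Type} [MeasurableSpace Ω] (S : GaussSetting d Ω) (RL : ℕ → ℝ)
    (κ : ℝ) (L : ℕ) (x₀ : Fin d → ℤ) : Set Ω :=
  {ω | ∀ x ∈ QBoxAt (RL L) x₀, x ≠ x₀ →
    |S.zeta L x₀ x ω| ≤ Real.sqrt (variance (S.zeta L x₀ x) S.P) *
      (S.aL L / S.dL L) ^ (κ * znorm (x - x₀)) *
      Real.sqrt (max 1 (|S.ξ L ω x₀ - S.aL L| * S.aL L))}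

/-- The event `E_{L,x₀} = E¹ ∩ E² ∩ E³`. -/
def EventE {d : ℕ} {Ω : Type} [MeasurableSpace Ω] (S : GaussSetting d Ω) (RL : ℕ → ℝ)
    (κ : ℝ) (L : ℕ) (x₀ : Fin d → ℤ) : Set Ω :=
  EventE1 S L x₀ ∩ EventE2 S RL L x₀ ∩ EventE3 S RL κ L x₀

end



/-- standard normal density -/
noncomputable def nphi (a : ℝ) : ℝ := (Real.sqrt (2 * Real.pi))⁻¹ * Real.exp (-a ^ 2 / 2)

lemma nphi_pos (a : ℝ) : 0 < nphi a := by unfold nphi; positivity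

lemma nphi_eq (a : ℝ) : gaussianPDFReal 0 1 a = nphi a := by
  simp [gaussianPDFReal, nphi]

lemma gauss_real_eq (s : Set ℝ) :
    (gaussianReal 0 1).real s = ∫ x in s, nphi x := by
  rw [measureReal_def, gaussianReal_apply_eq_integral _ (by simp), ENNReal.toReal_ofReal]
  · simp_rw [nphi_eq]
  · exact integral_nonneg fun x => gaussianPDFReal_nonneg _ _ _

lemma integrable_nphi : Integrable nphi := by
  have := integrable_gaussianPDFReal 0 1
  exact this.congr (ae_of_all _ fun x => nphi_eq x)

lemma gauss_tail_upper (a b : ℝ) (ha : 0 < a) :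
    (gaussianReal 0 1).real (Set.Ioi b) ≤ nphi a / a * Real.exp (a * (a - b)) := by
  rw [gauss_real_eq]
  have h1 : ∀ x, nphi x ≤ (Real.sqrt (2 * Real.pi))⁻¹ * Real.exp (a ^ 2 / 2) * Real.exp (-a * x) := by
    intro x
    unfold nphi
    rw [mul_assoc, ← Real.exp_add]
    gcongr
    nlinarith [sq_nonneg (a - x)]
  calc ∫ x in Set.Ioi b, nphi x
      ≤ ∫ x in Set.Ioi b, (Real.sqrt (2 * Real.pi))⁻¹ * Real.exp (a ^ 2 / 2) * Real.exp (-a * x) := by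
        apply integral_mono integrable_nphi.integrableOn
        · exact (integrableOn_exp_mul_Ioi (by linarith) b).const_mul _
        · exact h1
    _ = nphi a / a * Real.exp (a * (a - b)) := by
        rw [integral_const_mul, integral_exp_mul_Ioi (by linarith)]
        unfold nphi
        have : Real.exp (-a * b) = Real.exp (-a ^ 2 / 2) * Real.exp (a * (a - b)) / Real.exp (a ^ 2 / 2) := by
          rw [← Real.exp_add, ← Real.exp_sub]; congr 1; ring
        rw [this]
        have := Real.exp_pos (a ^ 2 / 2)
        field_simp

lemma gauss_window_lower (b b' M : ℝ) (hb : 0 ≤ b) (hbb : b ≤ b') :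
    (b' - b) * nphi b' ≤ (gaussianReal 0 1).real (Set.Ioc b b') := by
  rw [gauss_real_eq]
  calc (b' - b) * nphi b' = ∫ x in Set.Ioc b b', nphi b' := by
        simp [hbb]
    _ ≤ _ := by
        apply setIntegral_mono_on
        · simp
        · exact integrable_nphi.integrableOn
        · exact measurableSet_Ioc
        · intro x hx
          unfold nphi
          gcongr
          · linarith [hx.1]
          · exact hx.2

lemma gauss_window_upper (b b' : ℝ) (hb : 0 ≤ b) (hbb : b ≤ b') (a0 : ℝ) (ha0 : 0 ≤ a0) (hab : a0 ≤ b) :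
    (gaussianReal 0 1).real (Set.Icc b b') ≤ (b' - b) * nphi a0 := by
  rw [gauss_real_eq]
  calc ∫ x in Set.Icc b b', nphi x ≤ ∫ x in Set.Icc b b', nphi a0 := by
        apply setIntegral_mono_on
        · exact integrable_nphi.integrableOn
        · simp
        · exact measurableSet_Icc
        · intro x hx
          unfold nphi
          gcongr
          linarith [hx.1]
    _ = _ := by simp [hbb]

lemma gauss_tail_lower (a : ℝ) (ha : 1 ≤ a) :
    Real.exp (-2) * (nphi a / a) ≤ (gaussianReal 0 1).real (Set.Ioi a) := by
  have h0 : 0 < a := by linarith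
  have h1 := gauss_window_lower a (a + 1 / a) 0 h0.le (by simp; positivity)
  have h2 : (gaussianReal 0 1).real (Set.Ioc a (a + 1 / a)) ≤ (gaussianReal 0 1).real (Set.Ioi a) :=
    measureReal_mono (fun x hx => hx.1)
  refine le_trans ?_ (le_trans h1 h2)
  have h3 : Real.exp (-2) * nphi a ≤ nphi (a + 1 / a) := by
    unfold nphi
    rw [mul_left_comm, ← Real.exp_add]
    gcongr
    have : (a + 1 / a) ^ 2 = a ^ 2 + 2 + 1 / a ^ 2 := by field_simp; ring
    have h4 : 1 / a ^ 2 ≤ 1 := by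
      rw [div_le_one (by positivity)]; nlinarith
    linarith
  calc Real.exp (-2) * (nphi a / a) = (1 / a) * (Real.exp (-2) * nphi a) := by ring
    _ ≤ (1 / a) * nphi (a + 1 / a) := by gcongr
    _ = _ := by ring

/-- exponential square moment -/
lemma gauss_exp_sq : Integrable (fun x : ℝ => Real.exp (x ^ 2 / 4)) (gaussianReal 0 1) ∧
    ∫ x, Real.exp (x ^ 2 / 4) ∂(gaussianReal 0 1) ≤ 2 := by
  have key : ∀ x : ℝ, gaussianPDFReal 0 1 x * Real.exp (x ^ 2 / 4)
      = (Real.sqrt (2 * Real.pi))⁻¹ * Real.exp (-(1 / 4) * x ^ 2) := by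
    intro x
    rw [nphi_eq]; unfold nphi
    rw [mul_assoc, ← Real.exp_add]; congr 2; ring
  constructor
  · rw [gaussianReal_of_var_ne_zero _ (by simp)]
    rw [integrable_withDensity_iff_integrable_smul' (measurable_gaussianPDF _ _)
      (ae_of_all _ fun x => gaussianPDF_lt_top)]
    simp only [toReal_gaussianPDF, smul_eq_mul, key]
    exact (integrable_exp_neg_mul_sq (by norm_num)).const_mul _
  · rw [integral_gaussianReal_eq_integral_smul (by simp)]
    simp only [smul_eq_mul, key]
    rw [integral_const_mul, integral_gaussian, ← Real.sqrt_inv, ← Real.sqrt_mul (by positivity)]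
    rw [Real.sqrt_le_left (by norm_num)]
    have := Real.pi_pos
    field_simp
    norm_num

lemma gauss_exp_sq' (v V : NNReal) (hV : 0 < V) (hv : v ≤ V) :
    Integrable (fun x : ℝ => Real.exp (x ^ 2 / (4 * V))) (gaussianReal 0 v) ∧
    ∫ x, Real.exp (x ^ 2 / (4 * V)) ∂(gaussianReal 0 v) ≤ 2 := by
  have hmap : gaussianReal 0 v = (gaussianReal 0 1).map (fun x => Real.sqrt v * x) := by
    rw [gaussianReal_map_const_mul]
    congr 1
    · simp
    · ext; simp
  have hm : Measurable (fun x : ℝ => Real.exp (x ^ 2 / (4 * V))) := by fun_prop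
  have hle : ∀ x : ℝ, Real.exp ((Real.sqrt v * x) ^ 2 / (4 * V)) ≤ Real.exp (x ^ 2 / 4) := by
    intro x
    have hV' : (0:ℝ) < V := by exact_mod_cast hV
    have hv' : (v:ℝ) ≤ V := by exact_mod_cast hv
    rw [Real.exp_le_exp, mul_pow, Real.sq_sqrt (by positivity), div_le_div_iff₀ (by positivity) (by norm_num)]
    nlinarith [sq_nonneg x, mul_le_mul_of_nonneg_right hv' (sq_nonneg x)]
  have hintg : Integrable (fun x : ℝ => Real.exp ((Real.sqrt v * x) ^ 2 / (4 * V))) (gaussianReal 0 1) := by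
    refine gauss_exp_sq.1.mono' (by fun_prop) (ae_of_all _ fun x => ?_)
    rw [Real.norm_of_nonneg (Real.exp_pos _).le]; exact hle x
  rw [hmap]
  constructor
  · rw [integrable_map_measure hm.aestronglyMeasurable (by fun_prop)]
    exact hintg
  · rw [integral_map (by fun_prop) hm.aestronglyMeasurable]
    exact (integral_mono hintg gauss_exp_sq.1 hle).trans gauss_exp_sq.2

/-- Chernoff bound for a centred Gaussian. -/
lemma gauss_chernoff (v : NNReal) (w t : ℝ) (hw : 0 < w) (hv : (v : ℝ) ≤ w) (ht : 0 ≤ t) :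
    (gaussianReal 0 v).real (Set.Ici t) ≤ Real.exp (-(t ^ 2 / (2 * w))) := by
  have h := measure_ge_le_exp_mul_mgf (X := id) (μ := gaussianReal 0 v) t (t := t / w) (by positivity)
    (integrable_exp_mul_gaussianReal _)
  rw [mgf_id_gaussianReal] at h
  refine h.trans ?_
  simp only [zero_mul, zero_add]
  rw [← Real.exp_add, Real.exp_le_exp]
  have : (v : ℝ) * (t / w) ^ 2 / 2 ≤ w * (t / w) ^ 2 / 2 := by gcongr
  have e : -(t / w) * t + w * (t / w) ^ 2 / 2 = -(t ^ 2 / (2 * w)) := by field_simp; ring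
  linarith


/-- An isonormal-type Gaussian family: `X c` is centred Gaussian with variance `‖T c‖²`. -/
structure Iso {Ω E H : Type*} [MeasurableSpace Ω] [AddCommGroup E] [Module ℝ E]
    [NormedAddCommGroup H] [InnerProductSpace ℝ H] (P : Measure Ω)
    (X : E →ₗ[ℝ] (Ω → ℝ)) (T : E →ₗ[ℝ] H) : Prop where
  prob : IsProbabilityMeasure P
  meas : ∀ c, Measurable (X c)
  law : ∀ c, P.map (X c) = gaussianReal 0 (‖T c‖₊ ^ 2)

namespace Iso
variable {Ω E H : Type*} [MeasurableSpace Ω] [AddCommGroup E] [Module ℝ E]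
    [NormedAddCommGroup H] [InnerProductSpace ℝ H] {P : Measure Ω}
    {X : E →ₗ[ℝ] (Ω → ℝ)} {T : E →ₗ[ℝ] H}

lemma memLp (h : Iso P X T) (c : E) : MemLp (X c) 2 P := by
  have h1 : MemLp id 2 (P.map (X c)) := by
    rw [h.law c]; exact memLp_id_gaussianReal 2
  exact (memLp_map_measure_iff (by fun_prop) (h.meas c).aemeasurable).1 h1

lemma mean (h : Iso P X T) (c : E) : ∫ ω, X c ω ∂P = 0 := by
  have := integral_map (μ := P) (h.meas c).aemeasurable (f := fun x : ℝ => x) (by fun_prop)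
  rw [← this, h.law c]
  simpa using integral_id_gaussianReal (μ := 0) (v := ‖T c‖₊ ^ 2)

lemma sq (h : Iso P X T) (c : E) : ∫ ω, X c ω ^ 2 ∂P = ‖T c‖ ^ 2 := by
  haveI := h.prob
  have h1 : variance (X c) P = ‖T c‖ ^ 2 := by
    have := variance_map (μ := P) (X := fun x : ℝ => x) (Y := X c) (by fun_prop) (h.meas c).aemeasurable
    rw [show (fun x : ℝ => x) ∘ X c = X c from rfl] at this
    rw [← this, h.law c]
    have := variance_id_gaussianReal (μ := 0) (v := ‖T c‖₊ ^ 2)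
    simpa [Function.id_def] using this
  rw [variance_eq_integral (h.meas c).aemeasurable, h.mean c] at h1
  simpa using h1

lemma mul (h : Iso P X T) (c c' : E) : ∫ ω, X c ω * X c' ω ∂P = inner ℝ (T c) (T c') := by
  have h1 := h.sq (c + c')
  have i1 := (h.memLp c).integrable_sq
  have i2 := (h.memLp c').integrable_sq
  have i3 : Integrable (fun ω => X c ω * X c' ω) P := (h.memLp c).integrable_mul (h.memLp c')
  have e : ∀ ω, X (c + c') ω ^ 2 = (X c ω ^ 2 + X c' ω ^ 2) + 2 * (X c ω * X c' ω) := by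
    intro ω; rw [map_add]; simp only [Pi.add_apply]; ring
  simp only [e] at h1
  rw [integral_add (f := fun ω => X c ω ^ 2 + X c' ω ^ 2) (i1.add i2) (i3.const_mul 2), integral_add i1 i2, integral_const_mul, h.sq, h.sq,
    map_add, norm_add_sq_real] at h1
  linarith

lemma cov (h : Iso P X T) (c c' : E) : cov[X c, X c'; P] = inner ℝ (T c) (T c') := by
  rw [covariance, h.mean, h.mean, ← h.mul]; simp

lemma gaussVec (h : Iso P X T) {ι : Type*} [Fintype ι] (c : ι → E) :
    HasGaussianLaw (fun ω => fun i => X (c i) ω) P := by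
  haveI := h.prob
  classical
  have hm : Measurable (fun ω => fun i => X (c i) ω) := measurable_pi_iff.2 fun i => h.meas _
  refine ⟨isGaussian_of_map_eq_gaussianReal fun L => ⟨0, ‖T (∑ i, L (Pi.single i 1) • c i)‖₊ ^ 2, ?_⟩⟩
  rw [Measure.map_map (by fun_prop) hm, ← h.law]
  congr 1
  funext ω
  simp only [Function.comp, map_sum, map_smul, Finset.sum_apply, Pi.smul_apply, smul_eq_mul]
  conv_lhs => rw [pi_eq_sum_univ' (fun i => X (c i) ω)]
  rw [map_sum]
  refine Finset.sum_congr rfl fun i _ => ?_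
  rw [map_smul, smul_eq_mul, mul_comm]

lemma indep (h : Iso P X T) {ι : Type*} [Fintype ι] (c0 : E) (c : ι → E)
    (h0 : ∀ i, inner ℝ (T c0) (T (c i)) = 0) :
    IndepFun (X c0) (fun ω => fun i => X (c i) ω) P := by
  have hg := h.gaussVec (Sum.elim (fun _ : Unit => c0) c)
  have hg2 : HasGaussianLaw (fun ω ↦ ((fun _ : Unit ↦ X c0 ω), fun j ↦ X (c j) ω)) P := by
    have := hg.map_fun (F := (Unit → ℝ) × (ι → ℝ))
      (ContinuousLinearMap.prod (ContinuousLinearMap.pi fun i => ContinuousLinearMap.proj (Sum.inl i))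
        (ContinuousLinearMap.pi fun i => ContinuousLinearMap.proj (Sum.inr i)))
    simpa using this
  have := hg2.indepFun_of_covariance_eval (X := fun _ : Unit => X c0) (Y := fun j => X (c j))
    (fun i j => by rw [h.cov]; exact h0 j)
  exact this.comp (φ := fun f : Unit → ℝ => f ()) (ψ := id) (measurable_pi_apply _) measurable_id


lemma real_eq (h : Iso P X T) (c : E) {s : Set ℝ} (hs : MeasurableSet s) :
    P.real {ω | X c ω ∈ s} = (gaussianReal 0 (‖T c‖₊ ^ 2)).real s := by
  rw [← h.law c, map_measureReal_apply (h.meas c) hs]; rfl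

lemma near_pair (h : Iso P X T) (c c' : E) (t ρ : ℝ) (ht : 0 ≤ t) (h1 : ‖T c‖ = 1) (h2 : ‖T c'‖ = 1)
    (h3 : inner ℝ (T c) (T c') ≤ ρ) (h4 : 0 < 1 + ρ) :
    P.real {ω | t < X c ω ∧ t < X c' ω} ≤ Real.exp (-(t ^ 2 / (1 + ρ))) := by
  have := h.prob
  have hv : ((‖T (c + c')‖₊ ^ 2 : NNReal) : ℝ) ≤ 2 * (1 + ρ) := by
    push_cast
    rw [map_add, norm_add_sq_real, h1, h2]; linarith
  calc P.real {ω | t < X c ω ∧ t < X c' ω} ≤ P.real {ω | X (c + c') ω ∈ Set.Ici (2 * t)} := by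
        refine measureReal_mono ?_
        rintro ω ⟨h5, h6⟩
        simp only [map_add, Pi.add_apply, Set.mem_Ici, Set.mem_setOf_eq]; linarith
    _ ≤ _ := by
        rw [h.real_eq _ measurableSet_Ici]
        refine (gauss_chernoff _ (2 * (1 + ρ)) (2 * t) (by linarith) hv (by linarith)).trans ?_
        apply le_of_eq; congr 2; field_simp

end Iso

/-- Independent excess lemma. -/
lemma indep_excess {Ω : Type*} [MeasurableSpace Ω] {P : Measure Ω} [IsProbabilityMeasure P]
    {s Y : Ω → ℝ} (hs : Measurable s) (hY : Measurable Y) (hlaw : P.map s = gaussianReal 0 1)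
    (hind : IndepFun s Y P) (a t : ℝ) (ha : 0 < a)
    (hintg : Integrable (fun ω => Real.exp (2 * (a * Y ω))) P) :
    P.real {ω | a - Y ω < s ω ∧ t ≤ a * Y ω} ≤
      nphi a / a * Real.exp (-t) * ∫ ω, Real.exp (2 * (a * Y ω)) ∂P := by
  have hprod := (indepFun_iff_map_prod_eq_prod_map_map hs.aemeasurable hY.aemeasurable).1 hind
  have hps : IsProbabilityMeasure (P.map s) := Measure.isProbabilityMeasure_map hs.aemeasurable
  have hpY : IsProbabilityMeasure (P.map Y) := Measure.isProbabilityMeasure_map hY.aemeasurable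
  set A : Set (ℝ × ℝ) := {p | a - p.2 < p.1 ∧ t ≤ a * p.2} with hA
  have hAm : MeasurableSet A := by
    exact (measurableSet_lt (f := fun p : ℝ × ℝ => a - p.2) (g := fun p => p.1) (by fun_prop) (by fun_prop)).inter
      (measurableSet_le (f := fun _ : ℝ × ℝ => t) (g := fun p => a * p.2) (by fun_prop) (by fun_prop))
  have e1 : P {ω | a - Y ω < s ω ∧ t ≤ a * Y ω} = ((P.map s).prod (P.map Y)) A := by
    rw [← hprod, Measure.map_apply (hs.prodMk hY) hAm]; rfl
  rw [Measure.real, e1, Measure.prod_apply_symm hAm]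
  have hintg' : Integrable (fun y => nphi a / a * Real.exp (-t) * Real.exp (2 * (a * y))) (P.map Y) := by
    apply Integrable.const_mul
    exact (integrable_map_measure (by fun_prop) hY.aemeasurable).2 hintg
  have e2 : ∫ ω, Real.exp (2 * (a * Y ω)) ∂P = ∫ y, Real.exp (2 * (a * y)) ∂(P.map Y) := by
    rw [integral_map hY.aemeasurable (by fun_prop)]
  rw [e2, ← integral_const_mul]
  have hpos : ∀ y, 0 ≤ nphi a / a * Real.exp (-t) * Real.exp (2 * (a * y)) := fun y => by
    have := nphi_pos a; positivity
  rw [integral_eq_lintegral_of_nonneg_ae (ae_of_all _ hpos) (by fun_prop)]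
  refine ENNReal.toReal_mono ?_ (lintegral_mono fun y => ?_)
  · have := hintg'.lintegral_lt_top; exact this.ne
  · by_cases hy : t ≤ a * y
    · have : (fun x => (x, y)) ⁻¹' A = Set.Ioi (a - y) := by
        ext x; simp [hA, hy]
      rw [this, hlaw]
      rw [← ENNReal.ofReal_toReal (a := gaussianReal 0 1 (Set.Ioi (a - y))) (measure_ne_top _ _)]
      refine ENNReal.ofReal_le_ofReal ((gauss_tail_upper a (a - y) ha).trans ?_)
      rw [mul_assoc, ← Real.exp_add]
      have := nphi_pos a
      gcongr
      nlinarith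
    · have : (fun x => (x, y)) ⁻¹' A = ∅ := by
        ext x; simp [hA, hy]
      rw [this]; simp

lemma pdf_compare (ρ s x b : ℝ) (h0 : 0 ≤ ρ) (h1 : ρ < 1) (hs : 0 ≤ s) (hsb : s ≤ b) (hx : 0 ≤ x) (hxb : x ≤ b) :
    gaussianPDFReal (ρ * s) (Real.toNNReal (1 - ρ ^ 2)) x ≤
      ((Real.sqrt (1 - ρ ^ 2))⁻¹ * Real.exp (ρ * b ^ 2)) * gaussianPDFReal 0 1 x := by
  have hp : 0 < 1 - ρ ^ 2 := by nlinarith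
  rw [nphi_eq, nphi, gaussianPDFReal, Real.coe_toNNReal _ hp.le, Real.sqrt_mul (by positivity), mul_inv]
  have h2 : -(x - ρ * s) ^ 2 / (2 * (1 - ρ ^ 2)) ≤ ρ * b ^ 2 + -x ^ 2 / 2 := by
    rw [div_le_iff₀ (by positivity)]
    have h3 : s * x ≤ b ^ 2 := by nlinarith
    have h4 : 0 ≤ s * x := by positivity
    have h5 : 2 * (ρ * (s * x) * (1 - ρ)) ≤ 2 * (ρ * b ^ 2) * (1 - ρ ^ 2) := by
      have : ρ * (s * x) ≤ ρ * b ^ 2 * (1 + ρ) := by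
        have := mul_le_mul_of_nonneg_left h3 h0
        nlinarith [mul_nonneg h0 (mul_nonneg h0 (sq_nonneg b))]
      have := mul_le_mul_of_nonneg_right this (by linarith : 0 ≤ 1 - ρ)
      nlinarith
    nlinarith [mul_nonneg (sq_nonneg ρ) (sq_nonneg (s - x))]
  calc _ ≤ (√(2 * Real.pi))⁻¹ * (√(1 - ρ ^ 2))⁻¹ * Real.exp (ρ * b ^ 2 + -x ^ 2 / 2) := by gcongr
    _ = _ := by rw [Real.exp_add]; ring

lemma Iso.far_pair {Ω E H : Type*} [MeasurableSpace Ω] [AddCommGroup E] [Module ℝ E]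
    [NormedAddCommGroup H] [InnerProductSpace ℝ H] {P : Measure Ω}
    {X : E →ₗ[ℝ] (Ω → ℝ)} {T : E →ₗ[ℝ] H} (h : Iso P X T) (c c' : E) (ρ b : ℝ)
    (hc : ‖T c‖ = 1) (hc' : ‖T c'‖ = 1)
    (h3 : inner ℝ (T c) (T c') = ρ) (h0 : 0 ≤ ρ) (h1 : ρ < 1)
    {A : Set (ℝ × ℝ)} (hA : MeasurableSet A) (hAb : ∀ p ∈ A, 0 ≤ p.1 ∧ p.1 ≤ b ∧ 0 ≤ p.2 ∧ p.2 ≤ b) :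
    P.real {ω | (X c ω, X c' ω) ∈ A} ≤
      (Real.sqrt (1 - ρ ^ 2))⁻¹ * Real.exp (ρ * b ^ 2) * ((gaussianReal 0 1).prod (gaussianReal 0 1)).real A := by
  have := h.prob
  have hp : 0 < 1 - ρ ^ 2 := by nlinarith
  set c2 : E := c' - ρ • c with hc2
  have hT2 : ‖T c2‖ ^ 2 = 1 - ρ ^ 2 := by
    rw [hc2, map_sub, map_smul, norm_sub_sq_real, inner_smul_right, norm_smul, real_inner_comm, h3, hc, hc']
    rw [mul_one, Real.norm_eq_abs, sq_abs]; ring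
  have hind : IndepFun (X c) (X c2) P := by
    have := h.indep (ι := Unit) c (fun _ => c2) (fun _ => by
      rw [hc2, map_sub, map_smul, inner_sub_right, inner_smul_right, h3, real_inner_self_eq_norm_sq, hc]; simp)
    exact this.comp (φ := id) (ψ := fun f : Unit → ℝ => f ()) measurable_id (measurable_pi_apply _)
  have hprod := (indepFun_iff_map_prod_eq_prod_map_map (h.meas c).aemeasurable (h.meas c2).aemeasurable).1 hind
  have hl1 : P.map (X c) = gaussianReal 0 1 := by
    rw [h.law]; congr 1; ext; simp [hc]
  have hl2 : P.map (X c2) = gaussianReal 0 (Real.toNNReal (1 - ρ ^ 2)) := by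
    rw [h.law]; congr 1; ext; rw [Real.coe_toNNReal _ hp.le, ← hT2]; simp
  rw [hl1, hl2] at hprod
  set A' : Set (ℝ × ℝ) := {p | (p.1, ρ * p.1 + p.2) ∈ A} with hA'
  have hA'm : MeasurableSet A' := by
    have : Measurable (fun p : ℝ × ℝ => (p.1, ρ * p.1 + p.2)) := by fun_prop
    exact this hA
  have e1 : P {ω | (X c ω, X c' ω) ∈ A} = ((gaussianReal 0 1).prod (gaussianReal 0 (Real.toNNReal (1 - ρ ^ 2)))) A' := by
    rw [← hprod, Measure.map_apply ((h.meas c).prodMk (h.meas c2)) hA'm]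
    congr 1; ext ω
    simp [hA', hc2]
  have hne : Real.toNNReal (1 - ρ ^ 2) ≠ 0 := by simpa using hp
  set C : ℝ := (Real.sqrt (1 - ρ ^ 2))⁻¹ * Real.exp (ρ * b ^ 2) with hC
  have hCpos : 0 ≤ C := by positivity
  have key : ((gaussianReal 0 1).prod (gaussianReal 0 (Real.toNNReal (1 - ρ ^ 2)))) A' ≤
      ENNReal.ofReal C * ((gaussianReal 0 1).prod (gaussianReal 0 1)) A := by
    rw [Measure.prod_apply hA'm, Measure.prod_apply hA, ← lintegral_const_mul _ (measurable_measure_prodMk_left hA)]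
    refine lintegral_mono fun s => ?_
    have hm : MeasurableSet (Prod.mk s ⁻¹' A) := measurable_prodMk_left hA
    have e2 : gaussianReal 0 (Real.toNNReal (1 - ρ ^ 2)) (Prod.mk s ⁻¹' A') =
        gaussianReal (ρ * s) (Real.toNNReal (1 - ρ ^ 2)) (Prod.mk s ⁻¹' A) := by
      have := gaussianReal_map_const_add (μ := 0) (v := Real.toNNReal (1 - ρ ^ 2)) (ρ * s)
      rw [zero_add] at this
      rw [← this, Measure.map_apply (by fun_prop) hm]
      rfl
    rw [e2, gaussianReal_apply _ hne, gaussianReal_apply _ one_ne_zero,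
      ← lintegral_const_mul _ (by fun_prop)]
    refine setLIntegral_mono (by fun_prop) fun x hx => ?_
    obtain ⟨q1, q2, q3, q4⟩ := hAb _ hx
    rw [gaussianPDF, gaussianPDF, ← ENNReal.ofReal_mul hCpos]
    exact ENNReal.ofReal_le_ofReal (pdf_compare ρ s x b h0 h1 q1 q2 q3 q4)
  rw [Measure.real, e1]
  refine (ENNReal.toReal_mono (by finiteness) key).trans ?_
  rw [ENNReal.toReal_mul, ENNReal.toReal_ofReal hCpos]; rfl


lemma gauss_var_of_map {Ω : Type*} [MeasurableSpace Ω] {P : Measure Ω} [IsProbabilityMeasure P]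
    {X : Ω → ℝ} (hX : Measurable X) {w : NNReal} (h : P.map X = gaussianReal 0 w) :
    MemLp X 2 P ∧ ∫ ω, X ω ^ 2 ∂P = w ∧ ∫ ω, X ω ∂P = 0 := by
  have h1 : MemLp id 2 (P.map X) := by rw [h]; exact memLp_id_gaussianReal 2
  have h2 := (memLp_map_measure_iff (by fun_prop) hX.aemeasurable).1 h1
  have hm : ∫ ω, X ω ∂P = 0 := by
    have := integral_map (μ := P) hX.aemeasurable (f := fun x : ℝ => x) (by fun_prop)
    rw [← this, h]; simp
  refine ⟨h2, ?_, hm⟩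
  have h3 : variance X P = w := by
    have := variance_map (μ := P) (X := fun x : ℝ => x) (Y := X) (by fun_prop) hX.aemeasurable
    rw [show (fun x : ℝ => x) ∘ X = X from rfl] at this
    rw [← this, h]; simp
  rw [variance_eq_integral hX.aemeasurable, hm] at h3
  simpa using h3

lemma Iso.exists_T {Ω E : Type*} [MeasurableSpace Ω] [AddCommGroup E] [Module ℝ E]
    {P : Measure Ω} [hP : IsProbabilityMeasure P] (X : E →ₗ[ℝ] (Ω → ℝ))
    (hX : ∀ c, Measurable (X c)) (hl : ∀ c, ∃ w : NNReal, P.map (X c) = gaussianReal 0 w) :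
    ∃ T : E →ₗ[ℝ] (Lp ℝ 2 P), Iso P X T := by
  have hm : ∀ c, MemLp (X c) 2 P := fun c => by
    obtain ⟨w, hw⟩ := hl c; exact (gauss_var_of_map (hX c) hw).1
  refine ⟨⟨⟨fun c => (hm c).toLp, ?_⟩, ?_⟩, hP, hX, ?_⟩
  · intro c c'
    rw [← MemLp.toLp_add]; congr 1; rw [map_add]
  · intro r c
    simp only [RingHom.id_apply]
    rw [← MemLp.toLp_const_smul]; congr 1; rw [map_smul]
  · intro c
    obtain ⟨w, hw⟩ := hl c
    rw [hw]; congr 1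
    ext
    push_cast
    rw [← (gauss_var_of_map (hX c) hw).2.1]
    rw [← real_inner_self_eq_norm_sq, MeasureTheory.L2.inner_def]
    refine integral_congr_ae ?_
    have := (hm c).coeFn_toLp
    filter_upwards [this] with ω hω
    simp only [LinearMap.coe_mk, AddHom.coe_mk, hω]
    simp [sq]

/-- Symmetrised covariance. -/
noncomputable def usym {d : ℕ} (v : (Fin d → ℤ) → ℝ) (x : Fin d → ℤ) : ℝ := (v x + v (-x)) / 2

/-- Fixed-volume package: Gaussian field with covariance `u`. -/
structure GField {d : ℕ} {Ω H : Type*} [MeasurableSpace Ω] [NormedAddCommGroup H] [InnerProductSpace ℝ H]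
    (P : Measure Ω) (ξ : Ω → (Fin d → ℤ) → ℝ)
    (u : (Fin d → ℤ) → ℝ) (X : ((Fin d → ℤ) →₀ ℝ) →ₗ[ℝ] (Ω → ℝ)) (T : ((Fin d → ℤ) →₀ ℝ) →ₗ[ℝ] H) : Prop where
  iso : Iso P X T
  Xs : ∀ x ω, X (Finsupp.single x 1) ω = ξ ω x
  inn : ∀ x y, inner ℝ (T (Finsupp.single x 1)) (T (Finsupp.single y 1)) = u (x - y)
  even : ∀ x, u (-x) = u x
  zero : u 0 = 1
  nonneg : ∀ x, 0 ≤ u x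

lemma GaussSetting.exists_GField {d : ℕ} {Ω : Type} [MeasurableSpace Ω] (S : GaussSetting d Ω) (L : ℕ) (hL : 2 ≤ L) :
    ∃ (X : ((Fin d → ℤ) →₀ ℝ) →ₗ[ℝ] (Ω → ℝ)) (T : ((Fin d → ℤ) →₀ ℝ) →ₗ[ℝ] (Lp ℝ 2 S.P)),
      GField S.P (S.ξ L) (usym (S.v L)) X T := by
  classical
  have := S.hP
  set X : ((Fin d → ℤ) →₀ ℝ) →ₗ[ℝ] (Ω → ℝ) := Finsupp.linearCombination ℝ (fun x ω => S.ξ L ω x) with hX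
  have hXa : ∀ c ω, X c ω = ∑ x ∈ c.support, c x * S.ξ L ω x := by
    intro c ω; rw [hX, Finsupp.linearCombination_apply, Finsupp.sum, Finset.sum_apply]; simp
  have hXf : ∀ c, X c = fun ω => ∑ x ∈ c.support, c x * S.ξ L ω x := fun c => funext (hXa c)
  have hm : ∀ c, Measurable (X c) := fun c => by
    rw [hXf]; exact Finset.measurable_sum _ fun x _ => (S.meas L x).const_mul _
  obtain ⟨T, hT⟩ := Iso.exists_T (P := S.P) X hm (fun c => ⟨_, by rw [hXf]; exact S.gaussian L hL c.support c⟩)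
  have hXs : ∀ x ω, X (Finsupp.single x 1) ω = S.ξ L ω x := by
    intro x ω; rw [hX]; simp
  have hn : ∀ x, ‖T (Finsupp.single x 1)‖ ^ 2 = 1 := by
    intro x
    have h1 := S.gaussian L hL {x} (fun _ => 1)
    have h2 := (gauss_var_of_map (P := S.P) (X := fun ω => ∑ x ∈ {x}, (fun _ => (1:ℝ)) x * S.ξ L ω x) (by
      exact Finset.measurable_sum _ fun x _ => (S.meas L x).const_mul _) h1).2.1
    rw [← hT.sq]
    simp only [hXs]
    simpa [S.v_zero] using h2
  refine ⟨X, T, hT, hXs, ?_, ?_, ?_, ?_⟩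
  · intro x y
    by_cases hxy : x = y
    · subst hxy; rw [real_inner_self_eq_norm_sq, hn]; simp [usym, S.v_zero]
    have h1 := S.gaussian L hL {x, y} (fun _ => 1)
    have h2 := (gauss_var_of_map (P := S.P) (X := fun ω => ∑ x ∈ {x, y}, (fun _ => (1:ℝ)) x * S.ξ L ω x) (by
      exact Finset.measurable_sum _ fun x _ => (S.meas L x).const_mul _) h1).2.1
    have h3 := hT.sq (Finsupp.single x 1 + Finsupp.single y 1)
    rw [map_add, map_add, norm_add_sq_real, hn, hn] at h3
    simp only [Pi.add_apply, hXs] at h3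
    simp only [Finset.sum_pair hxy, one_mul] at h2
    rw [h3] at h2
    simp only [sub_self, S.v_zero] at h2
    have p1 := S.v_nonneg L (x - y)
    have p2 := S.v_nonneg L (y - x)
    rw [Real.coe_toNNReal _ (by linarith)] at h2
    rw [usym, neg_sub]; linarith
  · intro x; simp [usym, add_comm]
  · simp [usym, S.v_zero]
  · intro x; rw [usym]; have := S.v_nonneg L x; have := S.v_nonneg L (-x); linarith


/-- The `2d` unit directions. -/
def dir {d : ℕ} (p : Fin d × Bool) : Fin d → ℤ := if p.2 then Pi.single p.1 1 else -Pi.single p.1 1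

/-- Sum over nearest neighbours. -/
noncomputable def nbs {d : ℕ} (f : (Fin d → ℤ) → ℝ) (x : Fin d → ℤ) : ℝ := ∑ p : Fin d × Bool, f (x + dir p)

/-- ℓ¹ norm. -/
noncomputable def n1 {d : ℕ} (x : Fin d → ℤ) : ℝ := ∑ i, |(x i : ℝ)|

lemma dir_neg {d : ℕ} (i : Fin d) (b : Bool) : dir (i, !b) = -dir (i, b) := by
  cases b <;> simp [dir]

lemma dir_ne {d : ℕ} (p : Fin d × Bool) : dir p ≠ 0 := by
  obtain ⟨i, b⟩ := p
  intro h
  have := congrFun h i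
  cases b <;> simp [dir] at this

lemma dir_inj {d : ℕ} : Function.Injective (dir (d := d)) := by
  rintro ⟨i, b⟩ ⟨j, b'⟩ h
  have h1 := congrFun h i
  by_cases hij : i = j
  · subst hij
    cases b <;> cases b' <;> simp [dir] at h1 ⊢ <;> omega
  · cases b <;> cases b' <;> simp [dir, hij] at h1

lemma sum_abs_dir {d : ℕ} (p : Fin d × Bool) : ∑ i, |dir p i| = 1 := by
  obtain ⟨i, b⟩ := p
  rw [Finset.sum_eq_single i]
  · cases b <;> simp [dir]
  · intro j _ hj; cases b <;> simp [dir, hj]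
  · simp

lemma adj_iff {d : ℕ} (x y : Fin d → ℤ) : Adj x y ↔ ∃ p, x + dir p = y := by
  constructor
  · intro h
    unfold Adj at h
    have : ∃ i, x i - y i ≠ 0 := by
      by_contra hc
      push Not at hc
      simp [hc] at h
    obtain ⟨i, hi⟩ := this
    have h0 : |x i - y i| + ∑ j ∈ univ.erase i, |x j - y j| = 1 := by
      rw [← h]; exact Finset.add_sum_erase _ (fun j => |x j - y j|) (mem_univ i)
    have hnn : 0 ≤ ∑ j ∈ univ.erase i, |x j - y j| := Finset.sum_nonneg fun j _ => abs_nonneg _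
    have hpos := abs_pos.2 hi
    have hz : ∑ j ∈ univ.erase i, |x j - y j| = 0 := by omega
    have h1 : |x i - y i| = 1 := by omega
    have hz' : ∀ j, j ≠ i → x j = y j := by
      intro j hj
      have := (Finset.sum_eq_zero_iff_of_nonneg (fun j _ => abs_nonneg (x j - y j))).1 hz j (by simp [hj])
      have := abs_eq_zero.1 this; omega
    rcases (abs_eq (by norm_num)).1 h1 with h2 | h2
    · refine ⟨(i, false), funext fun j => ?_⟩
      by_cases hj : j = i
      · subst hj; simp [dir]; omega
      · simp [dir, hj, hz' j hj]
    · refine ⟨(i, true), funext fun j => ?_⟩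
      by_cases hj : j = i
      · subst hj; simp [dir]; omega
      · simp [dir, hj, hz' j hj]
  · rintro ⟨p, rfl⟩
    unfold Adj
    rw [← sum_abs_dir p]
    refine Finset.sum_congr rfl fun i _ => ?_
    simp

lemma sum_adj {d : ℕ} (C : Finset (Fin d → ℤ)) (f : (Fin d → ℤ) → ℝ) (hf : ∀ x ∉ C, f x = 0) (x : Fin d → ℤ) :
    (∑ y ∈ C, if Adj x y then f y else 0) = nbs f x := by
  classical
  rw [← Finset.sum_filter, nbs]
  have : ∑ p : Fin d × Bool, f (x + dir p) = ∑ y ∈ univ.image (fun p : Fin d × Bool => x + dir p), f y := by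
    rw [Finset.sum_image]
    intro p _ q _ h
    exact dir_inj (add_left_cancel h)
  rw [this]
  refine Finset.sum_subset_zero_on_sdiff ?_ ?_ (fun _ _ => rfl)
  · intro y hy
    obtain ⟨p, hp⟩ := (adj_iff x y).1 (Finset.mem_filter.1 hy).2
    exact Finset.mem_image.2 ⟨p, mem_univ _, hp⟩
  · intro y hy
    rw [Finset.mem_sdiff, Finset.mem_image] at hy
    obtain ⟨⟨p, _, hp⟩, h2⟩ := hy
    apply hf
    intro hC
    exact h2 (Finset.mem_filter.2 ⟨hC, (adj_iff x y).2 ⟨p, hp⟩⟩)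

lemma n1_nonneg {d : ℕ} (x : Fin d → ℤ) : 0 ≤ n1 x := Finset.sum_nonneg fun _ _ => abs_nonneg _

lemma n1_add {d : ℕ} (x y : Fin d → ℤ) : n1 (x + y) ≤ n1 x + n1 y := by
  unfold n1; rw [← Finset.sum_add_distrib]
  refine Finset.sum_le_sum fun i _ => ?_
  simp only [Pi.add_apply, Int.cast_add]; exact abs_add_le _ _

lemma n1_neg {d : ℕ} (x : Fin d → ℤ) : n1 (-x) = n1 x := by
  unfold n1; refine Finset.sum_congr rfl fun i _ => ?_
  simp

lemma n1_dir {d : ℕ} (p : Fin d × Bool) : n1 (dir p) = 1 := by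
  have := sum_abs_dir p
  unfold n1; exact_mod_cast this

lemma n1_zero {d : ℕ} : n1 (0 : Fin d → ℤ) = 0 := by simp [n1]

lemma n1_coord {d : ℕ} (x : Fin d → ℤ) (i : Fin d) : |(x i : ℝ)| ≤ n1 x :=
  Finset.single_le_sum (f := fun i => |(x i : ℝ)|) (fun _ _ => abs_nonneg _) (mem_univ i)

lemma n1_ge_one {d : ℕ} (x : Fin d → ℤ) (hx : x ≠ 0) : 1 ≤ n1 x := by
  obtain ⟨i, hi⟩ := Function.ne_iff.1 hx
  refine le_trans ?_ (n1_coord x i)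
  have : (1 : ℤ) ≤ |x i| := Int.one_le_abs hi
  exact_mod_cast this

lemma card_dir (d : ℕ) : (Finset.univ : Finset (Fin d × Bool)).card = 2 * d := by
  simp [mul_comm]

lemma sum_shift_le {d : ℕ} (C : Finset (Fin d → ℤ)) (G : (Fin d → ℤ) → ℝ) (h0 : ∀ x, 0 ≤ G x)
    (hG : ∀ x ∉ C, G x = 0) (p : Fin d → ℤ) (C' : Finset (Fin d → ℤ)) : ∑ x ∈ C', G (x + p) ≤ ∑ x ∈ C, G x := by
  classical
  have : ∑ x ∈ C', G (x + p) = ∑ x ∈ C'.image (fun x => x + p), G x := by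
    rw [Finset.sum_image]; intro a _ b _ h; exact add_right_cancel h
  rw [this]
  calc ∑ x ∈ C'.image (fun x => x + p), G x = ∑ x ∈ (C'.image (fun x => x + p)).filter (fun x => x ∈ C), G x := by
        symm; apply Finset.sum_filter_of_ne
        intro x _ hx; by_contra h; exact hx (hG x h)
    _ ≤ _ := Finset.sum_le_sum_of_subset_of_nonneg (fun x hx => (Finset.mem_filter.1 hx).2) (fun x _ _ => h0 x)


/-- Local eigenpair data for `Δ - Sh` on `C` with `Sh` well-shaped. -/
structure LocEig {d : ℕ} (C : Finset (Fin d → ℤ)) (Sh : (Fin d → ℤ) → ℝ) (K lam : ℝ) (f : (Fin d → ℤ) → ℝ) : Prop where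
  supp : ∀ x ∉ C, f x = 0
  eq : ∀ x ∈ C, nbs f x = (lam + 2 * d + Sh x) * f x
  norm : ∑ x ∈ C, f x ^ 2 = 1
  lamge : -(2 * (d : ℝ)) ≤ lam
  S0 : Sh 0 = 0
  SK : ∀ x, x ≠ 0 → K ≤ Sh x
  Kpos : 0 < K
  mem0 : 0 ∈ C
  small : 32 * (d : ℝ) ^ 2 ≤ K ^ 2

namespace LocEig
variable {d : ℕ} {C : Finset (Fin d → ℤ)} {Sh : (Fin d → ℤ) → ℝ} {K lam : ℝ} {f : (Fin d → ℤ) → ℝ}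

lemma Snn (h : LocEig C Sh K lam f) (x : Fin d → ℤ) : 0 ≤ Sh x := by
  by_cases hx : x = 0
  · rw [hx, h.S0]
  · exact h.Kpos.le.trans (h.SK x hx)

lemma pt (h : LocEig C Sh K lam f) (x : Fin d → ℤ) (hx : x ≠ 0) :
    K ^ 2 * f x ^ 2 ≤ 2 * d * ∑ p : Fin d × Bool, f (x + dir p) ^ 2 := by
  have hnn : 0 ≤ ∑ p : Fin d × Bool, f (x + dir p) ^ 2 := Finset.sum_nonneg fun _ _ => sq_nonneg _
  by_cases hC : x ∈ C
  · have h1 := h.eq x hC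
    have h2 := h.SK x hx
    have h3 := h.lamge
    have h4 : (nbs f x) ^ 2 ≤ 2 * d * ∑ p : Fin d × Bool, f (x + dir p) ^ 2 := by
      have := sq_sum_le_card_mul_sum_sq (s := (univ : Finset (Fin d × Bool))) (f := fun p => f (x + dir p))
      rw [card_dir] at this
      unfold nbs; exact_mod_cast this
    refine le_trans ?_ h4
    rw [h1, mul_pow]
    have hK := h.Kpos
    have : K ≤ lam + 2 * d + Sh x := by linarith
    gcongr
  · rw [h.supp x hC]; simp; positivity

lemma N_le (h : LocEig C Sh K lam f) : ∑ x ∈ C, n1 x ^ 2 * f x ^ 2 ≤ 8 * d ^ 2 / K ^ 2 := by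
  have hK := h.Kpos
  set N := ∑ x ∈ C, n1 x ^ 2 * f x ^ 2 with hN
  have h1 : K ^ 2 * N ≤ 2 * d * ∑ p : Fin d × Bool, ∑ x ∈ C, n1 x ^ 2 * f (x + dir p) ^ 2 := by
    rw [hN, Finset.mul_sum, Finset.sum_comm, Finset.mul_sum]
    refine Finset.sum_le_sum fun x _ => ?_
    by_cases hx : x = 0
    · subst hx; simp [n1_zero]
    · have := h.pt x hx
      have h2 := mul_le_mul_of_nonneg_left this (sq_nonneg (n1 x))
      rw [← Finset.mul_sum]; nlinarith
  have h2 : ∀ p : Fin d × Bool, ∑ x ∈ C, n1 x ^ 2 * f (x + dir p) ^ 2 ≤ 1 + 4 * N := by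
    intro p
    have e : ∀ x, n1 x ^ 2 * f (x + dir p) ^ 2 = (fun z => n1 (z - dir p) ^ 2 * f z ^ 2) (x + dir p) := by
      intro x; simp
    simp only [e]
    refine (sum_shift_le C (fun z => n1 (z - dir p) ^ 2 * f z ^ 2) (fun z => by positivity) (fun x hx => by simp [h.supp x hx]) (dir p) C).trans ?_
    calc ∑ x ∈ C, n1 (x - dir p) ^ 2 * f x ^ 2 ≤ ∑ x ∈ C, (f x ^ 2 + 4 * (n1 x ^ 2 * f x ^ 2)) := by
          refine Finset.sum_le_sum fun x _ => ?_
          have : n1 (x - dir p) ^ 2 ≤ 1 + 4 * n1 x ^ 2 := by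
            have a1 : n1 (x - dir p) ≤ n1 x + 1 := by
              rw [sub_eq_add_neg]; refine (n1_add _ _).trans ?_; rw [n1_neg, n1_dir]
            have a2 := n1_nonneg (x - dir p)
            by_cases hx : x = 0
            · subst hx; rw [n1_zero] at a1 ⊢; nlinarith
            · have := n1_ge_one x hx; nlinarith
          nlinarith [mul_le_mul_of_nonneg_right this (sq_nonneg (f x))]
      _ = 1 + 4 * N := by rw [Finset.sum_add_distrib, h.norm, ← Finset.mul_sum]
  have h3 : ∑ p : Fin d × Bool, ∑ x ∈ C, n1 x ^ 2 * f (x + dir p) ^ 2 ≤ 2 * d * (1 + 4 * N) := by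
    refine (Finset.sum_le_card_nsmul _ _ _ fun p _ => h2 p).trans ?_
    rw [card_dir, nsmul_eq_mul]; push_cast; rfl
  have hs := h.small
  have hN0 : 0 ≤ N := Finset.sum_nonneg fun _ _ => by positivity
  rw [le_div_iff₀ (by positivity)]
  have hd0 : (0 : ℝ) ≤ d := Nat.cast_nonneg d
  have h4 := mul_le_mul_of_nonneg_left h3 (by positivity : (0 : ℝ) ≤ 2 * d)
  nlinarith [mul_le_mul_of_nonneg_right hs hN0]

lemma off_le (h : LocEig C Sh K lam f) : ∑ x ∈ C.erase 0, f x ^ 2 ≤ 8 * d ^ 2 / K ^ 2 := by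
  refine le_trans ?_ h.N_le
  calc ∑ x ∈ C.erase 0, f x ^ 2 ≤ ∑ x ∈ C.erase 0, n1 x ^ 2 * f x ^ 2 := by
        refine Finset.sum_le_sum fun x hx => ?_
        have := n1_ge_one x (Finset.ne_of_mem_erase hx)
        have : 1 ≤ n1 x ^ 2 := by nlinarith
        nlinarith [sq_nonneg (f x)]
    _ ≤ _ := Finset.sum_le_sum_of_subset_of_nonneg (Finset.erase_subset _ _) fun _ _ _ => by positivity

lemma f0 (h : LocEig C Sh K lam f) : 1 - 8 * d ^ 2 / K ^ 2 ≤ f 0 ^ 2 := by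
  have h1 := h.off_le
  have h2 := Finset.add_sum_erase C (fun x => f x ^ 2) h.mem0
  rw [h.norm] at h2
  linarith

lemma f0_le (h : LocEig C Sh K lam f) : f 0 ^ 2 ≤ 1 := by
  rw [← h.norm]
  exact Finset.single_le_sum (f := fun x => f x ^ 2) (fun _ _ => sq_nonneg _) h.mem0

lemma energy (h : LocEig C Sh K lam f) :
    lam + 2 * d + ∑ x ∈ C, Sh x * f x ^ 2 = ∑ x ∈ C, f x * nbs f x := by
  have : ∀ x ∈ C, f x * nbs f x = (lam + 2 * d) * f x ^ 2 + Sh x * f x ^ 2 := by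
    intro x hx; rw [h.eq x hx]; ring
  rw [Finset.sum_congr rfl this, Finset.sum_add_distrib, ← Finset.mul_sum, h.norm, mul_one]

lemma energy_le (h : LocEig C Sh K lam f) :
    lam + 2 * d + ∑ x ∈ C, Sh x * f x ^ 2 ≤ (16 * d ^ 3 + 2 * d) / K := by
  classical
  have hK := h.Kpos
  rw [h.energy]
  have hoff := h.off_le
  have key : ∀ p : Fin d × Bool, ∑ x ∈ C, f x * f (x + dir p) ≤ (8 * d ^ 2 + 1) / K := by
    intro p
    rw [← Finset.add_sum_erase C _ h.mem0]
    have t1 : f 0 * f (0 + dir p) ≤ (1 / 2) / K + (K / 2) * (8 * d ^ 2 / K ^ 2) := by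
      have a1 : f (0 + dir p) ^ 2 ≤ 8 * d ^ 2 / K ^ 2 := by
        refine le_trans ?_ hoff
        rw [zero_add]
        by_cases hc : dir p ∈ C
        · exact Finset.single_le_sum (f := fun x => f x ^ 2) (fun _ _ => sq_nonneg _)
            (Finset.mem_erase.2 ⟨dir_ne p, hc⟩)
        · rw [h.supp _ hc]; simpa using Finset.sum_nonneg fun _ _ => sq_nonneg _
      have a2 := h.f0_le
      have a3 : f 0 * f (0 + dir p) ≤ f 0 ^ 2 / (2 * K) + (K / 2) * f (0 + dir p) ^ 2 := by
        have : 0 ≤ (f 0 - K * f (0 + dir p)) ^ 2 / (2 * K) := by positivity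
        have e : (f 0 - K * f (0 + dir p)) ^ 2 / (2 * K) = f 0 ^ 2 / (2 * K) + (K / 2) * f (0 + dir p) ^ 2 - f 0 * f (0 + dir p) := by
          field_simp; ring
        linarith
      have a4 : f 0 ^ 2 / (2 * K) ≤ (1 / 2) / K := by
        rw [div_div]; gcongr
      have a5 := mul_le_mul_of_nonneg_left a1 (by positivity : 0 ≤ K / 2)
      linarith
    have t2 : ∑ x ∈ C.erase 0, f x * f (x + dir p) ≤ (1 / 2) / K + (K / 2) * (8 * d ^ 2 / K ^ 2) := by
      calc ∑ x ∈ C.erase 0, f x * f (x + dir p) ≤ ∑ x ∈ C.erase 0, ((1 / 2) / K * f (x + dir p) ^ 2 + (K / 2) * f x ^ 2) := by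
            refine Finset.sum_le_sum fun x _ => ?_
            have : 0 ≤ (f (x + dir p) - K * f x) ^ 2 / (2 * K) := by positivity
            have e : (f (x + dir p) - K * f x) ^ 2 / (2 * K) = (1 / 2) / K * f (x + dir p) ^ 2 + (K / 2) * f x ^ 2 - f x * f (x + dir p) := by
              field_simp; ring
            linarith
        _ = (1 / 2) / K * ∑ x ∈ C.erase 0, f (x + dir p) ^ 2 + (K / 2) * ∑ x ∈ C.erase 0, f x ^ 2 := by
            rw [Finset.sum_add_distrib, ← Finset.mul_sum, ← Finset.mul_sum]
        _ ≤ _ := by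
            have := sum_shift_le C (fun x => f x ^ 2) (fun _ => sq_nonneg _) (fun x hx => by simp [h.supp x hx]) (dir p) (C.erase 0)
            rw [h.norm] at this
            have b1 := mul_le_mul_of_nonneg_left this (by positivity : 0 ≤ (1 / 2) / K)
            have b2 := mul_le_mul_of_nonneg_left hoff (by positivity : 0 ≤ K / 2)
            linarith
    have e : (8 * (d:ℝ) ^ 2 + 1) / K = 2 * ((1 / 2) / K + (K / 2) * (8 * d ^ 2 / K ^ 2)) := by
      field_simp; ring
    rw [e]; linarith
  calc ∑ x ∈ C, f x * nbs f x = ∑ p : Fin d × Bool, ∑ x ∈ C, f x * f (x + dir p) := by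
        simp only [nbs, Finset.mul_sum]; rw [Finset.sum_comm]
    _ ≤ 2 * d * ((8 * d ^ 2 + 1) / K) := by
        refine (Finset.sum_le_card_nsmul _ _ _ fun p _ => key p).trans ?_
        rw [card_dir, nsmul_eq_mul]; push_cast; rfl
    _ = _ := by ring

lemma lam_le (h : LocEig C Sh K lam f) : lam + 2 * d ≤ (16 * d ^ 3 + 2 * d) / K := by
  have := h.energy_le
  have h2 : 0 ≤ ∑ x ∈ C, Sh x * f x ^ 2 := Finset.sum_nonneg fun x _ => mul_nonneg (h.Snn x) (sq_nonneg _)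
  linarith

lemma Senergy_le (h : LocEig C Sh K lam f) : ∑ x ∈ C, Sh x * f x ^ 2 ≤ (16 * d ^ 3 + 2 * d) / K := by
  have := h.energy_le
  have := h.lamge
  linarith

end LocEig

/-- Existence of an eigenpair with eigenvalue at least the diagonal entry at `0`. -/
lemma exists_eig {d : ℕ} (C : Finset (Fin d → ℤ)) (V : (Fin d → ℤ) → ℝ) (h0 : 0 ∈ C) (hV : V 0 = 0) :
    ∃ lam f, -(2 * (d : ℝ)) ≤ lam ∧ (∑ x ∈ C, f x ^ 2 = 1) ∧ IsDirichletEigenpair C V lam f := by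
  classical
  let A : Matrix C C ℝ := Matrix.of fun x y => (if Adj x.1 y.1 then 1 else 0) + (if x = y then V x - 2 * d else 0)
  have hadj : ∀ x y : Fin d → ℤ, Adj x y ↔ Adj y x := by
    intro x y; unfold Adj; simp only [abs_sub_comm]
  have hA : A.IsHermitian := by
    ext x y
    simp only [Matrix.conjTranspose_apply, A, Matrix.of_apply, star_trivial, hadj y.1 x.1]
    by_cases h : x = y
    · subst h; rfl
    · simp [h, Ne.symm h]
  let B := hA.eigenvectorBasis
  let z : C := ⟨0, h0⟩
  have hex : ∃ i, -(2 * (d : ℝ)) ≤ hA.eigenvalues i := by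
    by_contra hc
    push Not at hc
    have hspec : ∀ i, A.mulVec (B i).ofLp = hA.eigenvalues i • (B i).ofLp := fun i => hA.mulVec_eigenvectorBasis i
    have h1 : ∑ i, (B i).ofLp z ^ 2 = 1 := by
      have := B.sum_sq_norm_inner_right (EuclideanSpace.single z (1:ℝ))
      simpa [EuclideanSpace.inner_single_right] using this
    have h2 : A z z = ∑ i, hA.eigenvalues i * (B i).ofLp z ^ 2 := by
      have h3 := B.sum_repr (EuclideanSpace.single z (1:ℝ))
      have h4 : (Pi.single z 1 : C → ℝ) = ∑ i, (B i).ofLp z • (B i).ofLp := by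
        have := congrArg (fun w : EuclideanSpace ℝ C => w.ofLp) h3
        simp only [WithLp.ofLp_sum, WithLp.ofLp_smul, B.repr_apply_apply, EuclideanSpace.inner_single_right] at this
        rw [← show (EuclideanSpace.single z (1:ℝ)).ofLp = (Pi.single z 1 : C → ℝ) from rfl, ← this]
        simp
      have h5 : A z z = (A.mulVec (Pi.single z 1)) z := by simp
      rw [h5, h4, Matrix.mulVec_sum]
      simp only [Matrix.mulVec_smul, hspec, Finset.sum_apply, Pi.smul_apply, smul_eq_mul]
      refine Finset.sum_congr rfl fun i _ => by ring
    have h3 : A z z = -(2 * (d : ℝ)) := by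
      have : ¬ Adj (0 : Fin d → ℤ) 0 := by unfold Adj; simp
      simp [A, z, hV, this]
    rw [h3] at h2
    have h4 : ∑ i, (hA.eigenvalues i + 2 * d) * (B i).ofLp z ^ 2 = 0 := by
      simp only [add_mul, Finset.sum_add_distrib, ← Finset.mul_sum, h1, ← h2]; ring
    have h5 : ∀ i, (hA.eigenvalues i + 2 * d) * (B i).ofLp z ^ 2 ≤ 0 := fun i =>
      mul_nonpos_of_nonpos_of_nonneg (by have := hc i; linarith) (sq_nonneg _)
    have h6 := (Finset.sum_eq_zero_iff_of_nonpos (fun i _ => h5 i)).1 h4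
    have : ∑ i, (B i).ofLp z ^ 2 = 0 := Finset.sum_eq_zero fun i hi => by
      have := h6 i hi
      rcases mul_eq_zero.1 this with h | h
      · have := hc i; linarith
      · exact h
    linarith
  obtain ⟨i, hi⟩ := hex
  let f : (Fin d → ℤ) → ℝ := fun x => if h : x ∈ C then (B i).ofLp ⟨x, h⟩ else 0
  have hfC : ∀ x : C, f x.1 = (B i).ofLp x := fun x => by simp [f]
  have hsum : ∀ g : (Fin d → ℤ) → ℝ, ∑ x ∈ C, g x = ∑ x : C, g x.1 := fun g => (Finset.sum_coe_sort C g).symm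
  refine ⟨hA.eigenvalues i, f, hi, ?_, ?_, ?_⟩
  · rw [hsum]; simp only [hfC]
    have := B.norm_eq_one i
    have h2 := EuclideanSpace.real_norm_sq_eq (B i)
    rw [this] at h2; simpa using h2.symm
  · intro x hx; simp [f, hx]
  · intro x hx
    have := congrFun (hA.mulVec_eigenvectorBasis i) ⟨x, hx⟩
    rw [hsum]
    rw [show f x = (B i).ofLp ⟨x, hx⟩ from hfC ⟨x, hx⟩]
    simp only [hfC]
    simp only [Matrix.mulVec, dotProduct, A, Matrix.of_apply, add_mul, Finset.sum_add_distrib, ite_mul, one_mul, zero_mul,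
      Pi.smul_apply, smul_eq_mul, Finset.sum_ite_eq, Finset.mem_univ, if_true] at this
    simp only [B]
    linarith

lemma eig_nbs {d : ℕ} {C : Finset (Fin d → ℤ)} {Sh : (Fin d → ℤ) → ℝ} {lam : ℝ} {f : (Fin d → ℤ) → ℝ}
    (h : IsDirichletEigenpair C (fun x => -Sh x) lam f) :
    ∀ x ∈ C, nbs f x = (lam + 2 * d + Sh x) * f x := by
  intro x hx
  have := h.2 x hx
  rw [sum_adj C f h.1] at this
  linarith

lemma principal_LocEig {d : ℕ} {C : Finset (Fin d → ℤ)} {Sh : (Fin d → ℤ) → ℝ} {lam K : ℝ} {f : (Fin d → ℤ) → ℝ}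
    (h : IsPrincipalEigenpair C (fun x => -Sh x) lam f) (S0 : Sh 0 = 0) (SK : ∀ x, x ≠ 0 → K ≤ Sh x)
    (hK : 0 < K) (h0 : 0 ∈ C) (small : 32 * (d : ℝ) ^ 2 ≤ K ^ 2) : LocEig C Sh K lam f := by
  obtain ⟨l, g, hl, hg, hge⟩ := exists_eig C (fun x => -Sh x) h0 (by simp [S0])
  refine ⟨h.1.1, eig_nbs h.1, h.2.1, ?_, S0, SK, hK, h0, small⟩
  refine hl.trans (h.2.2.2 l g ?_ hge)
  rintro rfl
  simp at hg

lemma exists_even_LocEig {d : ℕ} {C : Finset (Fin d → ℤ)} {Sh : (Fin d → ℤ) → ℝ} {K : ℝ}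
    (S0 : Sh 0 = 0) (SK : ∀ x, x ≠ 0 → K ≤ Sh x)
    (hK : 0 < K) (h0 : 0 ∈ C) (small : 32 * (d : ℝ) ^ 2 ≤ K ^ 2)
    (hC : ∀ x, x ∈ C → -x ∈ C) (hS : ∀ x, Sh (-x) = Sh x) :
    ∃ lam f, LocEig C Sh K lam f ∧ ∀ x, f (-x) = f x := by
  obtain ⟨l, g, hl, hg, hge⟩ := exists_eig C (fun x => -Sh x) h0 (by simp [S0])
  have hL : LocEig C Sh K l g := ⟨hge.1, eig_nbs hge, hg, hl, S0, SK, hK, h0, small⟩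
  have hg0 : 0 < g 0 ^ 2 := by
    have h1 := hL.f0
    have : 8 * (d : ℝ) ^ 2 / K ^ 2 ≤ 1 / 4 := by
      rw [div_le_iff₀ (by positivity)]; linarith
    linarith
  let h : (Fin d → ℤ) → ℝ := fun x => g x + g (-x)
  have hcard : ∀ x, nbs (fun x => g (-x)) x = nbs g (-x) := by
    intro x
    unfold nbs
    refine Fintype.sum_equiv (Equiv.prodCongr (Equiv.refl _) Equiv.boolNot) _ _ ?_
    rintro ⟨i, b⟩
    simp only [Equiv.prodCongr_apply, Prod.map, Equiv.refl_apply, Equiv.boolNot_apply, dir_neg]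
    congr 1; abel
  set s := ∑ x ∈ C, h x ^ 2 with hs
  have hspos : 0 < s := by
    refine lt_of_lt_of_le ?_ (Finset.single_le_sum (f := fun x => h x ^ 2) (fun _ _ => sq_nonneg _) h0)
    simp only [h, neg_zero]
    nlinarith
  refine ⟨l, fun x => (Real.sqrt s)⁻¹ * h x, ⟨?_, ?_, ?_, hl, S0, SK, hK, h0, small⟩, ?_⟩
  · intro x hx
    have hx' : -x ∉ C := fun hh => hx (by simpa using hC _ hh)
    simp [h, hge.1 x hx, hge.1 _ hx']
  · intro x hx
    have h1 := hL.eq x hx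
    have h2 := hL.eq (-x) (hC x hx)
    rw [hS] at h2
    have : nbs (fun x => (Real.sqrt s)⁻¹ * h x) x = (Real.sqrt s)⁻¹ * (nbs g x + nbs g (-x)) := by
      rw [← hcard]
      simp only [nbs, h, ← Finset.mul_sum, ← Finset.sum_add_distrib]
    rw [this, h1, h2]; simp only [h]; ring
  · simp only [mul_pow, ← Finset.mul_sum, ← hs, inv_pow, Real.sq_sqrt hspos.le]
    exact inv_mul_cancel₀ hspos.ne'
  · intro x; simp [h, add_comm]


/-- Stationary family of vectors in a Hilbert space. -/
structure Stat {d : ℕ} {H : Type*} [NormedAddCommGroup H] [InnerProductSpace ℝ H]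
    (e : (Fin d → ℤ) → H) (u : (Fin d → ℤ) → ℝ) : Prop where
  inn : ∀ x y, inner ℝ (e x) (e y) = u (x - y)
  even : ∀ x, u (-x) = u x
  zero : u 0 = 1

/-- second difference -/
def Dv {d : ℕ} {H : Type*} [NormedAddCommGroup H] [InnerProductSpace ℝ H]
    (e : (Fin d → ℤ) → H) (x : Fin d → ℤ) : H := e x + e (-x) - (2:ℝ) • e 0

namespace Stat
variable {d : ℕ} {H : Type*} [NormedAddCommGroup H] [InnerProductSpace ℝ H]
    {e : (Fin d → ℤ) → H} {u : (Fin d → ℤ) → ℝ}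

lemma norm_one (h : Stat e u) (x : Fin d → ℤ) : ‖e x‖ = 1 := by
  have := h.inn x x
  rw [real_inner_self_eq_norm_sq, sub_self, h.zero] at this
  nlinarith [norm_nonneg (e x)]

lemma inner_D (h : Stat e u) (x y : Fin d → ℤ) :
    inner ℝ (Dv e x) (Dv e y) = ‖e (x + y) - e x - e y + e 0‖ ^ 2 := by
  rw [← real_inner_self_eq_norm_sq]
  simp only [Dv, inner_add_left, inner_add_right, inner_sub_left, inner_sub_right, inner_smul_left, inner_smul_right, h.inn]
  have e1 : u (-x - y) = u (x + y) := by rw [← h.even (x + y)]; congr 1; abel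
  have e2 : u (-x - -y) = u (x - y) := by rw [← h.even (x - y)]; congr 1; abel
  have e3 : u (y - x) = u (x - y) := by rw [← h.even (x - y)]; congr 1; abel
  simp only [sub_neg_eq_add, sub_zero, zero_sub, h.even, h.zero, sub_self, add_sub_cancel_left, add_sub_cancel_right,
    e1, e3, zero_add]
  have e4 : u (-x + y) = u (x - y) := by rw [← h.even (x - y)]; congr 1; abel
  have e5 : u (x - (x + y)) = u y := by rw [← h.even y]; congr 1; abel
  have e6 : u (y - (x + y)) = u x := by rw [← h.even x]; congr 1; abel
  have e7 : u (-(x + y)) = u (x + y) := h.even _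
  simp only [e4, e5, e6]
  simp
  ring

lemma inner_D_nonneg (h : Stat e u) (x y : Fin d → ℤ) : 0 ≤ inner ℝ (Dv e x) (Dv e y) := by
  rw [h.inner_D]; positivity

lemma D_neg (x : Fin d → ℤ) : Dv e (-x) = Dv e x := by
  unfold Dv; rw [neg_neg]; abel

lemma D_zero : Dv e 0 = 0 := by
  unfold Dv; rw [neg_zero, two_smul]; abel

lemma mixed_le (h : Stat e u) (x y : Fin d → ℤ) :
    ‖e (x + y) - e x - e y + e 0‖ ≤ Real.sqrt ‖Dv e x‖ * Real.sqrt ‖Dv e y‖ := by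
  rw [← Real.sqrt_mul (norm_nonneg _)]
  refine Real.le_sqrt_of_sq_le ?_
  rw [← h.inner_D]; exact real_inner_le_norm _ _

lemma subadd (h : Stat e u) (x y : Fin d → ℤ) :
    Real.sqrt ‖Dv e (x + y)‖ ≤ Real.sqrt ‖Dv e x‖ + Real.sqrt ‖Dv e y‖ := by
  refine Real.sqrt_le_iff.2 ⟨by positivity, ?_⟩
  have e1 : Dv e (x + y) = (e (x + y) - e x - e y + e 0) + (e (-x + -y) - e (-x) - e (-y) + e 0) + Dv e x + Dv e y := by
    unfold Dv; rw [neg_add]; simp only [two_smul]; abel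
  have h1 := h.mixed_le x y
  have h2 := h.mixed_le (-x) (-y)
  rw [D_neg, D_neg] at h2
  have h3 := Real.sq_sqrt (norm_nonneg (Dv e x))
  have h4 := Real.sq_sqrt (norm_nonneg (Dv e y))
  calc ‖Dv e (x + y)‖ ≤ ‖e (x + y) - e x - e y + e 0‖ + ‖e (-x + -y) - e (-x) - e (-y) + e 0‖ + ‖Dv e x‖ + ‖Dv e y‖ := by
        rw [e1]; exact norm_add₄_le
    _ ≤ _ := by nlinarith

lemma D_le (h : Stat e u) (M : ℝ) (hM : ∀ p, ‖Dv e (dir p)‖ ≤ M) (x : Fin d → ℤ) :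
    ‖Dv e x‖ ≤ n1 x ^ 2 * M := by
  by_cases hd : Nonempty (Fin d)
  swap
  · have : x = 0 := by
      funext i; exact absurd ⟨i⟩ hd
    subst this; rw [D_zero, n1_zero]; simp
  obtain ⟨i0⟩ := hd
  have hM0 : 0 ≤ M := (norm_nonneg _).trans (hM (i0, true))
  let N : (Fin d → ℤ) → ℝ := fun x => Real.sqrt ‖Dv e x‖
  have hN0 : N 0 = 0 := by simp [N, D_zero]
  have hNn : ∀ x, N (-x) = N x := fun x => by simp [N, D_neg]
  have hk : ∀ (i : Fin d) (k : ℕ), N (Pi.single i (k : ℤ)) ≤ k * Real.sqrt M := by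
    intro i k
    induction k with
    | zero => simp [hN0]
    | succ k ih =>
      have : (Pi.single i ((k + 1 : ℕ) : ℤ) : Fin d → ℤ) = Pi.single i (k : ℤ) + dir (i, true) := by
        simp [dir, ← Pi.single_add]
      rw [this]
      refine (h.subadd _ _).trans ?_
      have := Real.sqrt_le_sqrt (hM (i, true))
      push_cast; simp only [N] at ih; linarith
  have hz : ∀ (i : Fin d) (n : ℤ), N (Pi.single i n) ≤ |(n : ℝ)| * Real.sqrt M := by
    intro i n
    rcases Int.eq_nat_or_neg n with ⟨k, rfl | rfl⟩
    · simpa using hk i k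
    · rw [Pi.single_neg, hNn]; simpa using hk i k
  have hx : N x ≤ n1 x * Real.sqrt M := by
    have e1 : x = ∑ i, Pi.single i (x i) := (Finset.univ_sum_single x).symm
    have := Finset.le_sum_of_subadditive N hN0.le h.subadd univ (fun i => Pi.single i (x i))
    rw [← e1] at this
    refine this.trans ?_
    rw [n1, Finset.sum_mul]
    exact Finset.sum_le_sum fun i _ => hz i (x i)
  have h1 : ‖Dv e x‖ = N x ^ 2 := (Real.sq_sqrt (norm_nonneg _)).symm
  rw [h1]
  calc N x ^ 2 ≤ (n1 x * Real.sqrt M) ^ 2 := by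
        have : 0 ≤ N x := Real.sqrt_nonneg _
        gcongr
    _ = _ := by rw [mul_pow, Real.sq_sqrt hM0]

lemma cross (h : Stat e u) (C : Finset (Fin d → ℤ)) (W : (Fin d → ℤ) → ℝ) (hW : ∀ x, 0 ≤ W x) (z : Fin d → ℤ) (hz : z ∈ C) :
    W z * ‖Dv e z‖ ≤ ‖∑ x ∈ C, W x • Dv e x‖ := by
  have h1 : W z * ‖Dv e z‖ ^ 2 ≤ inner ℝ (Dv e z) (∑ x ∈ C, W x • Dv e x) := by
    rw [inner_sum]
    have := Finset.single_le_sum (f := fun x => inner ℝ (Dv e z) (W x • Dv e x)) (s := C)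
      (fun x _ => by simp only [inner_smul_right]; exact mul_nonneg (hW x) (h.inner_D_nonneg _ _)) hz
    refine le_trans (le_of_eq ?_) this
    simp only [inner_smul_right]; rw [real_inner_self_eq_norm_sq]
  have h2 := h1.trans (real_inner_le_norm _ _)
  by_cases h0 : ‖Dv e z‖ = 0
  · rw [h0]; simp
  · have : 0 < ‖Dv e z‖ := lt_of_le_of_ne (norm_nonneg _) (Ne.symm h0)
    refine le_of_mul_le_mul_left ?_ this
    nlinarith

lemma refl_norm (h : Stat e u) (C : Finset (Fin d → ℤ)) (c : (Fin d → ℤ) → ℝ) :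
    ‖∑ x ∈ C, c x • e (-x)‖ = ‖∑ x ∈ C, c x • e x‖ := by
  have : ‖∑ x ∈ C, c x • e (-x)‖ ^ 2 = ‖∑ x ∈ C, c x • e x‖ ^ 2 := by
    rw [← real_inner_self_eq_norm_sq, ← real_inner_self_eq_norm_sq]
    simp only [sum_inner, inner_sum, inner_smul_left, inner_smul_right, h.inn]
    have q : ∀ x y, u (-x - -y) = u (x - y) := fun x y => by
      rw [show -x - -y = -(x - y) by abel, h.even]
    simp only [q]
  exact (sq_eq_sq₀ (norm_nonneg _) (norm_nonneg _)).1 this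

lemma star_tau (h : Stat e u) (C : Finset (Fin d → ℤ)) (W v : (Fin d → ℤ) → ℝ) (hv : v 0 = 1)
    (hW : ∀ x, 0 ≤ W x) (hv1 : ∀ x, v x ≤ 1) :
    ‖∑ x ∈ C, W x • Dv e x‖ ≤ 2 * ‖∑ x ∈ C.erase 0, W x • (e x - v x • e 0)‖ + 2 * ∑ x ∈ C, W x * (1 - v x) := by
  classical
  set b := ∑ x ∈ C, W x * v x with hb
  have e0 : ∑ x ∈ C.erase 0, W x • (e x - v x • e 0) = ∑ x ∈ C, W x • (e x - v x • e 0) := by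
    refine Finset.sum_subset (Finset.erase_subset _ _) fun x hx hx' => ?_
    have : x = 0 := by by_contra hc; exact hx' (Finset.mem_erase.2 ⟨hc, hx⟩)
    subst this; simp [hv]
  have e1 : ‖∑ x ∈ C, W x • (e (-x) - v x • e 0)‖ = ‖∑ x ∈ C, W x • (e x - v x • e 0)‖ := by
    have q := h.refl_norm (insert 0 C) (fun x => (if x ∈ C then W x else 0) - if x = 0 then b else 0)
    have q2 : ∀ w : (Fin d → ℤ) → H, ∑ x ∈ insert 0 C, ((if x ∈ C then W x else 0) - if x = 0 then b else 0) • w x =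
        ∑ x ∈ C, W x • w x - b • w 0 := by
      intro w
      simp only [sub_smul, Finset.sum_sub_distrib, ite_smul, zero_smul]
      congr 1
      · rw [← Finset.sum_filter]
        congr 1
        ext x; simp only [Finset.mem_filter, Finset.mem_insert]; tauto
      · rw [Finset.sum_ite_eq' (insert 0 C)]; simp
    have q3 : ∀ w : (Fin d → ℤ) → H, ∑ x ∈ C, W x • (w x - v x • e 0) = ∑ x ∈ C, W x • w x - b • e 0 := by
      intro w
      simp only [smul_sub, Finset.sum_sub_distrib, smul_smul, ← Finset.sum_smul, hb]
    rw [q2 e, q2 (fun x => e (-x))] at q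
    rw [q3 e, q3 (fun x => e (-x))]
    simpa using q
  have e2 : ∑ x ∈ C, W x • Dv e x = ∑ x ∈ C, W x • (e x - v x • e 0) + ∑ x ∈ C, W x • (e (-x) - v x • e 0)
      - (2 * ∑ x ∈ C, W x * (1 - v x)) • e 0 := by
    rw [Finset.mul_sum, Finset.sum_smul, ← Finset.sum_add_distrib, ← Finset.sum_sub_distrib]
    refine Finset.sum_congr rfl fun x _ => ?_
    unfold Dv; module
  have hβ : 0 ≤ ∑ x ∈ C, W x * (1 - v x) := Finset.sum_nonneg fun x _ => mul_nonneg (hW x) (by have := hv1 x; linarith)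
  rw [e0, e2]
  refine (norm_sub_le _ _).trans ?_
  refine (add_le_add_left (norm_add_le _ _) _).trans ?_
  rw [e1, norm_smul, h.norm_one, Real.norm_eq_abs, abs_of_nonneg (by linarith)]
  linarith

lemma X_norm (h : Stat e u) (C : Finset (Fin d → ℤ)) (hC : ∀ x ∈ C, -x ∈ C) (W : (Fin d → ℤ) → ℝ) (hW : ∀ x, 0 ≤ W x)
    (hWe : ∀ x, W (-x) = W x) (hu1 : ∀ x, u x ≤ 1) (M : ℝ) (hM : ∀ p, ‖Dv e (dir p)‖ ≤ M) :
    ‖∑ x ∈ C, W x • (e x - u x • e 0)‖ ≤ (∑ x ∈ C, n1 x ^ 2 * W x) * M / 2 + ∑ x ∈ C, W x * (1 - u x) := by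
  have e1 : ∑ x ∈ C, W x • (e x - u x • e 0) = ∑ x ∈ C, W x • (e (-x) - u x • e 0) := by
    refine Finset.sum_nbij' (fun x => -x) (fun x => -x) hC hC (by simp) (by simp) ?_
    intro x _; simp only [hWe, h.even, neg_neg]
  have e2 : ∑ x ∈ C, W x • (e x - u x • e 0) = (1 / 2 : ℝ) • ∑ x ∈ C, W x • Dv e x + (∑ x ∈ C, W x * (1 - u x)) • e 0 := by
    have : (2 : ℝ) • ∑ x ∈ C, W x • (e x - u x • e 0) = ∑ x ∈ C, W x • Dv e x + (2 * ∑ x ∈ C, W x * (1 - u x)) • e 0 := by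
      rw [two_smul]; nth_rewrite 2 [e1]
      rw [Finset.mul_sum, Finset.sum_smul, ← Finset.sum_add_distrib, ← Finset.sum_add_distrib]
      refine Finset.sum_congr rfl fun x _ => ?_
      unfold Dv; module
    have h2 := congrArg (fun w => (1 / 2 : ℝ) • w) this
    simp only [smul_smul, smul_add] at h2
    norm_num at h2 ⊢
    rw [h2]; congr 2; ring
  have hβ : 0 ≤ ∑ x ∈ C, W x * (1 - u x) := Finset.sum_nonneg fun x _ => mul_nonneg (hW x) (by have := hu1 x; linarith)
  rw [e2]
  refine (norm_add_le _ _).trans ?_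
  rw [norm_smul, norm_smul, h.norm_one, Real.norm_eq_abs, Real.norm_eq_abs, abs_of_nonneg hβ, mul_one]
  have : ‖∑ x ∈ C, W x • Dv e x‖ ≤ (∑ x ∈ C, n1 x ^ 2 * W x) * M := by
    refine (norm_sum_le _ _).trans ?_
    rw [Finset.sum_mul]
    refine Finset.sum_le_sum fun x _ => ?_
    rw [norm_smul, Real.norm_eq_abs, abs_of_nonneg (hW x)]
    have := mul_le_mul_of_nonneg_left (h.D_le M hM x) (hW x)
    linarith
  rw [abs_of_pos (by norm_num)]
  linarith

end Stat


/-- Anderson Hamiltonian applied to a function on the full lattice. -/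
noncomputable def Ham {d : ℕ} (V : (Fin d → ℤ) → ℝ) (f : (Fin d → ℤ) → ℝ) (x : Fin d → ℤ) : ℝ :=
  nbs f x - 2 * d * f x + V x * f x

lemma Ham_add {d : ℕ} (V : (Fin d → ℤ) → ℝ) (f g : (Fin d → ℤ) → ℝ) (x : Fin d → ℤ) :
    Ham V (fun z => f z + g z) x = Ham V f x + Ham V g x := by
  simp only [Ham, nbs, Finset.sum_add_distrib]; ring

lemma Ham_sum {d : ℕ} {ι : Type*} (s : Finset ι) (b : ι → ℝ) (V : (Fin d → ℤ) → ℝ) (f : ι → (Fin d → ℤ) → ℝ) (x : Fin d → ℤ) :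
    Ham V (fun z => ∑ y ∈ s, b y * f y z) x = ∑ y ∈ s, b y * Ham V (f y) x := by
  simp only [Ham, nbs]
  rw [Finset.sum_comm]
  simp only [mul_add, mul_sub, Finset.sum_add_distrib, Finset.sum_sub_distrib, Finset.mul_sum]
  congr 1
  · congr 1
    refine Finset.sum_congr rfl fun i _ => by ring
  · refine Finset.sum_congr rfl fun i _ => by ring

lemma sum_shift_eq {d : ℕ} (B : Finset (Fin d → ℤ)) (F G : (Fin d → ℤ) → ℝ)
    (hF : ∀ x ∉ B, F x = 0) (hG : ∀ x ∉ B, G x = 0) (p : Fin d → ℤ) :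
    ∑ x ∈ B, F x * G (x + p) = ∑ x ∈ B, G x * F (x - p) := by
  classical
  have h1 : ∑ x ∈ B, F x * G (x + p) = ∑ x ∈ B.filter (fun x => x + p ∈ B), F x * G (x + p) := by
    symm; apply Finset.sum_filter_of_ne
    intro x _ hx; by_contra h; exact hx (by rw [hG _ h, mul_zero])
  have h2 : ∑ x ∈ B, G x * F (x - p) = ∑ x ∈ B.filter (fun x => x - p ∈ B), G x * F (x - p) := by
    symm; apply Finset.sum_filter_of_ne
    intro x _ hx; by_contra h; exact hx (by rw [hF _ h, mul_zero])
  rw [h1, h2]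
  refine Finset.sum_nbij' (fun x => x + p) (fun x => x - p) ?_ ?_ (by simp) (by simp) ?_
  · intro x hx; simp only [Finset.mem_filter] at hx ⊢; simpa using ⟨hx.2, hx.1⟩
  · intro x hx; simp only [Finset.mem_filter] at hx ⊢; simpa using ⟨hx.2, hx.1⟩
  · intro x _; simp [mul_comm]

lemma nbs_sub {d : ℕ} (F : (Fin d → ℤ) → ℝ) (x : Fin d → ℤ) : ∑ p, F (x - dir p) = nbs F x := by
  unfold nbs
  refine Fintype.sum_equiv (Equiv.prodCongr (Equiv.refl _) Equiv.boolNot) _ _ ?_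
  rintro ⟨i, b⟩
  simp only [Equiv.prodCongr_apply, Prod.map, Equiv.refl_apply, Equiv.boolNot_apply, dir_neg]
  congr 1

lemma nbs_symm {d : ℕ} (B : Finset (Fin d → ℤ)) (F G : (Fin d → ℤ) → ℝ)
    (hF : ∀ x ∉ B, F x = 0) (hG : ∀ x ∉ B, G x = 0) :
    ∑ x ∈ B, F x * nbs G x = ∑ x ∈ B, G x * nbs F x := by
  calc ∑ x ∈ B, F x * nbs G x = ∑ p : Fin d × Bool, ∑ x ∈ B, F x * G (x + dir p) := by
        simp only [nbs, Finset.mul_sum]; rw [Finset.sum_comm]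
    _ = ∑ p : Fin d × Bool, ∑ x ∈ B, G x * F (x - dir p) :=
        Finset.sum_congr rfl fun p _ => sum_shift_eq B F G hF hG _
    _ = _ := by rw [Finset.sum_comm]; simp only [← Finset.mul_sum, nbs_sub]

lemma Ham_symm {d : ℕ} (B : Finset (Fin d → ℤ)) (V F G : (Fin d → ℤ) → ℝ)
    (hF : ∀ x ∉ B, F x = 0) (hG : ∀ x ∉ B, G x = 0) :
    ∑ x ∈ B, F x * Ham V G x = ∑ x ∈ B, G x * Ham V F x := by
  have h := nbs_symm B F G hF hG
  have e : ∀ F G : (Fin d → ℤ) → ℝ, ∑ x ∈ B, F x * Ham V G x =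
      ∑ x ∈ B, F x * nbs G x + ∑ x ∈ B, (V x - 2 * d) * (F x * G x) := by
    intro F G; rw [← Finset.sum_add_distrib]
    refine Finset.sum_congr rfl fun x _ => ?_
    unfold Ham; ring
  rw [e, e, h]; congr 1
  refine Finset.sum_congr rfl fun x _ => by ring

lemma nbs_form_le {d : ℕ} (B : Finset (Fin d → ℤ)) (F : (Fin d → ℤ) → ℝ)
    (hF : ∀ x ∉ B, F x = 0) : ∑ x ∈ B, F x * nbs F x ≤ 2 * d * ∑ x ∈ B, F x ^ 2 := by
  calc ∑ x ∈ B, F x * nbs F x = ∑ p : Fin d × Bool, ∑ x ∈ B, F x * F (x + dir p) := by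
        simp only [nbs, Finset.mul_sum]; rw [Finset.sum_comm]
    _ ≤ ∑ p : Fin d × Bool, ∑ x ∈ B, F x ^ 2 := by
        refine Finset.sum_le_sum fun p _ => ?_
        have h1 : ∑ x ∈ B, F x * F (x + dir p) ≤ ∑ x ∈ B, (F x ^ 2 / 2 + F (x + dir p) ^ 2 / 2) :=
          Finset.sum_le_sum fun x _ => by nlinarith [sq_nonneg (F x - F (x + dir p))]
        rw [Finset.sum_add_distrib, ← Finset.sum_div, ← Finset.sum_div] at h1
        have h2 := sum_shift_le B (fun x => F x ^ 2) (fun _ => sq_nonneg _) (fun x hx => by simp [hF x hx]) (dir p) B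
        linarith
    _ = _ := by rw [Finset.sum_const, card_dir, nsmul_eq_mul]; push_cast; rfl

/-- The form inequality. -/
lemma form_ineq {d : ℕ} (B Q Pk : Finset (Fin d → ℤ)) (V ψ : (Fin d → ℤ) → ℝ)
    (N : (Fin d → ℤ) → Finset (Fin d → ℤ)) (F : (Fin d → ℤ) → (Fin d → ℤ) → ℝ) (θ : (Fin d → ℤ) → ℝ)
    (a m κ : ℝ) (hm : 1 ≤ m) (hκ : κ ≤ 1 / 17)
    (hQ : Q ⊆ B) (hNB : ∀ y ∈ Pk, N y ⊆ B)
    (hdisj : ∀ y ∈ Pk, ∀ z ∈ Pk, y ≠ z → Disjoint (N y) (N z))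
    (hyN : ∀ y ∈ Pk, y ∈ N y)
    (hF : ∀ y ∈ Pk, ∀ x ∉ N y, F y x = 0) (hHF : ∀ y ∈ Pk, ∀ x ∉ N y, Ham V (F y) x = 0)
    (hn : ∀ y ∈ Pk, ∑ x ∈ B, F y x ^ 2 = 1) (hF0 : ∀ y ∈ Pk, 1 - κ ≤ F y y ^ 2)
    (hV1 : ∀ y ∈ Pk, V y ≤ a + 1) (hV2 : ∀ x, x ∉ Pk → (x ∈ Q ∨ ∃ y ∈ Pk, x ∈ N y) → V x ≤ a - m)
    (hψ : ∀ x ∉ Q, ψ x = 0) :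
    (∑ y ∈ Pk, (∑ x ∈ B, ψ x * F y x) ^ 2 ≤ ∑ x ∈ B, ψ x ^ 2) ∧
    ∑ x ∈ B, ψ x * Ham V ψ x ≤
      ∑ y ∈ Pk, ((∑ x ∈ B, F y x * Ham V (F y) x) +
          (∑ x ∈ B, (Ham V (F y) x - θ y * F y x) ^ 2) / (m / 4)) * (∑ x ∈ B, ψ x * F y x) ^ 2
        + (a - m / 4) * (∑ x ∈ B, ψ x ^ 2 - ∑ y ∈ Pk, (∑ x ∈ B, ψ x * F y x) ^ 2) := by
  classical
  set b : (Fin d → ℤ) → ℝ := fun y => ∑ x ∈ B, ψ x * F y x with hb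
  set G : (Fin d → ℤ) → ℝ := fun x => ∑ y ∈ Pk, b y * F y x with hG
  set χ : (Fin d → ℤ) → ℝ := fun x => ψ x - G x with hχ
  have hψe : ψ = fun x => G x + χ x := by funext x; simp [hχ]
  have hFB : ∀ y ∈ Pk, ∀ x ∉ B, F y x = 0 := fun y hy x hx => hF y hy x fun h => hx (hNB y hy h)
  have hψB : ∀ x ∉ B, ψ x = 0 := fun x hx => hψ x fun h => hx (hQ h)
  have hGB : ∀ x ∉ B, G x = 0 := fun x hx => Finset.sum_eq_zero fun y hy => by rw [hFB y hy x hx, mul_zero]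
  have hχB : ∀ x ∉ B, χ x = 0 := fun x hx => by simp [hχ, hψB x hx, hGB x hx]
  -- orthogonality
  have horth : ∀ y ∈ Pk, ∀ z ∈ Pk, y ≠ z → ∀ x, F y x * F z x = 0 := by
    intro y hy z hz hne x
    by_cases h1 : x ∈ N y
    · have : x ∉ N z := Finset.disjoint_left.1 (hdisj y hy z hz hne) h1
      rw [hF z hz x this, mul_zero]
    · rw [hF y hy x h1, zero_mul]
  have horth2 : ∀ y ∈ Pk, ∀ z ∈ Pk, y ≠ z → ∀ x, F y x * Ham V (F z) x = 0 := by
    intro y hy z hz hne x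
    by_cases h1 : x ∈ N y
    · have : x ∉ N z := Finset.disjoint_left.1 (hdisj y hy z hz hne) h1
      rw [hHF z hz x this, mul_zero]
    · rw [hF y hy x h1, zero_mul]
  have hGF : ∀ y ∈ Pk, ∑ x ∈ B, G x * F y x = b y := by
    intro y hy
    have : ∀ x ∈ B, G x * F y x = b y * F y x ^ 2 := by
      intro x _
      simp only [hG, Finset.sum_mul]
      rw [Finset.sum_eq_single y]
      · ring
      · intro z hz hne; rw [mul_assoc, horth z hz y hy hne, mul_zero]
      · intro h; exact absurd hy h
    rw [Finset.sum_congr rfl this, ← Finset.mul_sum, hn y hy, mul_one]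
  have hχF : ∀ y ∈ Pk, ∑ x ∈ B, χ x * F y x = 0 := by
    intro y hy
    simp only [hχ, sub_mul, Finset.sum_sub_distrib, hGF y hy, hb, sub_self]
  have hGχ : ∑ x ∈ B, G x * χ x = 0 := by
    simp only [hG, Finset.sum_mul]
    rw [Finset.sum_comm]
    refine Finset.sum_eq_zero fun y hy => ?_
    have := hχF y hy
    calc ∑ x ∈ B, b y * F y x * χ x = b y * ∑ x ∈ B, χ x * F y x := by
          rw [Finset.mul_sum]; refine Finset.sum_congr rfl fun x _ => by ring
      _ = 0 := by rw [this, mul_zero]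
  have hGG : ∑ x ∈ B, G x ^ 2 = ∑ y ∈ Pk, b y ^ 2 := by
    calc ∑ x ∈ B, G x ^ 2 = ∑ x ∈ B, ∑ y ∈ Pk, b y * (G x * F y x) := by
          refine Finset.sum_congr rfl fun x _ => ?_
          rw [sq]; nth_rewrite 2 [hG]; rw [Finset.mul_sum]
          refine Finset.sum_congr rfl fun y _ => by ring
      _ = ∑ y ∈ Pk, b y ^ 2 := by
          rw [Finset.sum_comm]
          refine Finset.sum_congr rfl fun y hy => ?_
          rw [← Finset.mul_sum, hGF y hy, sq]
  have hpyth : ∑ x ∈ B, ψ x ^ 2 = ∑ y ∈ Pk, b y ^ 2 + ∑ x ∈ B, χ x ^ 2 := by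
    rw [← hGG]
    have : ∀ x ∈ B, ψ x ^ 2 = G x ^ 2 + χ x ^ 2 + 2 * (G x * χ x) := by
      intro x _; simp only [hχ]; ring
    rw [Finset.sum_congr rfl this, Finset.sum_add_distrib, Finset.sum_add_distrib, ← Finset.mul_sum, hGχ]; ring
  have hχn : 0 ≤ ∑ x ∈ B, χ x ^ 2 := Finset.sum_nonneg fun _ _ => sq_nonneg _
  refine ⟨by rw [hpyth]; linarith, ?_⟩
  -- energy expansion
  have hE : ∑ x ∈ B, ψ x * Ham V ψ x = ∑ x ∈ B, G x * Ham V G x + 2 * ∑ x ∈ B, χ x * Ham V G x + ∑ x ∈ B, χ x * Ham V χ x := by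
    have hs := Ham_symm B V G χ hGB hχB
    have : ∀ x ∈ B, ψ x * Ham V ψ x = G x * Ham V G x + χ x * Ham V G x + (G x * Ham V χ x + χ x * Ham V χ x) := by
      intro x _
      have e1 : Ham V ψ x = Ham V G x + Ham V χ x := by rw [hψe]; exact Ham_add V G χ x
      have e2 : ψ x = G x + χ x := by rw [hψe]
      rw [e1, e2]; ring
    rw [Finset.sum_congr rfl this, Finset.sum_add_distrib, Finset.sum_add_distrib, Finset.sum_add_distrib, hs]; ring
  have hE1 : ∑ x ∈ B, G x * Ham V G x = ∑ y ∈ Pk, (∑ x ∈ B, F y x * Ham V (F y) x) * b y ^ 2 := by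
    have : ∀ x ∈ B, G x * Ham V G x = ∑ y ∈ Pk, b y ^ 2 * (F y x * Ham V (F y) x) := by
      intro x _
      have e1 : Ham V G x = ∑ y ∈ Pk, b y * Ham V (F y) x := Ham_sum Pk b V F x
      rw [e1]; simp only [hG]
      rw [Finset.sum_mul]
      refine Finset.sum_congr rfl fun y hy => ?_
      rw [Finset.mul_sum, Finset.sum_eq_single y]
      · ring
      · intro z hz hne
        have := horth2 y hy z hz hne.symm x
        calc b y * F y x * (b z * Ham V (F z) x) = b y * b z * (F y x * Ham V (F z) x) := by ring
          _ = 0 := by rw [this, mul_zero]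
      · intro h; exact absurd hy h
    rw [Finset.sum_congr rfl this, Finset.sum_comm]
    refine Finset.sum_congr rfl fun y _ => ?_
    rw [← Finset.mul_sum, mul_comm]
  have hcells : ∑ y ∈ Pk, ∑ x ∈ N y, χ x ^ 2 ≤ ∑ x ∈ B, χ x ^ 2 := by
    rw [← Finset.sum_biUnion]
    · exact Finset.sum_le_sum_of_subset_of_nonneg (Finset.biUnion_subset.2 hNB) fun _ _ _ => sq_nonneg _
    · intro y hy z hz hne; exact hdisj y hy z hz hne
  have hE2 : 2 * ∑ x ∈ B, χ x * Ham V G x ≤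
      ∑ y ∈ Pk, (∑ x ∈ B, (Ham V (F y) x - θ y * F y x) ^ 2) / (m / 4) * b y ^ 2 + (m / 4) * ∑ x ∈ B, χ x ^ 2 := by
    have e1 : ∑ x ∈ B, χ x * Ham V G x = ∑ y ∈ Pk, b y * ∑ x ∈ B, χ x * (Ham V (F y) x - θ y * F y x) := by
      have : ∀ x ∈ B, χ x * Ham V G x = ∑ y ∈ Pk, b y * (χ x * Ham V (F y) x) := by
        intro x _
        have e1 : Ham V G x = ∑ y ∈ Pk, b y * Ham V (F y) x := Ham_sum Pk b V F x
        rw [e1, Finset.mul_sum]; refine Finset.sum_congr rfl fun y _ => by ring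
      rw [Finset.sum_congr rfl this, Finset.sum_comm]
      refine Finset.sum_congr rfl fun y hy => ?_
      rw [← Finset.mul_sum]
      congr 1
      have h0 := hχF y hy
      have : ∀ x ∈ B, χ x * (Ham V (F y) x - θ y * F y x) = χ x * Ham V (F y) x - θ y * (χ x * F y x) := by
        intro x _; ring
      rw [Finset.sum_congr rfl this, Finset.sum_sub_distrib, ← Finset.mul_sum, h0]; ring
    have e2 : ∀ y ∈ Pk, 2 * (b y * ∑ x ∈ B, χ x * (Ham V (F y) x - θ y * F y x)) ≤
        (∑ x ∈ B, (Ham V (F y) x - θ y * F y x) ^ 2) / (m / 4) * b y ^ 2 + (m / 4) * ∑ x ∈ N y, χ x ^ 2 := by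
      intro y hy
      have r1 : ∑ x ∈ B, χ x * (Ham V (F y) x - θ y * F y x) = ∑ x ∈ N y, χ x * (Ham V (F y) x - θ y * F y x) := by
        symm; refine Finset.sum_subset (hNB y hy) fun x _ hx => ?_
        rw [hF y hy x hx, hHF y hy x hx]; ring
      have r2 : ∑ x ∈ N y, (Ham V (F y) x - θ y * F y x) ^ 2 ≤ ∑ x ∈ B, (Ham V (F y) x - θ y * F y x) ^ 2 :=
        Finset.sum_le_sum_of_subset_of_nonneg (hNB y hy) fun _ _ _ => sq_nonneg _
      rw [r1]
      have r3 : 2 * (b y * ∑ x ∈ N y, χ x * (Ham V (F y) x - θ y * F y x)) ≤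
          ∑ x ∈ N y, ((Ham V (F y) x - θ y * F y x) ^ 2 / (m / 4) * b y ^ 2 + (m / 4) * χ x ^ 2) := by
        rw [Finset.mul_sum, Finset.mul_sum]
        refine Finset.sum_le_sum fun x _ => ?_
        set hh := Ham V (F y) x - θ y * F y x
        have : 0 ≤ (b y * hh - (m / 4) * χ x) ^ 2 / (m / 4) := by positivity
        have e : (b y * hh - (m / 4) * χ x) ^ 2 / (m / 4) = hh ^ 2 / (m / 4) * b y ^ 2 + (m / 4) * χ x ^ 2 - 2 * (b y * (χ x * hh)) := by
          field_simp; ring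
        linarith
      refine r3.trans ?_
      rw [Finset.sum_add_distrib, ← Finset.mul_sum, ← Finset.sum_mul, ← Finset.sum_div]
      have hm4 : 0 < m / 4 := by linarith
      gcongr
    rw [e1, Finset.mul_sum]
    refine (Finset.sum_le_sum e2).trans ?_
    rw [Finset.sum_add_distrib, ← Finset.mul_sum]
    have := mul_le_mul_of_nonneg_left hcells (by linarith : 0 ≤ m / 4)
    linarith
  have hE3 : ∑ x ∈ B, χ x * Ham V χ x ≤ (a - m / 2) * ∑ x ∈ B, χ x ^ 2 := by
    have hform := nbs_form_le B χ hχB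
    have e1 : ∑ x ∈ B, χ x * Ham V χ x = ∑ x ∈ B, χ x * nbs χ x - 2 * d * ∑ x ∈ B, χ x ^ 2 + ∑ x ∈ B, V x * χ x ^ 2 := by
      rw [Finset.mul_sum, ← Finset.sum_sub_distrib, ← Finset.sum_add_distrib]
      refine Finset.sum_congr rfl fun x _ => ?_
      unfold Ham; ring
    have e2 : ∑ x ∈ B, V x * χ x ^ 2 ≤ (a - m) * ∑ x ∈ B, χ x ^ 2 + ∑ y ∈ Pk, (m + 1) * χ y ^ 2 := by
      have hPB : Pk ⊆ B := fun y hy => hNB y hy (hyN y hy)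
      have e3 : ∑ y ∈ Pk, (m + 1) * χ y ^ 2 = ∑ x ∈ B, if x ∈ Pk then (m + 1) * χ x ^ 2 else 0 := by
        rw [← Finset.sum_filter]; congr 1; ext x; simp only [Finset.mem_filter]
        exact ⟨fun h => ⟨hPB h, h⟩, fun h => h.2⟩
      rw [e3, Finset.mul_sum, ← Finset.sum_add_distrib]
      refine Finset.sum_le_sum fun x _ => ?_
      by_cases hx : x ∈ Pk
      · rw [if_pos hx]
        have := mul_le_mul_of_nonneg_right (hV1 x hx) (sq_nonneg (χ x))
        linarith
      · rw [if_neg hx, add_zero]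
        by_cases hx2 : x ∈ Q ∨ ∃ y ∈ Pk, x ∈ N y
        · exact mul_le_mul_of_nonneg_right (hV2 x hx hx2) (sq_nonneg _)
        · push Not at hx2
          have : χ x = 0 := by
            have g0 : G x = 0 := Finset.sum_eq_zero fun y hy => by rw [hF y hy x (hx2.2 y hy), mul_zero]
            simp [hχ, g0, hψ x hx2.1]
          rw [this]; simp
    have e4 : ∀ y ∈ Pk, χ y ^ 2 ≤ (1 / 8) * ∑ x ∈ N y, χ x ^ 2 := by
      intro y hy
      have q1 : ∑ x ∈ N y, χ x * F y x = 0 := by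
        rw [← hχF y hy]
        exact Finset.sum_subset (hNB y hy) fun x _ hx => by rw [hF y hy x hx, mul_zero]
      have q2 : ∑ x ∈ N y, F y x ^ 2 = 1 := by
        rw [← hn y hy]
        exact Finset.sum_subset (hNB y hy) fun x _ hx => by rw [hF y hy x hx]; simp
      rw [← Finset.add_sum_erase _ _ (hyN y hy)] at q1 q2
      have q3 := Finset.sum_mul_sq_le_sq_mul_sq ((N y).erase y) χ (F y)
      have q4 : (χ y * F y y) ^ 2 = (∑ x ∈ (N y).erase y, χ x * F y x) ^ 2 := by
        have : χ y * F y y = - ∑ x ∈ (N y).erase y, χ x * F y x := by linarith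
        rw [this]; ring
      rw [← q4, mul_pow] at q3
      have q5 : ∑ x ∈ (N y).erase y, χ x ^ 2 ≤ ∑ x ∈ N y, χ x ^ 2 :=
        Finset.sum_le_sum_of_subset_of_nonneg (Finset.erase_subset _ _) fun _ _ _ => sq_nonneg _
      have q0 : 0 ≤ ∑ x ∈ (N y).erase y, χ x ^ 2 := Finset.sum_nonneg fun _ _ => sq_nonneg _
      have q6 := hF0 y hy
      have q7 : ∑ x ∈ (N y).erase y, F y x ^ 2 ≤ 1 / 17 := by linarith
      have q8 : 16 / 17 ≤ F y y ^ 2 := by linarith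
      have q9 : χ y ^ 2 * (16 / 17) ≤ (∑ x ∈ N y, χ x ^ 2) * (1 / 17) := by
        calc χ y ^ 2 * (16 / 17) ≤ χ y ^ 2 * F y y ^ 2 := by gcongr
          _ ≤ _ := q3
          _ ≤ _ := by
            refine mul_le_mul q5 q7 (Finset.sum_nonneg fun _ _ => sq_nonneg _) (q0.trans q5)
      have q10 : 0 ≤ ∑ x ∈ N y, χ x ^ 2 := q0.trans q5
      linarith
    have e5 : ∑ y ∈ Pk, (m + 1) * χ y ^ 2 ≤ (m / 2) * ∑ x ∈ B, χ x ^ 2 := by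
      rw [← Finset.mul_sum]
      have := Finset.sum_le_sum e4
      rw [← Finset.mul_sum] at this
      have h8 : ∑ y ∈ Pk, χ y ^ 2 ≤ (1 / 8) * ∑ x ∈ B, χ x ^ 2 := by linarith
      have h9 := mul_le_mul_of_nonneg_left h8 (by linarith : 0 ≤ m + 1)
      have h10 : (m + 1) * ((1 / 8) * ∑ x ∈ B, χ x ^ 2) ≤ (m / 2) * ∑ x ∈ B, χ x ^ 2 := by
        nlinarith
      linarith
    rw [e1]; nlinarith
  rw [hE, hE1, hpyth]
  have : ∑ y ∈ Pk, ((∑ x ∈ B, F y x * Ham V (F y) x) + (∑ x ∈ B, (Ham V (F y) x - θ y * F y x) ^ 2) / (m / 4)) * b y ^ 2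
      = ∑ y ∈ Pk, (∑ x ∈ B, F y x * Ham V (F y) x) * b y ^ 2 +
        ∑ y ∈ Pk, (∑ x ∈ B, (Ham V (F y) x - θ y * F y x) ^ 2) / (m / 4) * b y ^ 2 := by
    rw [← Finset.sum_add_distrib]; refine Finset.sum_congr rfl fun y _ => by ring
  rw [this]
  nlinarith

lemma basis_complete {d : ℕ} {Q : Finset (Fin d → ℤ)} {V : (Fin d → ℤ) → ℝ} {lam : ℕ → ℝ} {phi : ℕ → (Fin d → ℤ) → ℝ}
    (h : IsDirichletEigenbasis Q V lam phi) (x y : Fin d → ℤ) (hx : x ∈ Q) (hy : y ∈ Q) :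
    ∑ l ∈ Finset.range Q.card, phi l x * phi l y = if x = y then 1 else 0 := by
  classical
  let O : Matrix (Fin Q.card) Q ℝ := Matrix.of fun l x => phi l x.1
  have h1 : O * O.transpose = 1 := by
    ext i j
    simp only [Matrix.mul_apply, O, Matrix.transpose_apply, Matrix.of_apply]
    have := h.2.2 i i.2 j j.2
    rw [← Finset.sum_coe_sort] at this
    rw [this, Matrix.one_apply]
    simp [Fin.ext_iff]
  have h2 : O.transpose * O = 1 := (Matrix.mul_eq_one_comm_of_card_eq (Fin Q.card) Q ℝ (by simp)).1 h1
  have h3 := congrFun (congrFun h2 ⟨x, hx⟩) ⟨y, hy⟩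
  simp only [Matrix.mul_apply, O, Matrix.transpose_apply, Matrix.of_apply, Matrix.one_apply, Subtype.mk.injEq] at h3
  rw [Finset.sum_range (fun l => phi l x * phi l y), h3]

lemma basis_parseval {d : ℕ} {Q : Finset (Fin d → ℤ)} {V : (Fin d → ℤ) → ℝ} {lam : ℕ → ℝ} {phi : ℕ → (Fin d → ℤ) → ℝ}
    (h : IsDirichletEigenbasis Q V lam phi) (F G : (Fin d → ℤ) → ℝ) :
    ∑ l ∈ Finset.range Q.card, (∑ x ∈ Q, phi l x * F x) * (∑ x ∈ Q, phi l x * G x) = ∑ x ∈ Q, F x * G x := by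
  classical
  calc ∑ l ∈ Finset.range Q.card, (∑ x ∈ Q, phi l x * F x) * (∑ x ∈ Q, phi l x * G x)
      = ∑ x ∈ Q, ∑ y ∈ Q, (∑ l ∈ Finset.range Q.card, phi l x * phi l y) * (F x * G y) := by
        simp only [Finset.sum_mul_sum]
        rw [Finset.sum_comm]
        refine Finset.sum_congr rfl fun x _ => ?_
        rw [Finset.sum_comm]
        refine Finset.sum_congr rfl fun y _ => ?_
        rw [Finset.sum_mul]
        refine Finset.sum_congr rfl fun l _ => by ring
    _ = ∑ x ∈ Q, ∑ y ∈ Q, (if x = y then 1 else 0) * (F x * G y) := by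
        refine Finset.sum_congr rfl fun x hx => Finset.sum_congr rfl fun y hy => ?_
        rw [basis_complete h x y hx hy]
    _ = _ := by
        refine Finset.sum_congr rfl fun x hx => ?_
        simp [hx]

lemma eig_Ham {d : ℕ} {Q : Finset (Fin d → ℤ)} {V : (Fin d → ℤ) → ℝ} {lam : ℝ} {phi : (Fin d → ℤ) → ℝ}
    (h : IsDirichletEigenpair Q V lam phi) (x : Fin d → ℤ) (hx : x ∈ Q) : Ham V phi x = lam * phi x := by
  have := h.2 x hx
  rw [sum_adj Q phi h.1] at this
  exact this

lemma basis_energy {d : ℕ} {Q : Finset (Fin d → ℤ)} {V : (Fin d → ℤ) → ℝ} {lam : ℕ → ℝ} {phi : ℕ → (Fin d → ℤ) → ℝ}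
    (h : IsDirichletEigenbasis Q V lam phi) (F : (Fin d → ℤ) → ℝ) (hF : ∀ x ∉ Q, F x = 0) :
    ∑ l ∈ Finset.range Q.card, lam l * (∑ x ∈ Q, phi l x * F x) ^ 2 = ∑ x ∈ Q, F x * Ham V F x := by
  rw [← Finset.sum_congr rfl (fun x _ => mul_comm (Ham V F x) (F x)), ← basis_parseval h]
  refine Finset.sum_congr rfl fun l hl => ?_
  have hl' := h.1 l (Finset.mem_range.1 hl)
  rw [Ham_symm Q V (phi l) F hl'.1 hF]
  have : ∑ x ∈ Q, F x * Ham V (phi l) x = lam l * ∑ x ∈ Q, phi l x * F x := by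
    rw [Finset.mul_sum]
    refine Finset.sum_congr rfl fun x hx => ?_
    rw [eig_Ham hl' x hx]; ring
  rw [this]; ring


set_option maxHeartbeats 1000000 in
/-- The finite-dimensional comparison lemma. -/
lemma numbers {ι : Type*} [DecidableEq ι] (n k : ℕ) (hkn : k < n) (Pk : Finset ι) (y : ℕ → ι) (b : ℕ → ι → ℝ)
    (lam M : ℕ → ℝ) (A : ι → ℝ) (Ainf T δ ε : ℝ) (hT : 1 ≤ T) (hδ : 0 < δ) (hδ1 : δ ≤ 1) (hε : 0 ≤ ε) (hε1 : ε ≤ 1)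
    (hlam : ∀ i j, i ≤ j → j < n → lam j ≤ lam i)
    (hy : ∀ j ≤ k, y j ∈ Pk) (hyi : ∀ i ≤ k, ∀ j ≤ k, y i = y j → i = j)
    (hcol : ∀ j ≤ k, ∑ l ∈ range n, b l (y j) ^ 2 = 1)
    (hmu : ∀ j ≤ k, M j - ε ≤ ∑ l ∈ range n, lam l * b l (y j) ^ 2)
    (hrow : ∀ l < n, ∑ z ∈ Pk, b l z ^ 2 ≤ 1)
    (hup : ∀ l < n, lam l ≤ ∑ z ∈ Pk, A z * b l z ^ 2 + Ainf * (1 - ∑ z ∈ Pk, b l z ^ 2))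
    (hA : ∀ j ≤ k, A (y j) ≤ M j + ε)
    (hA2 : ∀ z ∈ Pk, (∀ j ≤ k, z ≠ y j) → A z ≤ M k - δ + ε) (hAinf : Ainf ≤ M k - δ + ε)
    (hM : ∀ i j, i < j → j ≤ k → M j ≤ M i - δ) (hMT : ∀ j ≤ k, |M j| ≤ T)
    (hsmall : (k + 1) * ((4 + 12 * T * (k + 1)) / δ) ^ (k + 1) * ε ≤ 1 / 2) :
    ∀ j ≤ k, 1 - ((4 + 12 * T * (k + 1)) / δ) ^ (j + 1) * ε ≤ b j (y j) ^ 2 := by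
  set R := (4 + 12 * T * (k + 1)) / δ with hR
  have hk0 : (0 : ℝ) ≤ k := Nat.cast_nonneg k
  have hRδ : R * δ = 4 + 12 * T * (k + 1) := by rw [hR]; field_simp
  have hR1 : 1 ≤ R := by
    rw [hR, le_div_iff₀ hδ]; nlinarith
  have hMk : ∀ j ≤ k, M k ≤ M j := by
    intro j hj
    rcases hj.lt_or_eq with h | h
    · have := hM j k h le_rfl; linarith
    · rw [h]
  have hMabs : ∀ j ≤ k, M j ≤ T ∧ -T ≤ M j := fun j hj => ⟨(abs_le.1 (hMT j hj)).2, (abs_le.1 (hMT j hj)).1⟩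
  have hAT : ∀ z ∈ Pk, A z ≤ T + ε := by
    intro z hz
    by_cases h : ∃ j ≤ k, z = y j
    · obtain ⟨j, hj, rfl⟩ := h
      have := hA j hj; have := (hMabs j hj).1; linarith
    · push Not at h
      have := hA2 z hz h; have := (hMabs k le_rfl).1; linarith
  have hlamT : ∀ l < n, lam l ≤ T + ε := by
    intro l hl
    refine (hup l hl).trans ?_
    have h1 : ∑ z ∈ Pk, A z * b l z ^ 2 ≤ (T + ε) * ∑ z ∈ Pk, b l z ^ 2 := by
      rw [Finset.mul_sum]
      exact Finset.sum_le_sum fun z hz => mul_le_mul_of_nonneg_right (hAT z hz) (sq_nonneg _)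
    have h2 : Ainf * (1 - ∑ z ∈ Pk, b l z ^ 2) ≤ (T + ε) * (1 - ∑ z ∈ Pk, b l z ^ 2) := by
      refine mul_le_mul_of_nonneg_right ?_ (by have := hrow l hl; linarith)
      have := (hMabs k le_rfl).1; linarith
    linarith
  intro j
  induction j using Nat.strong_induction_on with
  | _ j ih =>
  intro hj
  have hjn : j < n := lt_of_le_of_lt hj hkn
  set σ := ∑ l ∈ range j, b l (y j) ^ 2 with hσ
  set σ' := ∑ i ∈ range j, b j (y i) ^ 2 with hσ'
  set s := k * R ^ j * ε with hs
  have hjk : (j : ℝ) ≤ k := by exact_mod_cast hj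
  have hRj : 0 ≤ R ^ j * ε := by positivity
  have tmono : ∀ i < j, R ^ (i + 1) * ε ≤ R ^ j * ε := fun i hi =>
    mul_le_mul_of_nonneg_right (pow_le_pow_right₀ hR1 hi) hε
  have hσ0 : 0 ≤ σ := Finset.sum_nonneg fun _ _ => sq_nonneg _
  have hσ'0 : 0 ≤ σ' := Finset.sum_nonneg fun _ _ => sq_nonneg _
  have hcard : ∀ F : ℕ → ℝ, (∀ i < j, F i ≤ R ^ j * ε) → ∑ i ∈ range j, F i ≤ s := by
    intro F hF
    have := Finset.sum_le_card_nsmul (range j) F _ (fun i hi => hF i (Finset.mem_range.1 hi))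
    rw [card_range, nsmul_eq_mul] at this
    refine this.trans ?_
    rw [hs, mul_assoc]
    exact mul_le_mul_of_nonneg_right hjk hRj
  have hσs : σ ≤ s := by
    refine hcard _ fun i hi => ?_
    have hik : i ≤ k := (le_of_lt hi).trans hj
    have h1 := ih i hi hik
    have h2 := hrow i (lt_of_le_of_lt hik hkn)
    have h3 : b i (y i) ^ 2 + b i (y j) ^ 2 ≤ ∑ z ∈ Pk, b i z ^ 2 := by
      have hne : y i ≠ y j := fun h => hi.ne (hyi i hik j hj h)
      rw [← Finset.sum_pair (f := fun z => b i z ^ 2) hne]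
      refine Finset.sum_le_sum_of_subset_of_nonneg ?_ fun _ _ _ => sq_nonneg _
      intro z hz; rcases Finset.mem_insert.1 hz with rfl | hz
      · exact hy i hik
      · rw [Finset.mem_singleton.1 hz]; exact hy j hj
    have := tmono i hi
    linarith
  have hσ's : σ' ≤ s := by
    refine hcard _ fun i hi => ?_
    have hik : i ≤ k := (le_of_lt hi).trans hj
    have h1 := ih i hi hik
    have h2 := hcol i hik
    have h3 : b i (y i) ^ 2 + b j (y i) ^ 2 ≤ ∑ l ∈ range n, b l (y i) ^ 2 := by
      rw [← Finset.sum_pair (f := fun l => b l (y i) ^ 2) hi.ne]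
      refine Finset.sum_le_sum_of_subset_of_nonneg ?_ fun _ _ _ => sq_nonneg _
      intro z hz; rcases Finset.mem_insert.1 hz with rfl | hz
      · exact Finset.mem_range.2 (hi.trans hjn)
      · rw [Finset.mem_singleton.1 hz]; exact Finset.mem_range.2 hjn
    have := tmono i hi
    linarith
  have hs2 : s ≤ 1 / 2 := by
    refine le_trans ?_ hsmall
    have : R ^ j ≤ R ^ (k + 1) := pow_le_pow_right₀ hR1 (by omega)
    rw [hs]
    have : (k : ℝ) * R ^ j ≤ (k + 1) * R ^ (k + 1) := by
      refine mul_le_mul (by linarith) this (by positivity) (by positivity)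
    exact mul_le_mul_of_nonneg_right this hε
  obtain ⟨mT, mT'⟩ := hMabs j hj
  -- lower bound
  have low : M j - ε ≤ (T + ε) * σ + lam j * (1 - σ) := by
    refine (hmu j hj).trans ?_
    have hc := hcol j hj
    rw [← Finset.sum_range_add_sum_Ico _ hjn.le] at hc ⊢
    have h1 : ∑ l ∈ range j, lam l * b l (y j) ^ 2 ≤ (T + ε) * σ := by
      rw [hσ, Finset.mul_sum]
      exact Finset.sum_le_sum fun l hl => mul_le_mul_of_nonneg_right (hlamT l ((Finset.mem_range.1 hl).trans hjn)) (sq_nonneg _)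
    have h2 : ∑ l ∈ Ico j n, lam l * b l (y j) ^ 2 ≤ lam j * ∑ l ∈ Ico j n, b l (y j) ^ 2 := by
      rw [Finset.mul_sum]
      refine Finset.sum_le_sum fun l hl => mul_le_mul_of_nonneg_right ?_ (sq_nonneg _)
      exact hlam j l (Finset.mem_Ico.1 hl).1 (Finset.mem_Ico.1 hl).2
    have h3 : ∑ l ∈ Ico j n, b l (y j) ^ 2 = 1 - σ := by linarith
    rw [h3] at h2; linarith
  -- upper bound
  set β := b j (y j) ^ 2 with hβ
  have up : lam j ≤ M j + ε + 2 * T * σ' + δ * σ' - δ * (1 - β) := by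
    refine (hup j hjn).trans ?_
    have hr := hrow j hjn
    set top := (range (j + 1)).image y with htop
    have htopsub : top ⊆ Pk := by
      intro z hz
      obtain ⟨i, hi, rfl⟩ := Finset.mem_image.1 hz
      exact hy i (by have := Finset.mem_range.1 hi; omega)
    have hinj : Set.InjOn y (range (j + 1)) := by
      intro i hi i' hi' h
      have h1 := Finset.mem_range.1 (Finset.mem_coe.1 hi)
      have h2 := Finset.mem_range.1 (Finset.mem_coe.1 hi')
      exact hyi i (by omega) i' (by omega) h
    have hsplit : ∀ F : ι → ℝ, ∑ z ∈ Pk, F z = ∑ i ∈ range j, F (y i) + F (y j) + ∑ z ∈ Pk \ top, F z := by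
      intro F
      rw [← Finset.sum_sdiff htopsub, htop, Finset.sum_image hinj, Finset.sum_range_succ]; ring
    rw [hsplit (fun z => b j z ^ 2)] at hr ⊢
    rw [hsplit (fun z => A z * b j z ^ 2)]
    have h1 : ∑ i ∈ range j, A (y i) * b j (y i) ^ 2 ≤ (T + ε) * σ' := by
      rw [hσ', Finset.mul_sum]
      refine Finset.sum_le_sum fun i hi => mul_le_mul_of_nonneg_right (hAT _ (hy i ?_)) (sq_nonneg _)
      have := Finset.mem_range.1 hi; omega
    have h2 : A (y j) * b j (y j) ^ 2 ≤ (M j + ε) * β := mul_le_mul_of_nonneg_right (hA j hj) (sq_nonneg _)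
    have h3 : ∑ z ∈ Pk \ top, A z * b j z ^ 2 ≤ (M j - δ + ε) * ∑ z ∈ Pk \ top, b j z ^ 2 := by
      rw [Finset.mul_sum]
      refine Finset.sum_le_sum fun z hz => mul_le_mul_of_nonneg_right ?_ (sq_nonneg _)
      obtain ⟨hz1, hz2⟩ := Finset.mem_sdiff.1 hz
      by_cases h : ∃ i ≤ k, z = y i
      · obtain ⟨i, hi, rfl⟩ := h
        have hji : j < i := by
          by_contra hc
          exact hz2 (Finset.mem_image.2 ⟨i, Finset.mem_range.2 (by omega), rfl⟩)
        have := hA i hi; have := hM j i hji hi; linarith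
      · push Not at h
        have := hA2 z hz1 h; have := hMk j hj; linarith
    set τ := ∑ z ∈ Pk \ top, b j z ^ 2 with hτ
    have h4 : Ainf * (1 - (σ' + β + τ)) ≤ (M j - δ + ε) * (1 - (σ' + β + τ)) := by
      refine mul_le_mul_of_nonneg_right ?_ (by linarith)
      have := hMk j hj; linarith
    have h5 : (T + ε) * σ' + (M j + ε) * β + (M j - δ + ε) * (1 - σ' - β) ≤ M j + ε + 2 * T * σ' + δ * σ' - δ * (1 - β) := by
      have b1 : 0 ≤ σ' * (T + M j) := mul_nonneg hσ'0 (by linarith)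
      linarith
    linarith
  -- conclusion
  have fin : δ * (1 - β) ≤ 4 * ε + 12 * T * s := by
    have h1 : (1 - σ) * lam j ≤ (1 - σ) * (M j + ε + 2 * T * σ' + δ * σ' - δ * (1 - β)) :=
      mul_le_mul_of_nonneg_left up (by linarith)
    have hs0 : 0 ≤ s := hσ0.trans hσs
    have h2 : (1 - σ) * (δ * (1 - β)) ≤ 2 * ε + 6 * T * s := by
      have a1 : 0 ≤ σ * T := by positivity
      have a2 : σ * T ≤ s * T := mul_le_mul_of_nonneg_right hσs (by linarith)
      have a3 : σ' * T ≤ s * T := mul_le_mul_of_nonneg_right hσ's (by linarith)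
      have a4 : (1 - σ) * ((2 * T + δ) * σ') ≤ (2 * T + δ) * s := by
        calc (1 - σ) * ((2 * T + δ) * σ') ≤ 1 * ((2 * T + δ) * σ') := by
              refine mul_le_mul_of_nonneg_right (by linarith) (by positivity)
          _ ≤ _ := by rw [one_mul]; exact mul_le_mul_of_nonneg_left hσ's (by positivity)
      have a5 : σ * (-M j) ≤ σ * T := mul_le_mul_of_nonneg_left (by linarith) hσ0
      have a6 : δ * s ≤ T * s := mul_le_mul_of_nonneg_right (by linarith) hs0
      linarith
    by_cases hb1 : 1 - β ≤ 0
    · have : δ * (1 - β) ≤ 0 := mul_nonpos_of_nonneg_of_nonpos hδ.le hb1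
      have : 0 ≤ 4 * ε + 12 * T * s := by positivity
      linarith
    · push Not at hb1
      have : (1 / 2) * (δ * (1 - β)) ≤ (1 - σ) * (δ * (1 - β)) :=
        mul_le_mul_of_nonneg_right (by linarith) (by positivity)
      linarith
  have hfin2 : 4 * ε + 12 * T * s ≤ δ * (R ^ (j + 1) * ε) := by
    have e1 : δ * (R ^ (j + 1) * ε) = (4 + 12 * T * (k + 1)) * (R ^ j * ε) := by
      rw [← hRδ, pow_succ]; ring
    rw [e1, hs]
    have : ε ≤ R ^ j * ε := by
      have := one_le_pow₀ (n := j) hR1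
      exact le_mul_of_one_le_left hε this
    have c1 : 0 ≤ T * (R ^ j * ε) := by positivity
    linarith
  have := le_of_mul_le_mul_left (fin.trans hfin2) hδ
  linarith


/-- The cube of radius `r`. -/
noncomputable def cube (d r : ℕ) : Finset (Fin d → ℤ) := Finset.Icc (fun _ => -(r : ℤ)) (fun _ => (r : ℤ))

lemma mem_cube {d r : ℕ} {x : Fin d → ℤ} : x ∈ cube d r ↔ ∀ i, |x i| ≤ r := by
  simp only [cube, Finset.mem_Icc, Pi.le_def, abs_le]
  exact ⟨fun h i => ⟨h.1 i, h.2 i⟩, fun h => ⟨fun i => (h i).1, fun i => (h i).2⟩⟩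

lemma cube_neg {d r : ℕ} {x : Fin d → ℤ} (h : x ∈ cube d r) : -x ∈ cube d r := by
  rw [mem_cube] at h ⊢; intro i; simpa using h i

lemma zero_mem_cube {d r : ℕ} : (0 : Fin d → ℤ) ∈ cube d r := by
  rw [mem_cube]; intro i; simp

lemma cube_dir {d r : ℕ} {x : Fin d → ℤ} (p : Fin d × Bool) (h : x + dir p ∈ cube d r) : x ∈ cube d (r + 1) := by
  rw [mem_cube] at h ⊢
  intro i
  have h1 := h i
  have h2 : |dir p i| ≤ 1 := by
    rw [← sum_abs_dir p]
    exact Finset.single_le_sum (f := fun i => |dir p i|) (fun _ _ => abs_nonneg _) (mem_univ i)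
  rw [Pi.add_apply, abs_le] at h1
  rw [abs_le] at h2 ⊢
  push_cast
  omega

lemma dir_mem_cube {d r : ℕ} (hr : 1 ≤ r) (p : Fin d × Bool) : dir p ∈ cube d r := by
  rw [mem_cube]; intro i
  have h2 : |dir p i| ≤ 1 := by
    rw [← sum_abs_dir p]
    exact Finset.single_le_sum (f := fun i => |dir p i|) (fun _ _ => abs_nonneg _) (mem_univ i)
  have : (1 : ℤ) ≤ r := by exact_mod_cast hr
  linarith

/-- fluctuation field (with the true covariance). -/
def zt {d : ℕ} (u V : (Fin d → ℤ) → ℝ) (y x : Fin d → ℤ) : ℝ := V (y + x) - u x * V y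

noncomputable def XX {d : ℕ} (C : Finset (Fin d → ℤ)) (f u V : (Fin d → ℤ) → ℝ) (y : Fin d → ℤ) : ℝ :=
  ∑ x ∈ C, f x ^ 2 * zt u V y x

noncomputable def ZZ {d : ℕ} (C : Finset (Fin d → ℤ)) (f u V : (Fin d → ℤ) → ℝ) (y : Fin d → ℤ) : ℝ :=
  ∑ x ∈ C, f x ^ 2 * zt u V y x ^ 2

noncomputable def bet {d : ℕ} (C : Finset (Fin d → ℤ)) (f u : (Fin d → ℤ) → ℝ) : ℝ :=
  ∑ x ∈ C, f x ^ 2 * (1 - u x)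

/-- translate -/
def sh {d : ℕ} (f : (Fin d → ℤ) → ℝ) (y x : Fin d → ℤ) : ℝ := f (x - y)

lemma sum_sh {d : ℕ} (B C : Finset (Fin d → ℤ)) (y : Fin d → ℤ) (hB : ∀ z ∈ C, y + z ∈ B)
    (G : (Fin d → ℤ) → ℝ) (hG : ∀ z ∉ C, G z = 0) : ∑ x ∈ B, G (x - y) = ∑ z ∈ C, G z := by
  classical
  have : ∑ z ∈ C, G z = ∑ x ∈ C.image (fun z => y + z), G (x - y) := by
    rw [Finset.sum_image (by intro a _ b _ h; exact add_left_cancel h)]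
    simp
  rw [this]; symm
  refine Finset.sum_subset ?_ ?_
  · intro x hx; obtain ⟨z, hz, rfl⟩ := Finset.mem_image.1 hx; exact hB z hz
  · intro x _ hx
    apply hG; intro h
    exact hx (Finset.mem_image.2 ⟨x - y, h, by simp⟩)

lemma nbs_sh {d : ℕ} (f : (Fin d → ℤ) → ℝ) (y x : Fin d → ℤ) : nbs (sh f y) x = nbs f (x - y) := by
  unfold nbs sh
  refine Finset.sum_congr rfl fun p _ => ?_
  congr 1; abel

section
variable {d r : ℕ} {a K lam : ℝ} {u f : (Fin d → ℤ) → ℝ}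

lemma ham_in (h : LocEig (cube d r) (fun x => a * (1 - u x)) K lam f) (V : (Fin d → ℤ) → ℝ)
    (y x : Fin d → ℤ) (hx : x - y ∈ cube d r) :
    Ham V (sh f y) x = (V y + lam + zt u V y (x - y) + (a - V y) * (1 - u (x - y))) * f (x - y) := by
  have := h.eq _ hx
  unfold Ham; rw [nbs_sh, this]; simp only [sh, zt]
  have e : y + (x - y) = x := by abel
  rw [e]; ring

lemma ham_out (h : LocEig (cube d r) (fun x => a * (1 - u x)) K lam f) (V : (Fin d → ℤ) → ℝ)
    (y x : Fin d → ℤ) (hx : x - y ∉ cube d r) :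
    Ham V (sh f y) x = nbs f (x - y) := by
  unfold Ham; rw [nbs_sh]; simp only [sh]; rw [h.supp _ hx]; ring

lemma nbs_far (h : LocEig (cube d r) (fun x => a * (1 - u x)) K lam f)
    (x : Fin d → ℤ) (hx : x ∉ cube d (r + 1)) : nbs f x = 0 :=
  Finset.sum_eq_zero fun p _ => h.supp _ fun hp => hx (cube_dir p hp)

lemma mu_eq (h : LocEig (cube d r) (fun x => a * (1 - u x)) K lam f) (V : (Fin d → ℤ) → ℝ)
    (y : Fin d → ℤ) (B : Finset (Fin d → ℤ)) (hB : ∀ z ∈ cube d r, y + z ∈ B) :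
    ∑ x ∈ B, sh f y x * Ham V (sh f y) x = lam + V y + (a - V y) * bet (cube d r) f u + XX (cube d r) f u V y := by
  have e : ∀ x ∈ B, sh f y x * Ham V (sh f y) x =
      (fun z => f z ^ 2 * (V y + lam) + (a - V y) * (f z ^ 2 * (1 - u z)) + f z ^ 2 * zt u V y z) (x - y) := by
    intro x _
    by_cases hx : x - y ∈ cube d r
    · rw [ham_in h V y x hx]; simp only [sh]; ring
    · simp only [sh, h.supp _ hx]; ring
  rw [Finset.sum_congr rfl e]
  refine (sum_sh B (cube d r) y hB (fun z => f z ^ 2 * (V y + lam) + (a - V y) * (f z ^ 2 * (1 - u z)) + f z ^ 2 * zt u V y z)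
    (fun z hz => by simp [h.supp z hz])).trans ?_
  rw [Finset.sum_add_distrib, Finset.sum_add_distrib, ← Finset.sum_mul, h.norm, ← Finset.mul_sum]
  unfold bet XX; ring

lemma sh_norm (h : LocEig (cube d r) (fun x => a * (1 - u x)) K lam f)
    (y : Fin d → ℤ) (B : Finset (Fin d → ℤ)) (hB : ∀ z ∈ cube d r, y + z ∈ B) :
    ∑ x ∈ B, sh f y x ^ 2 = 1 := by
  rw [← h.norm]
  exact sum_sh B (cube d r) y hB (fun z => f z ^ 2) (fun z hz => by simp [h.supp z hz])

lemma h_le (h : LocEig (cube d r) (fun x => a * (1 - u x)) K lam f) (hr : 1 ≤ r)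
    (hu0 : ∀ x, 0 ≤ u x) (hu1 : ∀ x, u x ≤ 1) (V : (Fin d → ℤ) → ℝ)
    (y : Fin d → ℤ) (B : Finset (Fin d → ℤ)) (hB : ∀ z ∈ cube d (r + 1), y + z ∈ B) :
    ∑ x ∈ B, (Ham V (sh f y) x - (V y + lam) * sh f y x) ^ 2 ≤
      2 * ZZ (cube d r) f u V y + 2 * (a - V y) ^ 2 * bet (cube d r) f u + 32 * d ^ 4 / (K ^ 2 * r ^ 2) := by
  classical
  have hsub : cube d r ⊆ cube d (r + 1) := by
    intro x hx; rw [mem_cube] at hx ⊢; intro i; have := hx i; push_cast; omega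
  set G : (Fin d → ℤ) → ℝ := fun z => if z ∈ cube d r then ((zt u V y z + (a - V y) * (1 - u z)) * f z) ^ 2 else nbs f z ^ 2 with hG
  have e : ∀ x ∈ B, (Ham V (sh f y) x - (V y + lam) * sh f y x) ^ 2 = G (x - y) := by
    intro x _
    by_cases hx : x - y ∈ cube d r
    · rw [ham_in h V y x hx]; simp only [sh, hG, if_pos hx]; ring
    · rw [ham_out h V y x hx]; simp only [sh, hG, if_neg hx, h.supp _ hx]; ring
  rw [Finset.sum_congr rfl e, sum_sh B (cube d (r + 1)) y hB G (fun z hz => by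
    simp only [hG]; rw [if_neg (fun h' => hz (hsub h')), nbs_far h z hz]; simp)]
  rw [← Finset.sum_sdiff hsub]
  have h1 : ∑ z ∈ cube d r, G z ≤ 2 * ZZ (cube d r) f u V y + 2 * (a - V y) ^ 2 * bet (cube d r) f u := by
    unfold ZZ bet
    rw [Finset.mul_sum, Finset.mul_sum, ← Finset.sum_add_distrib]
    refine Finset.sum_le_sum fun z hz => ?_
    simp only [hG, if_pos hz]
    have h2 : (1 - u z) ^ 2 ≤ 1 - u z := by nlinarith [hu0 z, hu1 z]
    have h3 : (zt u V y z + (a - V y) * (1 - u z)) ^ 2 ≤ 2 * zt u V y z ^ 2 + 2 * ((a - V y) ^ 2 * (1 - u z)) := by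
      have : (a - V y) ^ 2 * (1 - u z) ^ 2 ≤ (a - V y) ^ 2 * (1 - u z) := mul_le_mul_of_nonneg_left h2 (sq_nonneg _)
      nlinarith [sq_nonneg (zt u V y z - (a - V y) * (1 - u z))]
    have := mul_le_mul_of_nonneg_right h3 (sq_nonneg (f z))
    rw [mul_pow]; linarith
  have hr0 : (0 : ℝ) < r := by exact_mod_cast hr
  have h2 : ∑ z ∈ cube d (r + 1) \ cube d r, G z ≤ 32 * d ^ 4 / (K ^ 2 * r ^ 2) := by
    have s1 : ∀ z ∈ cube d (r + 1) \ cube d r, G z ≤ 2 * d * ∑ p : Fin d × Bool, (fun w => n1 w ^ 2 * f w ^ 2) (z + dir p) / r ^ 2 := by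
      intro z hz
      have hz' := (Finset.mem_sdiff.1 hz).2
      simp only [hG, if_neg hz']
      have := sq_sum_le_card_mul_sum_sq (s := (univ : Finset (Fin d × Bool))) (f := fun p => f (z + dir p))
      rw [card_dir] at this
      unfold nbs
      push_cast at this
      refine this.trans ?_
      refine mul_le_mul_of_nonneg_left (Finset.sum_le_sum fun p _ => ?_) (by positivity)
      rw [le_div_iff₀ (by positivity), mul_comm]
      refine mul_le_mul_of_nonneg_right ?_ (sq_nonneg _)
      by_cases hp : ∃ i, (r : ℤ) ≤ |(z + dir p) i|
      · obtain ⟨i, hi⟩ := hp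
        have := n1_coord (z + dir p) i
        have h5 : (r : ℝ) ≤ |((z + dir p) i : ℝ)| := by exact_mod_cast hi
        gcongr; linarith
      · exfalso
        push Not at hp
        apply hz'
        rw [mem_cube]; intro i
        have h6 := hp i
        have h2 : |dir p i| ≤ 1 := by
          rw [← sum_abs_dir p]
          exact Finset.single_le_sum (f := fun i => |dir p i|) (fun _ _ => abs_nonneg _) (mem_univ i)
        rw [Pi.add_apply, abs_lt] at h6
        rw [abs_le] at h2 ⊢
        omega
    refine (Finset.sum_le_sum s1).trans ?_
    rw [← Finset.mul_sum, Finset.sum_comm]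
    have s2 : ∀ p ∈ (univ : Finset (Fin d × Bool)), ∑ z ∈ cube d (r + 1) \ cube d r, (fun w => n1 w ^ 2 * f w ^ 2) (z + dir p) / r ^ 2 ≤ (8 * d ^ 2 / K ^ 2) / r ^ 2 := by
      intro p _
      rw [← Finset.sum_div]
      refine div_le_div_of_nonneg_right ?_ (by positivity)
      refine (sum_shift_le (cube d r) (fun w => n1 w ^ 2 * f w ^ 2) (fun _ => by positivity) (fun x hx => by simp [h.supp x hx]) (dir p) _).trans h.N_le
    have s3 := Finset.sum_le_card_nsmul _ _ _ s2
    rw [card_dir, nsmul_eq_mul] at s3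
    calc 2 * (d : ℝ) * _ ≤ 2 * d * (((2 * d : ℕ) : ℝ) * ((8 * d ^ 2 / K ^ 2) / r ^ 2)) := mul_le_mul_of_nonneg_left s3 (by positivity)
      _ = _ := by have := h.Kpos; push_cast; field_simp; ring
  linarith

end


noncomputable def YY {d : ℕ} (C : Finset (Fin d → ℤ)) (f u V : (Fin d → ℤ) → ℝ) (a m : ℝ) (y : Fin d → ℤ) : ℝ :=
  a * XX C f u V y ^ 2 + 8 / m * ZZ C f u V y

lemma ZZ_nonneg {d : ℕ} (C : Finset (Fin d → ℤ)) (f u V : (Fin d → ℤ) → ℝ) (y : Fin d → ℤ) : 0 ≤ ZZ C f u V y :=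
  Finset.sum_nonneg fun _ _ => by positivity

lemma site_small (a m w β X Z bd T T1 ε1 : ℝ) (ha : 0 < a) (hm : 0 < m) (hw : T / a ≤ w) (hwm : w ≤ m) (hw0 : 0 ≤ w)
    (hβ0 : 0 ≤ β) (hβ : 36 * β ≤ 1) (hbd : a * (4 * bd / m) ≤ ε1) (hε : ε1 ≤ 1 / 4) (hT : 2 * T1 + 3 ≤ T)
    (hY : a * X ^ 2 + 8 / m * Z ≤ w / 16) :
    a * (-w + w * β + X + (2 * Z + 2 * w ^ 2 * β + bd) / (m / 4)) ≤ -T1 - 1 := by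
  have e : (2 * Z + 2 * w ^ 2 * β + bd) / (m / 4) = 8 / m * Z + 8 * (w ^ 2 / m) * β + 4 * bd / m := by field_simp; ring
  have h1 : w ^ 2 / m ≤ w := by rw [div_le_iff₀ hm]; nlinarith
  have h2 : 8 * (w ^ 2 / m) * β ≤ 8 * w * β := by gcongr
  have h3 : X ≤ a * X ^ 2 + 1 / (4 * a) := by
    have : 0 ≤ a * (X - 1 / (2 * a)) ^ 2 := by positivity
    have e : a * (X - 1 / (2 * a)) ^ 2 = a * X ^ 2 + 1 / (4 * a) - X := by field_simp; ring
    linarith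
  have h4 : w * β ≤ w / 36 := by
    have := mul_le_mul_of_nonneg_left hβ hw0; linarith
  have h5 : T ≤ a * w := by rw [div_le_iff₀ ha] at hw; linarith
  have h6 : a * (1 / (4 * a)) = 1 / 4 := by field_simp
  have h7 : -w + w * β + X + (2 * Z + 2 * w ^ 2 * β + bd) / (m / 4) ≤ -w / 2 + 1 / (4 * a) + 4 * bd / m := by
    rw [e]; linarith
  have := mul_le_mul_of_nonneg_left h7 ha.le
  linarith

lemma site_good (a m w β X Z bd T ε1 : ℝ) (ha : 0 < a) (hm : 0 < m) (hw : |w| ≤ T / a) (hwm : T / a ≤ m)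
    (hβ0 : 0 ≤ β) (hβ : 9 * T * β ≤ ε1) (hbd : a * (4 * bd / m) ≤ ε1) (hε0 : 0 ≤ ε1) (hε : ε1 ≤ 1) (hZ : 0 ≤ Z)
    (hY : a * (a * X ^ 2 + 8 / m * Z) ≤ ε1 ^ 2) :
    a * (-w + w * β + X + (2 * Z + 2 * w ^ 2 * β + bd) / (m / 4)) ≤ -(a * w) + 4 * ε1 ∧
    -(a * w) - 4 * ε1 ≤ a * (-w + w * β + X) := by
  have e : (2 * Z + 2 * w ^ 2 * β + bd) / (m / 4) = 8 / m * Z + 8 * (w ^ 2 / m) * β + 4 * bd / m := by field_simp; ring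
  have h1 : w ^ 2 / m ≤ |w| := by
    rw [div_le_iff₀ hm, ← sq_abs]; have := abs_nonneg w; nlinarith
  have h2 : 8 * (w ^ 2 / m) * β ≤ 8 * |w| * β := by gcongr
  have h3 : (a * X) ^ 2 ≤ ε1 ^ 2 := by
    have : 0 ≤ a * (8 / m * Z) := by positivity
    have e : (a * X) ^ 2 = a * (a * X ^ 2) := by ring
    linarith
  have h4 : a * (8 / m * Z) ≤ ε1 := by
    have : 0 ≤ a * (a * X ^ 2) := by positivity
    nlinarith
  have h5 := abs_le.1 (abs_le_of_sq_le_sq h3 hε0)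
  have h6 : a * |w| ≤ T := by rw [le_div_iff₀ ha] at hw; linarith
  have h7 : a * |w| * β ≤ T * β := mul_le_mul_of_nonneg_right h6 hβ0
  have h8 : |w * β| = |w| * β := by rw [abs_mul, abs_of_nonneg hβ0]
  have h9 := abs_le.1 h8.le
  have h10 : a * (w * β) ≤ a * (|w| * β) := mul_le_mul_of_nonneg_left h9.2 ha.le
  have h11 : a * (-(|w| * β)) ≤ a * (w * β) := mul_le_mul_of_nonneg_left h9.1 ha.le
  have h12 : 0 ≤ T * β := le_trans (by positivity) h7
  have h13 := mul_le_mul_of_nonneg_left h2 ha.le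
  constructor
  · rw [e]; linarith
  · linarith

section
variable {d r : ℕ} {a K lt : ℝ} {u f : (Fin d → ℤ) → ℝ}

/-- Conclusion of localisation from overlap. -/
lemma overlap_loc (Q : Finset (Fin d → ℤ)) (φ F : (Fin d → ℤ) → ℝ) (y : Fin d → ℤ) (hy : y ∈ Q)
    (hφ : ∑ x ∈ Q, φ x ^ 2 = 1) (hF : ∑ x ∈ Q, F x ^ 2 = 1) (hF0 : 99 / 100 ≤ F y ^ 2)
    (hb : 99 / 100 ≤ (∑ x ∈ Q, φ x * F x) ^ 2) : 1 / 2 < φ y ^ 2 := by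
  classical
  have e1 := Finset.add_sum_erase Q (fun x => φ x ^ 2) hy
  have e2 := Finset.add_sum_erase Q (fun x => F x ^ 2) hy
  have e3 := Finset.add_sum_erase Q (fun x => φ x * F x) hy
  have cs := Finset.sum_mul_sq_le_sq_mul_sq (Q.erase y) φ F
  set s := ∑ x ∈ Q.erase y, φ x * F x
  have hp : 0 ≤ ∑ x ∈ Q.erase y, φ x ^ 2 := Finset.sum_nonneg fun _ _ => sq_nonneg _
  have hs : s ^ 2 ≤ 1 / 100 := by
    refine cs.trans ?_
    have h1 : ∑ x ∈ Q.erase y, φ x ^ 2 ≤ 1 := by rw [← hφ, ← e1]; linarith [sq_nonneg (φ y)]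
    have h2 : ∑ x ∈ Q.erase y, F x ^ 2 ≤ 1 / 100 := by linarith
    have h3 : 0 ≤ ∑ x ∈ Q.erase y, F x ^ 2 := Finset.sum_nonneg fun _ _ => sq_nonneg _
    nlinarith
  rw [← e3] at hb
  have hF1 : F y ^ 2 ≤ 1 := by
    have h3 : 0 ≤ ∑ x ∈ Q.erase y, F x ^ 2 := Finset.sum_nonneg fun _ _ => sq_nonneg _
    linarith
  have h4 : (φ y * F y + s) ^ 2 ≤ (1 + 1 / 4) * (φ y * F y) ^ 2 + 5 * s ^ 2 := by
    nlinarith [sq_nonneg ((1 / 2) * (φ y * F y) - 2 * s)]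
  have h5 : (φ y * F y) ^ 2 ≤ φ y ^ 2 := by
    rw [mul_pow]; nlinarith [sq_nonneg (φ y)]
  linarith

end


/-- All good events at one realisation. -/
structure Good {d : ℕ} (Q : Finset (Fin d → ℤ)) (r k : ℕ) (f u V : (Fin d → ℤ) → ℝ) (a m T T1 δ ε1 : ℝ) : Prop where
  G1 : ∀ y ∈ Q, ∀ x, x ≠ y → x - y ∈ cube d (2 * r + 2) → ¬(a - m < V y ∧ a - m < V x)
  G2 : ∀ x ∈ Q, V x ≤ a + T / a
  G3 : k + 1 ≤ (Q.filter (fun x => a - T1 / a < V x)).card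
  G4 : ∀ x ∈ Q, ∀ z ∈ Q, x ≠ z → a - T / a < V x → a - T / a < V z → δ / a < |V x - V z|
  G5 : ∀ x ∈ Q, a - T / a < V x → ∀ z ∈ cube d r, x + z ∈ Q
  G6 : ∀ x ∈ Q, a - T / a < V x → a * YY (cube d r) f u V a m x ≤ ε1 ^ 2
  G7 : ∀ x ∈ Q, V x ≤ a - T / a → YY (cube d r) f u V a m x ≤ (a - V x) / 16

/-- Numerical smallness conditions. -/
structure NumC (d r k : ℕ) (a m K β T T1 δ ε1 : ℝ) : Prop where
  ha : 0 < a
  hm : 1 ≤ m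
  hr : 1 ≤ r
  hT1 : 1 ≤ T1
  hT : 2 * T1 + 3 ≤ T
  hTa : T / a ≤ 1
  hδ : 0 < δ
  hδ1 : δ ≤ 1
  hε0 : 0 ≤ ε1
  hε1 : ε1 ≤ 1 / 4
  hsmall : (k + 1) * ((4 + 12 * T * (k + 1)) / δ) ^ (k + 1) * (4 * ε1) ≤ 1 / 100
  hβ0 : 0 ≤ β
  hβ36 : 36 * β ≤ 1
  hβT : 9 * T * β ≤ ε1
  hbd : a * (4 * (32 * d ^ 4 / (K ^ 2 * r ^ 2)) / m) ≤ ε1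
  hK : 8 * (d : ℝ) ^ 2 / K ^ 2 ≤ 1 / 100
  hAinf : T1 + 1 ≤ a * (m / 4 - 2 * d)

set_option maxHeartbeats 2000000 in
lemma det {d r k : ℕ} {a K lt m T T1 δ ε1 : ℝ} {u f V : (Fin d → ℤ) → ℝ} {Q : Finset (Fin d → ℤ)}
    (h : LocEig (cube d r) (fun x => a * (1 - u x)) K lt f)
    (hu0 : ∀ x, 0 ≤ u x) (hu1 : ∀ x, u x ≤ 1)
    (hN : NumC d r k a m K (bet (cube d r) f u) T T1 δ ε1)
    (hG : Good Q r k f u V a m T T1 δ ε1)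
    {lam : ℕ → ℝ} {phi : ℕ → (Fin d → ℤ) → ℝ} (hb : IsDirichletEigenbasis Q V lam phi)
    (y : ℕ → (Fin d → ℤ)) (hym : ∀ j < Q.card, y j ∈ Q)
    (hyi : ∀ i < Q.card, ∀ j < Q.card, y i = y j → i = j)
    (hymono : ∀ i j : ℕ, i ≤ j → j < Q.card → V (y j) ≤ V (y i)) :
    k < Q.card ∧ 1 / 2 < phi k (y k) ^ 2 := by
  classical
  have ha := hN.ha
  have hT0 : 0 < T := by have := hN.hT; have := hN.hT1; linarith
  have hTT : T1 / a ≤ T / a := div_le_div_of_nonneg_right (by have := hN.hT; have := hN.hT1; linarith) ha.le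
  have hm0 : 0 < m := by have := hN.hm; linarith
  set n := Q.card with hn
  set β := bet (cube d r) f u with hβ
  -- the sites y
  have hcover : (range n).image y = Q := by
    apply Finset.eq_of_subset_of_card_le
    · intro x hx; obtain ⟨j, hj, rfl⟩ := Finset.mem_image.1 hx; exact hym j (Finset.mem_range.1 hj)
    · rw [Finset.card_image_of_injOn]
      · simp [hn]
      · intro i hi j hj hij
        exact hyi i (by simpa using hi) j (by simpa using hj) hij
  have hkn : k < n := by
    have := hG.G3.trans (Finset.card_filter_le _ _); omega
  have hyT1 : ∀ j ≤ k, a - T1 / a < V (y j) := by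
    intro j hj
    by_contra hc
    push Not at hc
    have : Q.filter (fun x => a - T1 / a < V x) ⊆ (range j).image y := by
      intro x hx
      obtain ⟨hx1, hx2⟩ := Finset.mem_filter.1 hx
      rw [← hcover] at hx1
      obtain ⟨l, hl, rfl⟩ := Finset.mem_image.1 hx1
      refine Finset.mem_image.2 ⟨l, ?_, rfl⟩
      by_contra hlj
      have := hymono j l (by simpa using hlj) (Finset.mem_range.1 hl)
      linarith
    have h1 := Finset.card_le_card this
    have h2 := Finset.card_image_le (s := range j) (f := y)
    have h3 := hG.G3
    rw [card_range] at h2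
    omega
  have hyT : ∀ j ≤ k, a - T / a < V (y j) := fun j hj => by have := hyT1 j hj; linarith
  have hyQ : ∀ j ≤ k, y j ∈ Q := fun j hj => hym j (by omega)
  set Pk := Q.filter (fun x => a - m < V x) with hPk
  have hTm : T / a ≤ m := hN.hTa.trans hN.hm
  set N : (Fin d → ℤ) → Finset (Fin d → ℤ) := fun y => (cube d (r + 1)).image (fun z => y + z) with hNdef
  set B := Q ∪ Pk.biUnion N with hB
  have hQB : Q ⊆ B := Finset.subset_union_left
  have memN : ∀ y x, x ∈ N y ↔ x - y ∈ cube d (r + 1) := by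
    intro y x; simp only [hNdef, Finset.mem_image]
    constructor
    · rintro ⟨z, hz, rfl⟩; simpa using hz
    · intro hx; exact ⟨x - y, hx, by abel⟩
  have hsub : cube d r ⊆ cube d (r + 1) := by
    intro x hx; rw [mem_cube] at hx ⊢; intro i; have := hx i; push_cast; omega
  have hNB : ∀ y ∈ Pk, N y ⊆ B := fun y hy x hx =>
    Finset.mem_union_right _ (Finset.mem_biUnion.2 ⟨y, hy, hx⟩)
  have hBz : ∀ y ∈ Pk, ∀ z ∈ cube d (r + 1), y + z ∈ B := fun y hy z hz =>
    hNB y hy (by rw [memN]; simpa using hz)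
  have hBz' : ∀ y ∈ Pk, ∀ z ∈ cube d r, y + z ∈ B := fun y hy z hz => hBz y hy z (hsub hz)
  have cube2 : ∀ x y w : Fin d → ℤ, x - y ∈ cube d (r + 1) → x - w ∈ cube d (r + 1) → w - y ∈ cube d (2 * r + 2) := by
    intro x y w h1 h2; rw [mem_cube] at *
    intro i; have h1 := h1 i; have h2 := h2 i
    simp only [Pi.sub_apply, abs_le] at *; push_cast at *; omega
  have cube3 : cube d (r + 1) ⊆ cube d (2 * r + 2) := by
    intro x hx; rw [mem_cube] at hx ⊢; intro i; have := hx i; push_cast at *; omega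
  have hdisj : ∀ y ∈ Pk, ∀ z ∈ Pk, y ≠ z → Disjoint (N y) (N z) := by
    intro y hy z hz hyz
    rw [Finset.disjoint_left]
    intro x hx hx'
    rw [memN] at hx hx'
    have h1 := Finset.mem_filter.1 hy
    have h2 := Finset.mem_filter.1 hz
    exact hG.G1 y h1.1 z hyz.symm (cube2 x y z hx hx') ⟨h1.2, h2.2⟩
  have hV1 : ∀ y ∈ Pk, V y ≤ a + 1 := fun y hy => by
    have := hG.G2 y (Finset.mem_filter.1 hy).1; have := hN.hTa; linarith
  have hV2 : ∀ x, x ∉ Pk → (x ∈ Q ∨ ∃ y ∈ Pk, x ∈ N y) → V x ≤ a - m := by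
    intro x hx hor
    by_contra hc
    push Not at hc
    rcases hor with hxQ | ⟨y, hy, hxy⟩
    · exact hx (Finset.mem_filter.2 ⟨hxQ, hc⟩)
    · have h1 := Finset.mem_filter.1 hy
      have hne : x ≠ y := fun e => hx (e ▸ hy)
      rw [memN] at hxy
      exact hG.G1 y h1.1 x hne (cube3 hxy) ⟨h1.2, hc⟩
  have hFN : ∀ y ∈ Pk, ∀ x ∉ N y, sh f y x = 0 := by
    intro y _ x hx; rw [memN] at hx
    exact h.supp _ fun h' => hx (hsub h')
  have hHF : ∀ y ∈ Pk, ∀ x ∉ N y, Ham V (sh f y) x = 0 := by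
    intro y _ x hx; rw [memN] at hx
    rw [ham_out h V y x (fun h' => hx (hsub h')), nbs_far h _ hx]
  have hF0 : 99 / 100 ≤ f 0 ^ 2 := by have := h.f0; have := hN.hK; linarith
  have hsh0 : ∀ y, sh f y y ^ 2 = f 0 ^ 2 := fun y => by simp [sh]
  have hφQ : ∀ l < n, ∀ x ∉ Q, phi l x = 0 := fun l hl => (hb.1 l hl).1
  have sumBQ : ∀ l < n, ∀ G : (Fin d → ℤ) → ℝ, ∑ x ∈ B, phi l x * G x = ∑ x ∈ Q, phi l x * G x := by
    intro l hl G; symm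
    exact Finset.sum_subset hQB fun x _ hx => by rw [hφQ l hl x hx, zero_mul]
  have hnormφ : ∀ l < n, ∑ x ∈ B, phi l x ^ 2 = 1 := by
    intro l hl
    have := hb.2.2 l hl l hl
    simp only [if_true] at this
    rw [← this]; simp only [pow_two]; exact sumBQ l hl _
  have hform := fun l (hl : l < n) => form_ineq B Q Pk V (phi l) N (sh f) (fun y => V y + lt) a m (1 / 100) hN.hm (by norm_num)
    hQB hNB hdisj (fun y _ => by rw [memN]; simp [zero_mem_cube]) hFN hHF
    (fun y hy => sh_norm h y B (hBz' y hy)) (fun y _ => by rw [hsh0]; linarith) hV1 hV2 (hφQ l hl)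
  set A : (Fin d → ℤ) → ℝ := fun z => a * ((∑ x ∈ B, sh f z x * Ham V (sh f z) x) +
    (∑ x ∈ B, (Ham V (sh f z) x - (V z + lt) * sh f z x) ^ 2) / (m / 4) - lt - a) with hA
  set bd : ℝ := 32 * d ^ 4 / (K ^ 2 * r ^ 2) with hbd
  have hAle : ∀ z ∈ Pk, A z ≤ a * (-(a - V z) + (a - V z) * β + XX (cube d r) f u V z +
      (2 * ZZ (cube d r) f u V z + 2 * (a - V z) ^ 2 * β + bd) / (m / 4)) := by
    intro z hz
    simp only [hA]
    rw [mu_eq h V z B (hBz' z hz)]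
    refine mul_le_mul_of_nonneg_left ?_ ha.le
    have := div_le_div_of_nonneg_right (h_le h hN.hr hu0 hu1 V z B (hBz z hz)) (by positivity : 0 ≤ m / 4)
    linarith
  have hgood : ∀ z ∈ Pk, a - T / a < V z → A z ≤ a * (V z - a) + 4 * ε1 ∧
      a * (V z - a) - 4 * ε1 ≤ a * (V z - a + (a - V z) * β + XX (cube d r) f u V z) := by
    intro z hz hzT
    have hzQ := (Finset.mem_filter.1 hz).1
    have h1 := hG.G2 z hzQ
    have := site_good a m (a - V z) β (XX (cube d r) f u V z) (ZZ (cube d r) f u V z) bd T ε1 ha hm0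
      (abs_le.2 ⟨by linarith, by linarith⟩) hTm hN.hβ0 hN.hβT hN.hbd hN.hε0 (by have := hN.hε1; linarith)
      (ZZ_nonneg _ _ _ _ _) (hG.G6 z hzQ hzT)
    constructor
    · have h2 := hAle z hz; linarith [this.1]
    · linarith [this.2]
  have hyPk : ∀ j ≤ k, y j ∈ Pk := fun j hj => Finset.mem_filter.2 ⟨hyQ j hj, by have := hyT j hj; linarith⟩
  have hMlow : ∀ j ≤ k, -T1 ≤ a * (V (y j) - a) := by
    intro j hj
    have := hyT1 j hj
    have h2 : -(T1 / a) ≤ V (y j) - a := by linarith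
    have h3 := mul_le_mul_of_nonneg_left h2 ha.le
    have h4 : a * (-(T1 / a)) = -T1 := by field_simp
    linarith
  have hgap : ∀ x ∈ Q, ∀ z ∈ Q, x ≠ z → a - T / a < V x → a - T / a < V z → V z ≤ V x → a * (V z - a) ≤ a * (V x - a) - δ := by
    intro x hx z hz hxz h1 h2 h3
    have h4 := hG.G4 x hx z hz hxz h1 h2
    rw [abs_of_nonneg (by linarith), div_lt_iff₀ ha] at h4
    linarith
  have hnum := numbers n k hkn Pk y (fun l z => ∑ x ∈ B, phi l x * sh f z x) (fun l => a * (lam l - lt - a))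
    (fun j => a * (V (y j) - a)) A (a * (-(m / 4) - lt)) T δ (4 * ε1) (by have := hN.hT; have := hN.hT1; linarith) hN.hδ hN.hδ1
    (by have := hN.hε0; linarith) (by have := hN.hε1; linarith)
    (fun i j hij hj => mul_le_mul_of_nonneg_left (by have := hb.2.1 i (by omega) j hj hij; linarith) ha.le)
    hyPk (fun i hi j hj => hyi i (by omega) j (by omega))
    ?_ ?_ ?_ ?_ (fun j hj => (hgood _ (hyPk j hj) (hyT j hj)).1) ?_ ?_ ?_ ?_ ?_
  · refine ⟨hkn, ?_⟩
    have h1 := hnum k le_rfl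
    rw [sumBQ k hkn] at h1
    have hR : ((4 + 12 * T * (k + 1)) / δ) ^ (k + 1) * (4 * ε1) ≤ 1 / 100 := by
      refine le_trans ?_ hN.hsmall
      have hδ := hN.hδ
      have h0 : 0 ≤ ((4 + 12 * T * (k + 1)) / δ) ^ (k + 1) * (4 * ε1) := by have := hN.hε0; positivity
      refine (le_mul_of_one_le_left h0 (?_ : (1 : ℝ) ≤ k + 1)).trans (le_of_eq (mul_assoc _ _ _).symm)
      have : (0 : ℝ) ≤ k := Nat.cast_nonneg k
      linarith
    refine overlap_loc Q (phi k) (sh f (y k)) (y k) (hyQ k le_rfl) ?_ ?_ (by rw [hsh0]; exact hF0) (by linarith)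
    · have := hb.2.2 k hkn k hkn
      simp only [if_true] at this
      simpa only [pow_two] using this
    · exact sh_norm h (y k) Q (hG.G5 _ (hyQ k le_rfl) (hyT k le_rfl))
  · -- hcol
    intro j hj
    have h1 := basis_parseval hb (sh f (y j)) (sh f (y j))
    have h2 := sh_norm h (y j) Q (hG.G5 _ (hyQ j hj) (hyT j hj))
    simp only [pow_two] at h2
    rw [h2] at h1
    rw [← h1]
    refine Finset.sum_congr rfl fun l hl => ?_
    rw [sumBQ l (Finset.mem_range.1 hl), pow_two]
  · -- hmu
    intro j hj
    have hQc := hG.G5 _ (hyQ j hj) (hyT j hj)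
    have h1 := basis_energy hb (sh f (y j)) (fun x hx => h.supp _ fun hx' => hx (by
      have := hQc _ hx'
      rwa [add_sub_cancel] at this))
    rw [mu_eq h V (y j) Q hQc] at h1
    have h2 := basis_parseval hb (sh f (y j)) (sh f (y j))
    have h3 := sh_norm h (y j) Q hQc
    simp only [pow_two] at h3
    rw [h3] at h2
    have h4 : ∑ l ∈ range n, a * (lam l - lt - a) * (∑ x ∈ B, phi l x * sh f (y j) x) ^ 2 =
        a * ((∑ l ∈ range n, lam l * (∑ x ∈ Q, phi l x * sh f (y j) x) ^ 2) - (lt + a) * ∑ l ∈ range n, (∑ x ∈ Q, phi l x * sh f (y j) x) * (∑ x ∈ Q, phi l x * sh f (y j) x)) := by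
      rw [Finset.mul_sum, ← Finset.sum_sub_distrib, Finset.mul_sum]
      refine Finset.sum_congr rfl fun l hl => ?_
      rw [sumBQ l (Finset.mem_range.1 hl)]; ring
    rw [h4, h1, h2]
    have := (hgood _ (hyPk j hj) (hyT j hj)).2
    linarith
  · intro l hl
    have := (hform l hl).1
    rwa [hnormφ l hl] at this
  · intro l hl
    have h1 := (hform l hl).2
    have h2 : ∑ x ∈ B, phi l x * Ham V (phi l) x = lam l := by
      rw [sumBQ l hl]
      have h3 : ∀ x ∈ Q, phi l x * Ham V (phi l) x = lam l * phi l x ^ 2 := by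
        intro x hx; rw [eig_Ham (hb.1 l hl) x hx]; ring
      rw [Finset.sum_congr rfl h3, ← Finset.mul_sum]
      have h4 := hnormφ l hl
      simp only [pow_two] at h4 ⊢
      rw [sumBQ l hl] at h4
      rw [h4, mul_one]
    rw [h2, hnormφ l hl] at h1
    have h3 : ∑ z ∈ Pk, A z * (∑ x ∈ B, phi l x * sh f z x) ^ 2 = a * ((∑ z ∈ Pk, ((∑ x ∈ B, sh f z x * Ham V (sh f z) x) +
    (∑ x ∈ B, (Ham V (sh f z) x - (V z + lt) * sh f z x) ^ 2) / (m / 4)) * (∑ x ∈ B, phi l x * sh f z x) ^ 2) -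
      (lt + a) * ∑ z ∈ Pk, (∑ x ∈ B, phi l x * sh f z x) ^ 2) := by
      rw [Finset.mul_sum, ← Finset.sum_sub_distrib, Finset.mul_sum]
      refine Finset.sum_congr rfl fun z _ => ?_
      simp only [hA]; ring
    rw [h3]
    have h4 := mul_le_mul_of_nonneg_left h1 ha.le
    linarith
  · -- hA2
    intro z hz hzy
    have hzQ := (Finset.mem_filter.1 hz).1
    by_cases hzT : a - T / a < V z
    · have h1 := (hgood z hz hzT).1
      have h2 : V z ≤ V (y k) := by
        rw [← hcover] at hzQ
        obtain ⟨l, hl, rfl⟩ := Finset.mem_image.1 hzQ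
        refine hymono k l ?_ (Finset.mem_range.1 hl)
        by_contra hc
        exact hzy l (by omega) rfl
      have h3 := hgap (y k) (hyQ k le_rfl) z hzQ (hzy k le_rfl).symm (hyT k le_rfl) hzT h2
      linarith
    · push Not at hzT
      have h1 := hAle z hz
      have h2 := (Finset.mem_filter.1 hz).2
      have hTa0 : 0 < T / a := by positivity
      have h3 := site_small a m (a - V z) β (XX (cube d r) f u V z) (ZZ (cube d r) f u V z) bd T T1 ε1 ha hm0
        (by linarith) (by linarith) (by linarith) hN.hβ0 hN.hβ36 hN.hbd hN.hε1 hN.hT (hG.G7 z hzQ hzT)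
      have h4 := hMlow k le_rfl
      have h5 := hN.hδ1
      have h6 := hN.hε0
      linarith
  · have h4 := hMlow k le_rfl
    have h5 := hN.hδ1
    have h6 := hN.hε0
    have h7 := hN.hAinf
    have h8 : a * (-(m / 4) - lt) ≤ a * (-(m / 4) + 2 * d) := mul_le_mul_of_nonneg_left (by have := h.lamge; linarith) ha.le
    linarith
  · intro i j hij hj
    exact hgap (y i) (hyQ i (by omega)) (y j) (hyQ j hj) (fun e => hij.ne (hyi i (by omega) j (by omega) e))
      (hyT i (by omega)) (hyT j hj) (hymono i j hij.le (by omega))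
  · intro j hj
    have h4 := hMlow j hj
    have h5 := hG.G2 _ (hyQ j hj)
    have h6 : V (y j) - a ≤ T / a := by linarith
    have h7 := mul_le_mul_of_nonneg_left h6 ha.le
    have h8 : a * (T / a) = T := by field_simp
    have := hN.hT; have := hN.hT1
    exact abs_le.2 ⟨by linarith, by linarith⟩
  · refine hN.hsmall.trans (by norm_num)


lemma exp_weighted {ι : Type*} (s : Finset ι) (w t : ι → ℝ) (hw : ∀ i ∈ s, 0 ≤ w i) (hs : ∑ i ∈ s, w i ≤ 1) :
    Real.exp (∑ i ∈ s, w i * t i) ≤ ∑ i ∈ s, w i * Real.exp (t i) + (1 - ∑ i ∈ s, w i) := by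
  set S := ∑ i ∈ s, w i * t i with hS
  have h1 : ∀ x, Real.exp S * (1 + x - S) ≤ Real.exp x := by
    intro x
    have := Real.add_one_le_exp (x - S)
    have h2 : Real.exp x = Real.exp S * Real.exp (x - S) := by rw [← Real.exp_add]; congr 1; ring
    rw [h2]
    exact mul_le_mul_of_nonneg_left (by linarith) (Real.exp_pos _).le
  have h2 : ∑ i ∈ s, w i * (Real.exp S * (1 + t i - S)) ≤ ∑ i ∈ s, w i * Real.exp (t i) :=
    Finset.sum_le_sum fun i hi => mul_le_mul_of_nonneg_left (h1 _) (hw i hi)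
  have h3 : ∑ i ∈ s, w i * (Real.exp S * (1 + t i - S)) = Real.exp S * ((1 - S) * ∑ i ∈ s, w i + S) := by
    rw [hS, Finset.mul_sum, ← Finset.sum_add_distrib, Finset.mul_sum]
    refine Finset.sum_congr rfl fun i _ => by ring
  have h4 := h1 0
  rw [Real.exp_zero] at h4
  have h5 := mul_le_mul_of_nonneg_left h4 (sub_nonneg.2 hs)
  rw [h3] at h2
  nlinarith

lemma Iso.exp_sq_sum {Ω E H : Type*} [MeasurableSpace Ω] [AddCommGroup E] [Module ℝ E]
    [NormedAddCommGroup H] [InnerProductSpace ℝ H] {P : Measure Ω}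
    {X : E →ₗ[ℝ] (Ω → ℝ)} {T : E →ₗ[ℝ] H} (h : Iso P X T) {ι : Type*} (s : Finset ι) (c : ι → E) (q V : ι → ℝ)
    (hq : ∀ i ∈ s, 0 ≤ q i) (hV : ∀ i ∈ s, 0 < V i) (hv : ∀ i ∈ s, ‖T (c i)‖ ^ 2 ≤ V i)
    (hs : ∑ i ∈ s, 4 * q i * V i ≤ 1) :
    Integrable (fun ω => Real.exp (∑ i ∈ s, q i * X (c i) ω ^ 2)) P ∧
    ∫ ω, Real.exp (∑ i ∈ s, q i * X (c i) ω ^ 2) ∂P ≤ 2 := by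
  have := h.prob
  have e : ∀ ω, ∑ i ∈ s, q i * X (c i) ω ^ 2 = ∑ i ∈ s, (4 * q i * V i) * (X (c i) ω ^ 2 / (4 * V i)) := by
    intro ω
    refine Finset.sum_congr rfl fun i hi => ?_
    have := hV i hi
    field_simp
  have hw : ∀ i ∈ s, 0 ≤ 4 * q i * V i := fun i hi => by
    have := hV i hi; have := hq i hi; positivity
  have hi : ∀ i ∈ s, Integrable (fun ω => Real.exp (X (c i) ω ^ 2 / (4 * V i))) P ∧
      ∫ ω, Real.exp (X (c i) ω ^ 2 / (4 * V i)) ∂P ≤ 2 := by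
    intro i hi
    have h1 := gauss_exp_sq' (‖T (c i)‖₊ ^ 2) (Real.toNNReal (V i)) (by simpa using hV i hi) (by
      rw [← NNReal.coe_le_coe, Real.coe_toNNReal _ (hV i hi).le]; push_cast; exact hv i hi)
    rw [← h.law, Real.coe_toNNReal _ (hV i hi).le] at h1
    constructor
    · exact (integrable_map_measure (by fun_prop) (h.meas _).aemeasurable).1 h1.1
    · have := h1.2
      rwa [integral_map (h.meas _).aemeasurable (by fun_prop)] at this
  have hpt : ∀ ω, Real.exp (∑ i ∈ s, q i * X (c i) ω ^ 2) ≤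
      ∑ i ∈ s, (4 * q i * V i) * Real.exp (X (c i) ω ^ 2 / (4 * V i)) + (1 - ∑ i ∈ s, 4 * q i * V i) := by
    intro ω; rw [e]; exact exp_weighted s _ _ hw hs
  have hintg : Integrable (fun ω => ∑ i ∈ s, (4 * q i * V i) * Real.exp (X (c i) ω ^ 2 / (4 * V i)) + (1 - ∑ i ∈ s, 4 * q i * V i)) P :=
    (integrable_finsetSum s fun i hi' => ((hi i hi').1.const_mul _)).add (integrable_const _)
  have hm : Measurable (fun ω => Real.exp (∑ i ∈ s, q i * X (c i) ω ^ 2)) := by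
    refine Real.measurable_exp.comp (Finset.measurable_sum _ fun i _ => ?_)
    exact ((h.meas _).pow_const 2).const_mul _
  have hI : Integrable (fun ω => Real.exp (∑ i ∈ s, q i * X (c i) ω ^ 2)) P :=
    hintg.mono' hm.aestronglyMeasurable (ae_of_all _ fun ω => by
      rw [Real.norm_eq_abs, abs_of_pos (Real.exp_pos _)]; exact hpt ω)
  refine ⟨hI, (integral_mono hI hintg hpt).trans ?_⟩
  rw [integral_add (integrable_finsetSum s fun i hi' => ((hi i hi').1.const_mul _)) (integrable_const _),
    integral_finsetSum s (fun i hi' => ((hi i hi').1.const_mul _))]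
  simp only [integral_const_mul, integral_const, probReal_univ, smul_eq_mul, one_mul]
  have : ∑ i ∈ s, (4 * q i * V i) * ∫ ω, Real.exp (X (c i) ω ^ 2 / (4 * V i)) ∂P ≤ ∑ i ∈ s, (4 * q i * V i) * 2 :=
    Finset.sum_le_sum fun i hi' => mul_le_mul_of_nonneg_left (hi i hi').2 (hw i hi')
  rw [← Finset.sum_mul] at this
  linarith

namespace GField
variable {d : ℕ} {Ω H : Type*} [MeasurableSpace Ω] [NormedAddCommGroup H] [InnerProductSpace ℝ H]
    {P : Measure Ω} {ξ : Ω → (Fin d → ℤ) → ℝ}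
    {u : (Fin d → ℤ) → ℝ} {X : ((Fin d → ℤ) →₀ ℝ) →ₗ[ℝ] (Ω → ℝ)} {T : ((Fin d → ℤ) →₀ ℝ) →ₗ[ℝ] H}

lemma stat (G : GField P ξ u X T) (y : Fin d → ℤ) : Stat (fun x => T (Finsupp.single (y + x) 1)) u where
  inn := fun x z => by rw [G.inn]; congr 1; abel
  even := G.even
  zero := G.zero

lemma norm1 (G : GField P ξ u X T) (x : Fin d → ℤ) : ‖T (Finsupp.single x 1)‖ = 1 := by
  have h := real_inner_self_eq_norm_sq (T (Finsupp.single x 1))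
  rw [G.inn, sub_self, G.zero] at h
  have := norm_nonneg (T (Finsupp.single x 1))
  nlinarith

lemma u_le (G : GField P ξ u X T) (x : Fin d → ℤ) : u x ≤ 1 := by
  have := real_inner_le_norm (T (Finsupp.single x 1)) (T (Finsupp.single 0 1))
  rw [G.inn, G.norm1, G.norm1, sub_zero] at this
  linarith

lemma measξ (G : GField P ξ u X T) (x : Fin d → ℤ) : Measurable (fun ω => ξ ω x) := by
  have := G.iso.meas (Finsupp.single x 1)
  have e : X (Finsupp.single x 1) = fun ω => ξ ω x := funext (G.Xs x)
  rwa [e] at this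

lemma law (G : GField P ξ u X T) (x : Fin d → ℤ) : P.map (fun ω => ξ ω x) = gaussianReal 0 1 := by
  have := G.iso.law (Finsupp.single x 1)
  have e : X (Finsupp.single x 1) = fun ω => ξ ω x := funext (G.Xs x)
  rw [e] at this
  rw [this]; congr 1
  ext; push_cast; rw [G.norm1]; norm_num

lemma real_eq (G : GField P ξ u X T) (x : Fin d → ℤ) {s : Set ℝ} (hs : MeasurableSet s) :
    P.real {ω | ξ ω x ∈ s} = (gaussianReal 0 1).real s := by
  rw [← G.law x, map_measureReal_apply (G.measξ x) hs]; rfl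

lemma tail (G : GField P ξ u X T) (x : Fin d → ℤ) (a b : ℝ) (ha : 0 < a) :
    P.real {ω | b < ξ ω x} ≤ nphi a / a * Real.exp (a * (a - b)) :=
  (G.real_eq x measurableSet_Ioi).trans_le (gauss_tail_upper a b ha)

lemma near (G : GField P ξ u X T) (x z : Fin d → ℤ) (t ρ : ℝ) (ht : 0 ≤ t) (hu : u (x - z) ≤ ρ) (hρ : 0 < 1 + ρ) :
    P.real {ω | t < ξ ω x ∧ t < ξ ω z} ≤ Real.exp (-(t ^ 2 / (1 + ρ))) := by
  have := G.iso.near_pair (Finsupp.single x 1) (Finsupp.single z 1) t ρ ht (G.norm1 x) (G.norm1 z) (by rw [G.inn]; exact hu) hρ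
  simpa only [G.Xs] using this

/-- coefficient vector of `zt`. -/
noncomputable def cz (u : (Fin d → ℤ) → ℝ) (y x : Fin d → ℤ) : (Fin d → ℤ) →₀ ℝ :=
  Finsupp.single (y + x) 1 - u x • Finsupp.single y 1

lemma X_cz (G : GField P ξ u X T) (y x : Fin d → ℤ) (ω : Ω) : X (cz u y x) ω = zt u (ξ ω) y x := by
  unfold cz zt
  rw [map_sub, map_smul]
  simp only [Pi.sub_apply, Pi.smul_apply, G.Xs, smul_eq_mul]

lemma cz_orth (G : GField P ξ u X T) (y x : Fin d → ℤ) : inner ℝ (T (Finsupp.single y 1)) (T (cz u y x)) = 0 := by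
  unfold cz
  rw [map_sub, map_smul, inner_sub_right, inner_smul_right, G.inn, G.inn, sub_self, G.zero]
  have : y - (y + x) = -x := by abel
  rw [this, G.even]; ring

lemma cz_norm (G : GField P ξ u X T) (y x : Fin d → ℤ) : ‖T (cz u y x)‖ ^ 2 ≤ 2 * (1 - u x) := by
  have e : ‖T (cz u y x)‖ ^ 2 = 1 - u x ^ 2 := by
    unfold cz
    rw [map_sub, map_smul, norm_sub_sq_real, inner_smul_right, G.inn, norm_smul, G.norm1, G.norm1]
    have : y + x - y = x := by abel
    rw [this, Real.norm_eq_abs, mul_one, sq_abs]; ring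
  rw [e]
  nlinarith [G.u_le x, G.nonneg x]

noncomputable def cX (C : Finset (Fin d → ℤ)) (f u : (Fin d → ℤ) → ℝ) (y : Fin d → ℤ) : (Fin d → ℤ) →₀ ℝ :=
  ∑ x ∈ C, f x ^ 2 • cz u y x

lemma X_cX (G : GField P ξ u X T) (C : Finset (Fin d → ℤ)) (f : (Fin d → ℤ) → ℝ) (y : Fin d → ℤ) (ω : Ω) :
    X (cX C f u y) ω = XX C f u (ξ ω) y := by
  unfold cX XX
  rw [map_sum, Finset.sum_apply]
  refine Finset.sum_congr rfl fun x _ => ?_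
  rw [map_smul, Pi.smul_apply, G.X_cz, smul_eq_mul]

lemma T_cX (G : GField P ξ u X T) (C : Finset (Fin d → ℤ)) (f : (Fin d → ℤ) → ℝ) (y : Fin d → ℤ) :
    T (cX C f u y) = ∑ x ∈ C, f x ^ 2 • (T (Finsupp.single (y + x) 1) - u x • T (Finsupp.single (y + 0) 1)) := by
  unfold cX cz
  rw [map_sum]
  refine Finset.sum_congr rfl fun x _ => ?_
  rw [map_smul, map_sub, map_smul, add_zero]

/-- `zt` at `0` vanishes. -/
lemma zt_zero (G : GField P ξ u X T) (y : Fin d → ℤ) (V : (Fin d → ℤ) → ℝ) : zt u V y 0 = 0 := by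
  simp [zt, G.zero]

/-- Properties of the local fluctuation `Y`. -/
lemma Y_props (G : GField P ξ u X T) (C : Finset (Fin d → ℤ)) (f : (Fin d → ℤ) → ℝ) (a m s : ℝ) (ha : 0 < a) (hm : 0 < m)
    (hs : 0 < s) (hu : ∀ x, x ≠ 0 → u x < 1) (y : Fin d → ℤ) (hX : ‖T (cX C f u y)‖ ≤ s)
    (hsm : 128 * a ^ 2 * s ^ 2 + 2048 * a / m * bet C f u ≤ 1) :
    Measurable (fun ω => YY C f u (ξ ω) a m y) ∧ IndepFun (fun ω => ξ ω y) (fun ω => YY C f u (ξ ω) a m y) P ∧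
    (Integrable (fun ω => YY C f u (ξ ω) a m y) P ∧
      ∫ ω, a * YY C f u (ξ ω) a m y ∂P ≤ a ^ 2 * s ^ 2 + 16 * a / m * bet C f u) ∧
    (Integrable (fun ω => Real.exp (32 * (a * YY C f u (ξ ω) a m y))) P ∧
      ∫ ω, Real.exp (32 * (a * YY C f u (ξ ω) a m y)) ∂P ≤ 2) := by
  classical
  have := G.iso.prob
  have hZ : ∀ ω, ZZ C f u (ξ ω) y = ∑ x ∈ C, f x ^ 2 * X (cz u y x) ω ^ 2 := by
    intro ω; unfold ZZ; simp only [G.X_cz]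
  have hYe : ∀ ω, YY C f u (ξ ω) a m y = a * X (cX C f u y) ω ^ 2 + 8 / m * ∑ x ∈ C, f x ^ 2 * X (cz u y x) ω ^ 2 := by
    intro ω; unfold YY; rw [hZ, G.X_cX]
  have hmeas : Measurable (fun ω => YY C f u (ξ ω) a m y) := by
    simp only [hYe]
    refine (((G.iso.meas _).pow_const 2).const_mul _).add (Measurable.const_mul (Finset.measurable_sum _ fun i _ => ?_) _)
    exact ((G.iso.meas _).pow_const 2).const_mul _
  have hmemi : ∀ c, Integrable (fun ω => X c ω ^ 2) P := fun c => (G.iso.memLp c).integrable_sq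
  have hXnn : ‖T (cX C f u y)‖ ^ 2 ≤ s ^ 2 := pow_le_pow_left₀ (norm_nonneg _) hX 2
  refine ⟨hmeas, ?_, ⟨?_, ?_⟩, ?_⟩
  · have h1 := G.iso.indep (Finsupp.single y 1) (fun x : C => cz u y x.1) (fun i => G.cz_orth y i.1)
    have e : X (Finsupp.single y 1) = fun ω => ξ ω y := funext (G.Xs y)
    rw [e] at h1
    let φ : (C → ℝ) → ℝ := fun z => a * (∑ x : C, f x.1 ^ 2 * z x) ^ 2 + 8 / m * ∑ x : C, f x.1 ^ 2 * z x ^ 2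
    have hφ : Measurable φ := by fun_prop
    have h2 := h1.comp (φ := id) (ψ := φ) measurable_id hφ
    refine h2.congr (ae_of_all _ fun ω => rfl) (ae_of_all _ fun ω => ?_)
    simp only [φ, Function.comp]
    unfold YY XX ZZ
    simp only [G.X_cz]
    rw [Finset.sum_coe_sort C (fun x => f x ^ 2 * zt u (ξ ω) y x), Finset.sum_coe_sort C (fun x => f x ^ 2 * zt u (ξ ω) y x ^ 2)]
  · simp only [hYe]
    exact ((hmemi _).const_mul _).add ((integrable_finsetSum C fun x _ => (hmemi _).const_mul _).const_mul _)
  · rw [integral_const_mul]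
    simp only [hYe]
    rw [integral_add ((hmemi _).const_mul _) ((integrable_finsetSum C fun x _ => (hmemi _).const_mul _).const_mul _),
      integral_const_mul, integral_const_mul, integral_finsetSum C (fun x _ => (hmemi _).const_mul _), G.iso.sq]
    simp only [integral_const_mul, G.iso.sq]
    have h2 : ∑ x ∈ C, f x ^ 2 * ‖T (cz u y x)‖ ^ 2 ≤ 2 * bet C f u := by
      unfold bet; rw [Finset.mul_sum]
      refine Finset.sum_le_sum fun x _ => ?_
      have := mul_le_mul_of_nonneg_left (G.cz_norm y x) (sq_nonneg (f x)); linarith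
    have h3 : 8 / m * ∑ x ∈ C, f x ^ 2 * ‖T (cz u y x)‖ ^ 2 ≤ 8 / m * (2 * bet C f u) := by gcongr
    calc a * (a * ‖T (cX C f u y)‖ ^ 2 + 8 / m * ∑ x ∈ C, f x ^ 2 * ‖T (cz u y x)‖ ^ 2)
        ≤ a * (a * s ^ 2 + 8 / m * (2 * bet C f u)) := by gcongr
      _ = _ := by ring
  · have h1 := G.iso.exp_sq_sum (insertNone (C.erase 0)) (fun o => o.elim (cX C f u y) (cz u y))
      (fun o => o.elim (32 * a ^ 2) (fun x => 256 * a / m * f x ^ 2)) (fun o => o.elim (s ^ 2) (fun x => 2 * (1 - u x)))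
      ?_ ?_ ?_ ?_
    · simp only [sum_insertNone, Option.elim] at h1
      have e : ∀ ω, 32 * (a * YY C f u (ξ ω) a m y) = 32 * a ^ 2 * X (cX C f u y) ω ^ 2 + ∑ x ∈ C.erase 0, 256 * a / m * f x ^ 2 * X (cz u y x) ω ^ 2 := by
        intro ω
        have : ∑ x ∈ C.erase 0, 256 * a / m * f x ^ 2 * X (cz u y x) ω ^ 2 = ∑ x ∈ C, 256 * a / m * f x ^ 2 * X (cz u y x) ω ^ 2 := by
          refine Finset.sum_erase _ ?_
          rw [G.X_cz, G.zt_zero]; ring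
        rw [this, hYe, mul_add, mul_add, Finset.mul_sum, Finset.mul_sum, Finset.mul_sum]
        congr 1
        · ring
        · refine Finset.sum_congr rfl fun x _ => by ring
      simp only [e]
      exact h1
    · rintro (_ | x) _
      · simp only [Option.elim]; positivity
      · simp only [Option.elim]; positivity
    · rintro (_ | x) hx
      · simp only [Option.elim]; positivity
      · simp only [Option.elim]
        have : x ≠ 0 := Finset.ne_of_mem_erase (Finset.some_mem_insertNone.1 hx)
        have := hu x this; linarith
    · rintro (_ | x) hx
      · simp only [Option.elim]; exact hXnn
      · simp only [Option.elim]; exact G.cz_norm y x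
    · simp only [sum_insertNone, Option.elim]
      have h2 : ∑ x ∈ C.erase 0, 4 * (256 * a / m * f x ^ 2) * (2 * (1 - u x)) = 2048 * a / m * bet C f u := by
        unfold bet
        rw [← Finset.sum_erase C (f := fun x => f x ^ 2 * (1 - u x)) (a := 0) (by simp [G.zero]), Finset.mul_sum]
        refine Finset.sum_congr rfl fun x _ => by ring
      rw [h2]; linarith

end GField


lemma card_cube (d r : ℕ) : (cube d r).card = (2 * r + 1) ^ d := by
  unfold cube
  rw [Pi.card_Icc]
  simp only [Int.card_Icc, Finset.prod_const, Finset.card_univ, Fintype.card_fin]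
  congr 1; omega

lemma card_cube_le (d : ℕ) (b : ℝ) (hb : 0 ≤ b) : ((cube d ⌊Real.exp b⌋₊).card : ℝ) ≤ 3 ^ d * Real.exp (d * b) := by
  rw [card_cube]
  push_cast
  have h1 : (⌊Real.exp b⌋₊ : ℝ) ≤ Real.exp b := Nat.floor_le (Real.exp_pos _).le
  have h2 := Real.one_le_exp hb
  rw [Real.exp_nat_mul, ← mul_pow]
  exact pow_le_pow_left₀ (by positivity) (by linarith) _

lemma znorm_lt_mem {d : ℕ} (x : Fin d → ℤ) (b : ℝ) (h : znorm x < Real.exp b) : x ∈ cube d ⌊Real.exp b⌋₊ := by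
  rw [mem_cube]; intro i
  have h1 : |(x i : ℝ)| ≤ znorm x := by
    unfold znorm
    refine Real.abs_le_sqrt ?_
    exact Finset.single_le_sum (f := fun i => (x i : ℝ) ^ 2) (fun i _ => sq_nonneg _) (Finset.mem_univ i)
  have h2 : ((|x i|.toNat : ℕ) : ℝ) ≤ Real.exp b := by
    have : ((|x i|.toNat : ℕ) : ℤ) = |x i| := Int.toNat_of_nonneg (abs_nonneg _)
    have h3 : ((|x i|.toNat : ℕ) : ℝ) = |(x i : ℝ)| := by
      rw [← Int.cast_abs]; exact_mod_cast congrArg (fun n : ℤ => (n : ℝ)) this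
    rw [h3]; linarith
  have h4 := Nat.le_floor h2
  omega

lemma znorm_neg {d : ℕ} (x : Fin d → ℤ) : znorm (-x) = znorm x := by
  unfold znorm; simp

lemma nphi_le_exp (a : ℝ) : nphi a ≤ Real.exp (-a ^ 2 / 2) := by
  unfold nphi
  have : (Real.sqrt (2 * Real.pi))⁻¹ ≤ 1 := by
    apply inv_le_one_of_one_le₀
    rw [Real.one_le_sqrt]; nlinarith [Real.pi_gt_three]
  have h := Real.exp_pos (-a ^ 2 / 2)
  nlinarith

lemma exp_le_nphi (a : ℝ) : Real.exp (-a ^ 2 / 2) ≤ 3 * nphi a := by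
  unfold nphi
  have h3 : Real.sqrt (2 * Real.pi) ≤ 3 := by
    rw [Real.sqrt_le_left (by norm_num)]; nlinarith [Real.pi_lt_d2]
  have h0 : 0 < Real.sqrt (2 * Real.pi) := by positivity
  have : 1 ≤ 3 * (Real.sqrt (2 * Real.pi))⁻¹ := by
    rw [← div_eq_mul_inv, le_div_iff₀ h0]; linarith
  have h := Real.exp_pos (-a ^ 2 / 2)
  nlinarith

lemma inv_sqrt_le {ρ : ℝ} (h0 : 0 ≤ ρ) (h1 : ρ ≤ 1 / 2) : (Real.sqrt (1 - ρ ^ 2))⁻¹ ≤ Real.exp (2 * ρ) := by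
  have ha : 1 - ρ ≤ Real.sqrt (1 - ρ ^ 2) := Real.le_sqrt_of_sq_le (by nlinarith)
  have hb : Real.exp (-(2 * ρ)) ≤ 1 - ρ := by
    have := Real.quadratic_le_exp_of_nonneg (x := 2 * ρ) (by linarith)
    rw [Real.exp_neg]
    apply inv_le_of_inv_le₀ (by linarith)
    refine le_trans ?_ this
    rw [inv_le_iff_one_le_mul₀ (by linarith)]
    nlinarith
  rw [← inv_inv (Real.exp (2 * ρ)), ← Real.exp_neg]
  exact inv_anti₀ (Real.exp_pos _) (hb.trans ha)

/-- Fixed-`L` regime. -/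
structure Reg (d : ℕ) (Q : Finset (Fin d → ℤ)) (u : (Fin d → ℤ) → ℝ) (a D c C0 ε : ℝ) : Prop where
  ha : 48 ≤ a
  D1 : 1 ≤ D
  c0 : 0 < c
  c1 : c ≤ 1
  hu : ∀ x, x ≠ 0 → u x ≤ 1 - c / D
  hK : 8 * ((d : ℝ) + 2) ≤ c * a / D
  N1 : 1 ≤ (Q.card : ℝ) * (nphi a / a)
  NC : (Q.card : ℝ) * (nphi a / a) ≤ C0
  e0 : 0 ≤ ε
  e1 : ε ≤ 1 / 2
  far : ∀ x : Fin d → ℤ, Real.exp a ≤ znorm x → u x * Real.log (znorm x) ≤ ε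

lemma near_num {d : ℕ} {N a D c C0 : ℝ} (ha : 48 ≤ a) (D1 : 1 ≤ D) (c0 : 0 < c) (c1 : c ≤ 1)
    (hK : 8 * ((d : ℝ) + 2) ≤ c * a / D) (hN : 0 ≤ N) (NC : N * (nphi a / a) ≤ C0) :
    N * (3 ^ d * Real.exp (d * a)) * Real.exp (-((a - c * a / (16 * D)) ^ 2 / (1 + (1 - c / D)))) ≤ 3 * C0 * 3 ^ d * Real.exp (-a) := by
  set q := c / D with hq
  have hq0 : 0 < q := by positivity
  have hq1 : q ≤ 1 := by rw [hq, div_le_one (by linarith)]; linarith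
  have e1 : c * a / (16 * D) = a * q / 16 := by rw [hq]; field_simp
  have e2 : c * a / D = a * q := by rw [hq]; field_simp
  rw [e1]; rw [e2] at hK
  have h1 : a ^ 2 / 2 + (d + 2) * a ≤ (a - a * q / 16) ^ 2 / (1 + (1 - q)) := by
    have h2 : a ^ 2 / 2 * (1 + q / 4) ≤ (a - a * q / 16) ^ 2 / (1 + (1 - q)) := by
      rw [le_div_iff₀ (by linarith)]
      have : (a - a * q / 16) ^ 2 - a ^ 2 / 2 * (1 + q / 4) * (1 + (1 - q)) = a ^ 2 * (q / 8 + q ^ 2 / 8 + q ^ 2 / 256) := by ring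
      have h3 : 0 ≤ a ^ 2 * (q / 8 + q ^ 2 / 8 + q ^ 2 / 256) := by positivity
      linarith
    nlinarith
  have h2 : Real.exp (-((a - a * q / 16) ^ 2 / (1 + (1 - q)))) ≤ Real.exp (-a ^ 2 / 2) * Real.exp (-((d + 2) * a)) := by
    rw [← Real.exp_add]; apply Real.exp_le_exp.2; linarith
  have h3 : N * Real.exp (-a ^ 2 / 2) ≤ 3 * C0 * a := by
    have := exp_le_nphi a
    have h4 : N * Real.exp (-a ^ 2 / 2) ≤ N * (3 * nphi a) := mul_le_mul_of_nonneg_left this hN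
    have h5 : N * (3 * nphi a) = 3 * (N * (nphi a / a)) * a := by field_simp
    nlinarith
  have hC : 0 ≤ C0 := by
    refine le_trans ?_ NC
    have := nphi_pos a
    positivity
  have h4 : a ≤ Real.exp a := by linarith [Real.add_one_le_exp a]
  calc N * (3 ^ d * Real.exp (d * a)) * Real.exp (-((a - a * q / 16) ^ 2 / (1 + (1 - q))))
      ≤ N * (3 ^ d * Real.exp (d * a)) * (Real.exp (-a ^ 2 / 2) * Real.exp (-((d + 2) * a))) := by gcongr
    _ = (N * Real.exp (-a ^ 2 / 2)) * 3 ^ d * (Real.exp (d * a) * Real.exp (-((d + 2) * a))) := by ring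
    _ ≤ (3 * C0 * Real.exp a) * 3 ^ d * (Real.exp (d * a) * Real.exp (-((d + 2) * a))) := by
        have h5 : N * Real.exp (-a ^ 2 / 2) ≤ 3 * C0 * Real.exp a := h3.trans (by gcongr)
        have h6 : (0:ℝ) ≤ 3 ^ d := by positivity
        exact mul_le_mul_of_nonneg_right (mul_le_mul_of_nonneg_right h5 h6) (by positivity)
    _ = 3 * C0 * 3 ^ d * (Real.exp a * (Real.exp (d * a) * Real.exp (-((d + 2) * a)))) := by ring
    _ = _ := by rw [← Real.exp_add, ← Real.exp_add]; congr 2; ring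

namespace GField
variable {d : ℕ} {Ω H : Type*} [MeasurableSpace Ω] [NormedAddCommGroup H] [InnerProductSpace ℝ H]
    {P : Measure Ω} {ξ : Ω → (Fin d → ℤ) → ℝ}
    {u : (Fin d → ℤ) → ℝ} {X : ((Fin d → ℤ) →₀ ℝ) →ₗ[ℝ] (Ω → ℝ)} {T : ((Fin d → ℤ) →₀ ℝ) →ₗ[ℝ] H}
    {Q : Finset (Fin d → ℤ)} {a D c C0 ε : ℝ}

lemma near_sum (G : GField P ξ u X T) (R : Reg d Q u a D c C0 ε) :
    ∑ y ∈ Q, ∑ z ∈ (cube d ⌊Real.exp a⌋₊).erase 0,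
      P.real {ω | a - c * a / (16 * D) < ξ ω y ∧ a - c * a / (16 * D) < ξ ω (y + z)} ≤ 3 * C0 * 3 ^ d * Real.exp (-a) := by
  have ha := R.ha
  have hD := R.D1
  have hc := R.c0
  have hcd : c / D ≤ 1 := by rw [div_le_one (by linarith)]; linarith [R.c1]
  have ht : 0 ≤ a - c * a / (16 * D) := by
    have : c * a / (16 * D) = (c / D) * (a / 16) := by field_simp
    rw [this]; nlinarith
  refine le_trans ?_ (near_num (N := Q.card) ha hD hc R.c1 R.hK (Nat.cast_nonneg _) R.NC)
  set E := Real.exp (-((a - c * a / (16 * D)) ^ 2 / (1 + (1 - c / D)))) with hE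
  have hE0 : 0 ≤ E := (Real.exp_pos _).le
  have h1 : ∀ y ∈ Q, ∑ z ∈ (cube d ⌊Real.exp a⌋₊).erase 0,
      P.real {ω | a - c * a / (16 * D) < ξ ω y ∧ a - c * a / (16 * D) < ξ ω (y + z)} ≤ 3 ^ d * Real.exp (d * a) * E := by
    intro y _
    have h2 : ∀ z ∈ (cube d ⌊Real.exp a⌋₊).erase 0,
      P.real {ω | a - c * a / (16 * D) < ξ ω y ∧ a - c * a / (16 * D) < ξ ω (y + z)} ≤ E := by
      intro z hz
      refine G.near y (y + z) _ _ ht ?_ (by linarith)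
      have : y - (y + z) = -z := by abel
      rw [this, G.even]
      exact R.hu z (Finset.ne_of_mem_erase hz)
    refine (Finset.sum_le_card_nsmul _ _ _ h2).trans ?_
    rw [nsmul_eq_mul]
    have h3 : (((cube d ⌊Real.exp a⌋₊).erase 0).card : ℝ) ≤ 3 ^ d * Real.exp (d * a) :=
      le_trans (by exact_mod_cast Finset.card_erase_le) (card_cube_le d a (by linarith))
    gcongr
  refine (Finset.sum_le_card_nsmul _ _ _ h1).trans ?_
  rw [nsmul_eq_mul]; apply le_of_eq; ring

lemma far_b (G : GField P ξ u X T) (R : Reg d Q u a D c C0 ε) (x z : Fin d → ℤ) (h : Real.exp a ≤ znorm (z - x))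
    {A : Set (ℝ × ℝ)} (hA : MeasurableSet A) (hAb : ∀ p ∈ A, 0 ≤ p.1 ∧ p.1 ≤ a + 1 ∧ 0 ≤ p.2 ∧ p.2 ≤ a + 1) :
    P.real {ω | (ξ ω x, ξ ω z) ∈ A} ≤ Real.exp (6 * a ^ 2 * (ε / Real.log (znorm (z - x)))) * ((gaussianReal 0 1).prod (gaussianReal 0 1)).real A := by
  have ha := R.ha
  have hu := R.far _ h
  have hl : a ≤ Real.log (znorm (z - x)) := by
    rw [Real.le_log_iff_exp_le (lt_of_lt_of_le (Real.exp_pos _) h)]; exact h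
  set l := Real.log (znorm (z - x)) with hldef
  have hlp : 0 < l := by linarith
  have hu2 : u (z - x) ≤ ε / l := by rw [le_div_iff₀ hlp]; exact hu
  have hu0 := G.nonneg (z - x)
  have hu3 : u (z - x) ≤ 1 / 2 := by
    refine hu2.trans ?_
    rw [div_le_iff₀ hlp]; nlinarith [R.e0, R.e1]
  have e : u (x - z) = u (z - x) := by rw [← G.even]; congr 1; abel
  have := G.iso.far_pair (Finsupp.single x 1) (Finsupp.single z 1) (u (z - x)) (a + 1) (G.norm1 x) (G.norm1 z)
    (by rw [G.inn, e]) hu0 (by linarith) hA hAb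
  simp only [G.Xs] at this
  refine this.trans ?_
  apply mul_le_mul_of_nonneg_right _ measureReal_nonneg
  calc _ ≤ Real.exp (2 * u (z - x)) * Real.exp (u (z - x) * (a + 1) ^ 2) := by
        gcongr; exact inv_sqrt_le hu0 hu3
    _ = Real.exp (2 * u (z - x) + u (z - x) * (a + 1) ^ 2) := by rw [Real.exp_add]
    _ ≤ _ := by
        apply Real.exp_le_exp.2
        have h1 : 2 * u (z - x) + u (z - x) * (a + 1) ^ 2 ≤ 6 * a ^ 2 * u (z - x) := by
          have : 2 + (a + 1) ^ 2 ≤ 6 * a ^ 2 := by nlinarith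
          nlinarith
        refine h1.trans ?_
        gcongr

lemma pair_sum (G : GField P ξ u X T) (R : Reg d Q u a D c C0 ε) (hd : 1 ≤ d) (t : ℝ) (t0 : 0 ≤ t) (ht1 : t ≤ a) (ht2 : t / a ≤ c * a / (16 * D))
    {A : Set (ℝ × ℝ)} (hA : MeasurableSet A) (hAb : ∀ p ∈ A, a - t / a < p.1 ∧ p.1 ≤ a + t / a ∧ a - t / a < p.2 ∧ p.2 ≤ a + t / a) :
    ∑ x ∈ Q, ∑ z ∈ Q.erase x, P.real {ω | (ξ ω x, ξ ω z) ∈ A} ≤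
      3 * C0 * 3 ^ d * Real.exp (-a) + C0 * 3 ^ d * Real.exp (2 * t) * Real.exp (-a)
       + Real.exp (48 * d * ε) * ((Q.card : ℝ) ^ 2 * ((gaussianReal 0 1).prod (gaussianReal 0 1)).real A) := by
  classical
  have := G.iso.prob
  have ha := R.ha
  have ha0 : 0 < a := by linarith
  have hd1 : (1 : ℝ) ≤ d := by exact_mod_cast hd
  have hta : t / a ≤ 1 := by rw [div_le_one ha0]; exact ht1
  set g := ((gaussianReal 0 1).prod (gaussianReal 0 1)).real A with hg
  have hg0 : 0 ≤ g := measureReal_nonneg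
  have hAb' : ∀ p ∈ A, 0 ≤ p.1 ∧ p.1 ≤ a + 1 ∧ 0 ≤ p.2 ∧ p.2 ≤ a + 1 := by
    intro p hp
    obtain ⟨h1, h2, h3, h4⟩ := hAb p hp
    exact ⟨by linarith, by linarith, by linarith, by linarith⟩
  have hgle : g ≤ (nphi a / a * Real.exp t) ^ 2 := by
    have h1 : A ⊆ Set.Ioi (a - t / a) ×ˢ Set.Ioi (a - t / a) := fun p hp => ⟨(hAb p hp).1, (hAb p hp).2.2.1⟩
    have h2 : g ≤ ((gaussianReal 0 1).prod (gaussianReal 0 1)).real (Set.Ioi (a - t / a) ×ˢ Set.Ioi (a - t / a)) :=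
      measureReal_mono h1
    rw [measureReal_prod_prod] at h2
    have h3 := gauss_tail_upper a (a - t / a) ha0
    have h4 : a * (a - (a - t / a)) = t := by field_simp; ring
    rw [h4] at h3
    refine h2.trans ?_
    rw [sq]
    exact mul_le_mul h3 h3 measureReal_nonneg (measureReal_nonneg.trans h3)
  set θ : ℝ := a ^ 2 / (8 * d) with hθ
  have hθ0 : 0 ≤ θ := by positivity
  -- pointwise bound
  set E := fun (y z : Fin d → ℤ) => P.real {ω | a - c * a / (16 * D) < ξ ω y ∧ a - c * a / (16 * D) < ξ ω (y + z)} with hE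
  have hpt : ∀ x ∈ Q, ∀ z ∈ Q.erase x, P.real {ω | (ξ ω x, ξ ω z) ∈ A} ≤
      (if z - x ∈ (cube d ⌊Real.exp a⌋₊).erase 0 then E x (z - x) else 0) +
      ((if z - x ∈ cube d ⌊Real.exp θ⌋₊ then Real.exp (6 * a) * g else 0) + Real.exp (48 * d * ε) * g) := by
    intro x hx z hz
    have hE0 : 0 ≤ (if z - x ∈ (cube d ⌊Real.exp a⌋₊).erase 0 then E x (z - x) else 0) := by
      split_ifs
      · exact measureReal_nonneg
      · exact le_rfl
    have hM0 : 0 ≤ (if z - x ∈ cube d ⌊Real.exp θ⌋₊ then Real.exp (6 * a) * g else 0) := by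
      split_ifs
      · positivity
      · exact le_rfl
    have hF0 : 0 ≤ Real.exp (48 * d * ε) * g := by positivity
    have hzx : z - x ≠ 0 := sub_ne_zero.2 (Finset.ne_of_mem_erase hz)
    by_cases h1 : znorm (z - x) < Real.exp a
    · have hm := znorm_lt_mem _ _ h1
      rw [if_pos (Finset.mem_erase.2 ⟨hzx, hm⟩)]
      have : P.real {ω | (ξ ω x, ξ ω z) ∈ A} ≤ E x (z - x) := by
        refine measureReal_mono ?_
        intro ω hω
        obtain ⟨p1, p2, p3, p4⟩ := hAb _ hω
        have e : x + (z - x) = z := by abel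
        simp only [Set.mem_setOf_eq, e]
        simp only at p1 p3
        exact ⟨by linarith, by linarith⟩
      linarith
    · push Not at h1
      have hb := G.far_b R x z h1 hA hAb'
      have hl : a ≤ Real.log (znorm (z - x)) := by
        rw [Real.le_log_iff_exp_le (lt_of_lt_of_le (Real.exp_pos _) h1)]; exact h1
      by_cases h2 : znorm (z - x) < Real.exp θ
      · rw [if_pos (znorm_lt_mem _ _ h2)] at *
        have : Real.exp (6 * a ^ 2 * (ε / Real.log (znorm (z - x)))) ≤ Real.exp (6 * a) := by
          apply Real.exp_le_exp.2
          have : ε / Real.log (znorm (z - x)) ≤ 1 / a := by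
            apply div_le_div₀ (by norm_num) (by linarith [R.e1]) ha0 hl
          calc 6 * a ^ 2 * (ε / Real.log (znorm (z - x))) ≤ 6 * a ^ 2 * (1 / a) := by gcongr
            _ = 6 * a := by field_simp
        have h3 := mul_le_mul_of_nonneg_right this hg0
        linarith
      · push Not at h2
        have hl2 : θ ≤ Real.log (znorm (z - x)) := by
          rw [Real.le_log_iff_exp_le (lt_of_lt_of_le (Real.exp_pos _) h2)]; exact h2
        have : Real.exp (6 * a ^ 2 * (ε / Real.log (znorm (z - x)))) ≤ Real.exp (48 * d * ε) := by
          apply Real.exp_le_exp.2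
          have hθp : 0 < θ := by positivity
          have : ε / Real.log (znorm (z - x)) ≤ ε / θ :=
            div_le_div_of_nonneg_left R.e0 hθp hl2
          calc 6 * a ^ 2 * (ε / Real.log (znorm (z - x))) ≤ 6 * a ^ 2 * (ε / θ) := by gcongr
            _ = 48 * d * ε := by rw [hθ]; field_simp; ring
        have h3 := mul_le_mul_of_nonneg_right this hg0
        linarith
  have hshift : ∀ (F : (Fin d → ℤ) → ℝ) (C : Finset (Fin d → ℤ)) (x : Fin d → ℤ), (∀ z, 0 ≤ F z) →
      ∑ z ∈ Q.erase x, (if z - x ∈ C then F (z - x) else 0) ≤ ∑ w ∈ C, F w := by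
    intro F C x hF
    rw [← Finset.sum_filter]
    rw [← Finset.sum_image (s := (Q.erase x).filter (fun z => z - x ∈ C)) (g := fun z => z - x) (f := F)]
    · refine Finset.sum_le_sum_of_subset_of_nonneg ?_ (fun _ _ _ => hF _)
      intro w hw
      obtain ⟨z, hz, rfl⟩ := Finset.mem_image.1 hw
      exact (Finset.mem_filter.1 hz).2
    · intro z _ z' _ h
      simpa using h
  calc ∑ x ∈ Q, ∑ z ∈ Q.erase x, P.real {ω | (ξ ω x, ξ ω z) ∈ A}
      ≤ ∑ x ∈ Q, ∑ z ∈ Q.erase x, ((if z - x ∈ (cube d ⌊Real.exp a⌋₊).erase 0 then E x (z - x) else 0) +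
      ((if z - x ∈ cube d ⌊Real.exp θ⌋₊ then Real.exp (6 * a) * g else 0) + Real.exp (48 * d * ε) * g)) :=
        Finset.sum_le_sum fun x hx => Finset.sum_le_sum fun z hz => hpt x hx z hz
    _ ≤ ∑ x ∈ Q, ((∑ w ∈ (cube d ⌊Real.exp a⌋₊).erase 0, E x w) + ((3 ^ d * Real.exp (d * θ)) * (Real.exp (6 * a) * g) + Q.card * (Real.exp (48 * d * ε) * g))) := by
        refine Finset.sum_le_sum fun x hx => ?_
        rw [Finset.sum_add_distrib, Finset.sum_add_distrib]
        refine add_le_add (hshift (E x) _ x fun _ => measureReal_nonneg) (add_le_add ?_ ?_)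
        · refine (hshift (fun _ => Real.exp (6 * a) * g) _ x fun _ => by positivity).trans ?_
          rw [Finset.sum_const, nsmul_eq_mul]
          have := card_cube_le d θ hθ0
          gcongr
        · rw [Finset.sum_const, nsmul_eq_mul]
          have : ((Q.erase x).card : ℝ) ≤ Q.card := by exact_mod_cast Finset.card_erase_le
          gcongr
    _ = (∑ x ∈ Q, ∑ w ∈ (cube d ⌊Real.exp a⌋₊).erase 0, E x w) + (Q.card * ((3 ^ d * Real.exp (d * θ)) * (Real.exp (6 * a) * g)) + Real.exp (48 * d * ε) * ((Q.card : ℝ) ^ 2 * g)) := by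
        rw [Finset.sum_add_distrib, Finset.sum_const, nsmul_eq_mul]; ring
    _ ≤ _ := by
        have h1 := G.near_sum R
        have h2 : (Q.card : ℝ) * ((3 ^ d * Real.exp (d * θ)) * (Real.exp (6 * a) * g)) ≤ C0 * 3 ^ d * Real.exp (2 * t) * Real.exp (-a) := by
          have hp := nphi_pos a
          have e1 : (d : ℝ) * θ = a ^ 2 / 8 := by rw [hθ]; field_simp
          have hpl : nphi a / a ≤ Real.exp (-a ^ 2 / 2) := by
            refine le_trans ?_ (nphi_le_exp a)
            rw [div_le_iff₀ ha0]; nlinarith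
          have hC0 : 0 ≤ C0 := by linarith [R.N1, R.NC]
          rw [e1]
          calc (Q.card : ℝ) * ((3 ^ d * Real.exp (a ^ 2 / 8)) * (Real.exp (6 * a) * g))
              ≤ (Q.card : ℝ) * ((3 ^ d * Real.exp (a ^ 2 / 8)) * (Real.exp (6 * a) * (nphi a / a * Real.exp t) ^ 2)) := by gcongr
            _ = (Q.card * (nphi a / a)) * 3 ^ d * Real.exp (2 * t) * (Real.exp (a ^ 2 / 8) * Real.exp (6 * a) * (nphi a / a)) := by
                rw [two_mul, Real.exp_add]; ring
            _ ≤ C0 * 3 ^ d * Real.exp (2 * t) * (Real.exp (a ^ 2 / 8) * Real.exp (6 * a) * Real.exp (-a ^ 2 / 2)) := by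
                gcongr; exact R.NC
            _ ≤ C0 * 3 ^ d * Real.exp (2 * t) * Real.exp (-a) := by
                gcongr
                rw [← Real.exp_add, ← Real.exp_add]
                apply Real.exp_le_exp.2
                nlinarith
        linarith

end GField


/-- union bound for outer measures of existential events over a finset -/
lemma union_bd {Ω ι : Type*} [MeasurableSpace Ω] {P : Measure Ω} [IsProbabilityMeasure P] (s : Finset ι) (E : ι → Set Ω) (S : Set Ω)
    (h : ∀ ω ∈ S, ∃ i ∈ s, ω ∈ E i) : P.real S ≤ ∑ i ∈ s, P.real (E i) := by
  refine le_trans ?_ (measureReal_biUnion_finset_le s E)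
  refine measureReal_mono ?_ (measure_ne_top _ _)
  intro ω hω
  obtain ⟨i, hi, hE⟩ := h ω hω
  exact Set.mem_biUnion hi hE

lemma diag_gauss (a t δ : ℝ) (ha : 1 ≤ a) (ht : 0 ≤ t) (hta : t ≤ a) (hδ : 0 ≤ δ) :
    ((gaussianReal 0 1).prod (gaussianReal 0 1)).real
      {p : ℝ × ℝ | (a - t / a < p.1 ∧ p.1 ≤ a + t / a ∧ a - t / a < p.2 ∧ p.2 ≤ a + t / a) ∧ |p.1 - p.2| ≤ δ / a} ≤
    2 * δ * Real.exp (2 * t) * (nphi a / a) ^ 2 := by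
  have ha0 : 0 < a := by linarith
  have hta1 : t / a ≤ 1 := by rw [div_le_one ha0]; exact hta
  set A := {p : ℝ × ℝ | (a - t / a < p.1 ∧ p.1 ≤ a + t / a ∧ a - t / a < p.2 ∧ p.2 ≤ a + t / a) ∧ |p.1 - p.2| ≤ δ / a} with hAdef
  have hA : MeasurableSet A := by
    refine MeasurableSet.inter (MeasurableSet.inter ?_ (MeasurableSet.inter ?_ (MeasurableSet.inter ?_ ?_))) ?_
    · exact measurableSet_lt measurable_const measurable_fst
    · exact measurableSet_le measurable_fst measurable_const
    · exact measurableSet_lt measurable_const measurable_snd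
    · exact measurableSet_le measurable_snd measurable_const
    · exact measurableSet_le (measurable_fst.sub measurable_snd).abs measurable_const
  have hnph : nphi (a - t / a) ≤ nphi a * Real.exp t := by
    unfold nphi
    rw [mul_assoc, ← Real.exp_add]
    gcongr
    have : (a - t / a) ^ 2 = a ^ 2 - 2 * t + (t / a) ^ 2 := by field_simp; ring
    rw [this]; nlinarith [sq_nonneg (t / a)]
  have hp := nphi_pos a
  set κ : ℝ := 2 * δ / a * (nphi a * Real.exp t) with hκ
  have hκ0 : 0 ≤ κ := by positivity
  have hsl : ∀ x, (gaussianReal 0 1) (Prod.mk x ⁻¹' A) ≤ (Set.Ioi (a - t / a)).indicator (fun _ => ENNReal.ofReal κ) x := by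
    intro x
    by_cases hx : a - t / a < x
    · rw [Set.indicator_of_mem (by exact hx)]
      have hsub : Prod.mk x ⁻¹' A ⊆ Set.Icc (max (a - t / a) (x - δ / a)) (max (a - t / a) (x - δ / a) + 2 * δ / a) := by
        intro z hz
        obtain ⟨⟨h1, h2, h3, h4⟩, h5⟩ := hz
        rw [abs_le] at h5
        simp only at h3 h5
        refine ⟨max_le h3.le (by linarith [h5.2]), ?_⟩
        have : x - δ / a ≤ max (a - t / a) (x - δ / a) := le_max_right _ _
        have e : 2 * δ / a = δ / a + δ / a := by ring
        rw [e]; linarith [h5.1]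
      refine (measure_mono hsub).trans ?_
      rw [ENNReal.le_ofReal_iff_toReal_le (measure_ne_top _ _) hκ0]
      have hda : 0 ≤ 2 * δ / a := by positivity
      have := gauss_window_upper (max (a - t / a) (x - δ / a)) (max (a - t / a) (x - δ / a) + 2 * δ / a)
        (by exact le_max_of_le_left (by linarith)) (by linarith) (a - t / a) (by linarith) (le_max_left _ _)
      change (gaussianReal 0 1).real _ ≤ κ
      refine this.trans ?_
      rw [add_sub_cancel_left]
      exact mul_le_mul_of_nonneg_left hnph hda
    · rw [Set.indicator_of_notMem (by exact hx)]
      have : Prod.mk x ⁻¹' A = ∅ := by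
        ext z; simp only [Set.mem_preimage, Set.mem_empty_iff_false, iff_false]
        intro hz; exact hx hz.1.1
      rw [this]; simp
  have h1 : ((gaussianReal 0 1).prod (gaussianReal 0 1)) A ≤ ENNReal.ofReal κ * (gaussianReal 0 1) (Set.Ioi (a - t / a)) := by
    rw [Measure.prod_apply hA]
    refine (lintegral_mono hsl).trans ?_
    rw [lintegral_indicator measurableSet_Ioi, setLIntegral_const]
  have h2 : ((gaussianReal 0 1).prod (gaussianReal 0 1)).real A ≤ κ * (gaussianReal 0 1).real (Set.Ioi (a - t / a)) := by
    have := ENNReal.toReal_mono (ENNReal.mul_ne_top ENNReal.ofReal_ne_top (measure_ne_top _ _)) h1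
    rw [ENNReal.toReal_mul, ENNReal.toReal_ofReal hκ0] at this
    exact this
  have h3 := gauss_tail_upper a (a - t / a) ha0
  have h4 : a * (a - (a - t / a)) = t := by field_simp; ring
  rw [h4] at h3
  refine h2.trans ((mul_le_mul_of_nonneg_left h3 hκ0).trans (le_of_eq ?_))
  rw [hκ, two_mul t, Real.exp_add]; field_simp

namespace GField
variable {d : ℕ} {Ω H : Type*} [MeasurableSpace Ω] [NormedAddCommGroup H] [InnerProductSpace ℝ H]
    {P : Measure Ω} {ξ : Ω → (Fin d → ℤ) → ℝ}
    {u : (Fin d → ℤ) → ℝ} {X : ((Fin d → ℤ) →₀ ℝ) →ₗ[ℝ] (Ω → ℝ)} {T : ((Fin d → ℤ) →₀ ℝ) →ₗ[ℝ] H}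
    {Q : Finset (Fin d → ℤ)} {a D c C0 ε : ℝ}

lemma G1_bd (G : GField P ξ u X T) (R : Reg d Q u a D c C0 ε) (r : ℕ) (hr : 2 * r + 2 ≤ ⌊Real.exp a⌋₊) :
    P.real {ω | ¬ ∀ y ∈ Q, ∀ x, x ≠ y → x - y ∈ cube d (2 * r + 2) →
      ¬ (a - c * a / (16 * D) < ξ ω y ∧ a - c * a / (16 * D) < ξ ω x)} ≤ 3 * C0 * 3 ^ d * Real.exp (-a) := by
  have := G.iso.prob
  refine le_trans ?_ (G.near_sum R)
  rw [← Finset.sum_product']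
  refine union_bd _ (fun p : (Fin d → ℤ) × (Fin d → ℤ) => {ω | a - c * a / (16 * D) < ξ ω p.1 ∧ a - c * a / (16 * D) < ξ ω (p.1 + p.2)}) _ ?_
  intro ω hω
  simp only [Set.mem_setOf_eq] at hω
  push Not at hω
  obtain ⟨y, hy, x, hxy, hc, h1, h2⟩ := hω
  refine ⟨(y, x - y), Finset.mem_product.2 ⟨hy, Finset.mem_erase.2 ⟨sub_ne_zero.2 hxy, ?_⟩⟩, h1, ?_⟩
  · rw [mem_cube] at hc ⊢
    intro i; exact (hc i).trans (by exact_mod_cast hr)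
  · have : y + (x - y) = x := by abel
    simp only [this]; exact h2

lemma G2_bd (G : GField P ξ u X T) (R : Reg d Q u a D c C0 ε) (t : ℝ) :
    P.real {ω | ¬ ∀ x ∈ Q, ξ ω x ≤ a + t / a} ≤ C0 * Real.exp (-t) := by
  have := G.iso.prob
  have ha : 0 < a := by linarith [R.ha]
  refine (union_bd Q (fun x => {ω | a + t / a < ξ ω x}) _ ?_).trans ?_
  · intro ω hω
    simp only [Set.mem_setOf_eq] at hω
    push Not at hω
    exact hω
  · have h : ∀ x ∈ Q, P.real {ω | a + t / a < ξ ω x} ≤ nphi a / a * Real.exp (-t) := by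
      intro x _
      have := G.tail x a (a + t / a) ha
      have e : a * (a - (a + t / a)) = -t := by field_simp; ring
      rwa [e] at this
    refine (Finset.sum_le_card_nsmul _ _ _ h).trans ?_
    rw [nsmul_eq_mul, ← mul_assoc]
    exact mul_le_mul_of_nonneg_right R.NC (Real.exp_pos _).le

lemma G4_bd (G : GField P ξ u X T) (R : Reg d Q u a D c C0 ε) (hd : 1 ≤ d) (t δ : ℝ) (t0 : 0 ≤ t) (ht1 : t ≤ a) (ht2 : t / a ≤ c * a / (16 * D)) (hδ : 0 ≤ δ) :
    P.real {ω | ¬ ∀ x ∈ Q, ∀ z ∈ Q, x ≠ z → a - t / a < ξ ω x → a - t / a < ξ ω z → δ / a < |ξ ω x - ξ ω z|} ≤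
      C0 * Real.exp (-t) + (3 * C0 * 3 ^ d * Real.exp (-a) + C0 * 3 ^ d * Real.exp (2 * t) * Real.exp (-a)
       + Real.exp (48 * d * ε) * (C0 ^ 2 * (2 * δ * Real.exp (2 * t)))) := by
  have := G.iso.prob
  have ha : 48 ≤ a := R.ha
  set A := {p : ℝ × ℝ | (a - t / a < p.1 ∧ p.1 ≤ a + t / a ∧ a - t / a < p.2 ∧ p.2 ≤ a + t / a) ∧ |p.1 - p.2| ≤ δ / a} with hAdef
  have hA : MeasurableSet A := by
    refine MeasurableSet.inter (MeasurableSet.inter ?_ (MeasurableSet.inter ?_ (MeasurableSet.inter ?_ ?_))) ?_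
    · exact measurableSet_lt measurable_const measurable_fst
    · exact measurableSet_le measurable_fst measurable_const
    · exact measurableSet_lt measurable_const measurable_snd
    · exact measurableSet_le measurable_snd measurable_const
    · exact measurableSet_le (measurable_fst.sub measurable_snd).abs measurable_const
  have h1 := G.pair_sum R hd t t0 ht1 ht2 hA (fun p hp => hp.1)
  have h2 := diag_gauss a t δ (by linarith) t0 ht1 hδ
  have h3 : (Q.card : ℝ) ^ 2 * ((gaussianReal 0 1).prod (gaussianReal 0 1)).real A ≤ C0 ^ 2 * (2 * δ * Real.exp (2 * t)) := by
    calc _ ≤ (Q.card : ℝ) ^ 2 * (2 * δ * Real.exp (2 * t) * (nphi a / a) ^ 2) := by gcongr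
      _ = (Q.card * (nphi a / a)) ^ 2 * (2 * δ * Real.exp (2 * t)) := by ring
      _ ≤ _ := by
        have := R.N1
        have := R.NC
        gcongr
  have h4 : P.real {ω | ¬ ∀ x ∈ Q, ∀ z ∈ Q, x ≠ z → a - t / a < ξ ω x → a - t / a < ξ ω z → δ / a < |ξ ω x - ξ ω z|} ≤
      P.real {ω | ¬ ∀ x ∈ Q, ξ ω x ≤ a + t / a} + P.real {ω | ∃ x ∈ Q, ∃ z ∈ Q.erase x, (ξ ω x, ξ ω z) ∈ A} := by
    refine le_trans (measureReal_mono ?_) (measureReal_union_le _ _)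
    intro ω hω
    by_cases hb : ∀ x ∈ Q, ξ ω x ≤ a + t / a
    · right
      simp only [Set.mem_setOf_eq] at hω
      push Not at hω
      obtain ⟨x, hx, z, hz, hxz, p1, p2, p3⟩ := hω
      exact ⟨x, hx, z, Finset.mem_erase.2 ⟨hxz.symm, hz⟩, ⟨p1, hb x hx, p2, hb z hz⟩, p3⟩
    · left; exact hb
  have h5 : P.real {ω | ∃ x ∈ Q, ∃ z ∈ Q.erase x, (ξ ω x, ξ ω z) ∈ A} ≤ ∑ x ∈ Q, ∑ z ∈ Q.erase x, P.real {ω | (ξ ω x, ξ ω z) ∈ A} := by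
    refine (union_bd Q (fun x => {ω | ∃ z ∈ Q.erase x, (ξ ω x, ξ ω z) ∈ A}) _ (fun ω hω => hω)).trans ?_
    refine Finset.sum_le_sum fun x _ => union_bd (Q.erase x) (fun z => {ω | (ξ ω x, ξ ω z) ∈ A}) _ (fun ω hω => hω)
  have h6 := G.G2_bd R t
  have h7 := mul_le_mul_of_nonneg_left h3 (Real.exp_pos (48 * d * ε)).le
  linarith

lemma G6_bd (G : GField P ξ u X T) (R : Reg d Q u a D c C0 ε) (C : Finset (Fin d → ℤ)) (f : (Fin d → ℤ) → ℝ) (m s t e : ℝ) (hm : 0 < m)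
    (hs : 0 < s) (hX : ∀ y, ‖T (cX C f u y)‖ ≤ s)
    (hsm : 128 * a ^ 2 * s ^ 2 + 2048 * a / m * bet C f u ≤ 1) (he : 0 < e) :
    P.real {ω | ¬ ∀ x ∈ Q, a - t / a < ξ ω x → a * YY C f u (ξ ω) a m x ≤ e ^ 2} ≤
      C0 * Real.exp t * ((a ^ 2 * s ^ 2 + 16 * a / m * bet C f u) / e ^ 2) := by
  have := G.iso.prob
  have ha : 0 < a := by linarith [R.ha]
  have hu : ∀ x, x ≠ 0 → u x < 1 := fun x hx => lt_of_le_of_lt (R.hu x hx) (by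
    have := div_pos R.c0 (lt_of_lt_of_le one_pos R.D1); linarith)
  refine (union_bd Q (fun x => {ω | a - t / a < ξ ω x ∧ e ^ 2 < a * YY C f u (ξ ω) a m x}) _ ?_).trans ?_
  · intro ω hω
    simp only [Set.mem_setOf_eq] at hω
    push Not at hω
    exact hω
  · have h : ∀ x ∈ Q, P.real {ω | a - t / a < ξ ω x ∧ e ^ 2 < a * YY C f u (ξ ω) a m x} ≤
        nphi a / a * Real.exp t * ((a ^ 2 * s ^ 2 + 16 * a / m * bet C f u) / e ^ 2) := by
      intro x _
      obtain ⟨hYm, hYi, ⟨hYint, hYb⟩, _⟩ := G.Y_props C f a m s ha hm hs hu x (hX x) hsm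
      have hi := hYi.measure_inter_preimage_eq_mul (Set.Ioi (a - t / a)) (Set.Ioi (e ^ 2 / a)) measurableSet_Ioi measurableSet_Ioi
      have hset : {ω | a - t / a < ξ ω x ∧ e ^ 2 < a * YY C f u (ξ ω) a m x} =
          (fun ω => ξ ω x) ⁻¹' (Set.Ioi (a - t / a)) ∩ (fun ω => YY C f u (ξ ω) a m x) ⁻¹' (Set.Ioi (e ^ 2 / a)) := by
        ext ω
        simp only [Set.mem_setOf_eq, Set.mem_inter_iff, Set.mem_preimage, Set.mem_Ioi, div_lt_iff₀' ha]
      have h1 : P.real {ω | a - t / a < ξ ω x ∧ e ^ 2 < a * YY C f u (ξ ω) a m x} =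
          P.real {ω | a - t / a < ξ ω x} * P.real {ω | e ^ 2 < a * YY C f u (ξ ω) a m x} := by
        rw [hset]
        unfold Measure.real
        rw [hi, ENNReal.toReal_mul]
        congr 3
        ext ω
        simp only [Set.mem_setOf_eq, Set.mem_preimage, Set.mem_Ioi, div_lt_iff₀' ha]
      have h2 := G.tail x a (a - t / a) ha
      have e4 : a * (a - (a - t / a)) = t := by field_simp; ring
      rw [e4] at h2
      have h3 : P.real {ω | e ^ 2 < a * YY C f u (ξ ω) a m x} ≤ (a ^ 2 * s ^ 2 + 16 * a / m * bet C f u) / e ^ 2 := by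
        have hnn : ∀ ω, 0 ≤ a * YY C f u (ξ ω) a m x := by
          intro ω
          unfold YY ZZ
          have : 0 ≤ ∑ z ∈ C, f z ^ 2 * zt u (ξ ω) x z ^ 2 := Finset.sum_nonneg fun _ _ => by positivity
          positivity
        have := mul_meas_ge_le_integral_of_nonneg (μ := P) (ae_of_all _ hnn) (hYint.const_mul a) (e ^ 2)
        rw [le_div_iff₀' (by positivity)]
        refine le_trans (mul_le_mul_of_nonneg_left ?_ (sq_nonneg e)) (this.trans hYb)
        refine measureReal_mono ?_ (measure_ne_top _ _)
        intro ω hω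
        rw [Set.mem_setOf_eq] at hω ⊢
        exact hω.le
      rw [h1]
      exact mul_le_mul h2 h3 measureReal_nonneg (measureReal_nonneg.trans h2)
    refine (Finset.sum_le_card_nsmul _ _ _ h).trans ?_
    rw [nsmul_eq_mul, ← mul_assoc, ← mul_assoc]
    have hb : 0 ≤ bet C f u := by
      unfold bet
      exact Finset.sum_nonneg fun x _ => mul_nonneg (sq_nonneg _) (by linarith [G.u_le x])
    have := R.NC
    gcongr

lemma G7_bd (G : GField P ξ u X T) (R : Reg d Q u a D c C0 ε) (C : Finset (Fin d → ℤ)) (f : (Fin d → ℤ) → ℝ) (m s t : ℝ) (hm : 0 < m)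
    (hs : 0 < s) (hX : ∀ y, ‖T (cX C f u y)‖ ≤ s)
    (hsm : 128 * a ^ 2 * s ^ 2 + 2048 * a / m * bet C f u ≤ 1) :
    P.real {ω | ¬ ∀ x ∈ Q, ξ ω x ≤ a - t / a → YY C f u (ξ ω) a m x ≤ (a - ξ ω x) / 16} ≤
      2 * C0 * Real.exp (-t) := by
  have := G.iso.prob
  have ha : 0 < a := by linarith [R.ha]
  have hu : ∀ x, x ≠ 0 → u x < 1 := fun x hx => lt_of_le_of_lt (R.hu x hx) (by
    have := div_pos R.c0 (lt_of_lt_of_le one_pos R.D1); linarith)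
  refine (union_bd Q (fun x => {ω | ξ ω x ≤ a - t / a ∧ (a - ξ ω x) / 16 < YY C f u (ξ ω) a m x}) _ ?_).trans ?_
  · intro ω hω
    simp only [Set.mem_setOf_eq] at hω
    push Not at hω
    exact hω
  · have h : ∀ x ∈ Q, P.real {ω | ξ ω x ≤ a - t / a ∧ (a - ξ ω x) / 16 < YY C f u (ξ ω) a m x} ≤
        nphi a / a * Real.exp (-t) * 2 := by
      intro x _
      obtain ⟨hYm, hYi, _, hYe, hYb⟩ := G.Y_props C f a m s ha hm hs hu x (hX x) hsm
      have e1 : ∀ ω, 2 * (a * (16 * YY C f u (ξ ω) a m x)) = 32 * (a * YY C f u (ξ ω) a m x) := fun ω => by ring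
      have := indep_excess (Y := fun ω => 16 * YY C f u (ξ ω) a m x) (G.measξ x) (hYm.const_mul 16) (G.law x)
        (hYi.comp (φ := id) (ψ := fun z => 16 * z) measurable_id (by fun_prop)) a t ha (by simp only [e1]; exact hYe)
      simp only [e1] at this
      refine le_trans ?_ (this.trans (mul_le_mul_of_nonneg_left hYb ?_))
      · refine measureReal_mono ?_
        rintro ω ⟨h1, h2⟩
        refine ⟨by linarith, ?_⟩
        have h3 : t / a ≤ 16 * YY C f u (ξ ω) a m x := by linarith
        rwa [div_le_iff₀' ha] at h3
      · have := nphi_pos a; positivity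
    refine (Finset.sum_le_card_nsmul _ _ _ h).trans ?_
    rw [nsmul_eq_mul, ← mul_assoc, ← mul_assoc]
    have := R.NC
    have h9 := Real.exp_pos (-t)
    nlinarith [mul_le_mul_of_nonneg_right R.NC h9.le]

end GField


/-- second moment method for a count -/
lemma count_bd {Ω ι : Type*} [MeasurableSpace Ω] [DecidableEq ι] {P : Measure Ω} [IsProbabilityMeasure P] (s : Finset ι) (E : ι → Set Ω)
    (hE : ∀ i, MeasurableSet (E i)) (μ k : ℝ) (hμ : ∑ i ∈ s, P.real (E i) = μ)
    (h2 : ∑ i ∈ s, ∑ j ∈ s.erase i, P.real (E i ∩ E j) ≤ 1 + μ ^ 2) (hk : 2 * k ≤ μ) (hμ1 : 1 ≤ μ) :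
    P.real {ω | ∑ i ∈ s, (E i).indicator (fun _ => (1 : ℝ)) ω ≤ k} ≤ 8 / μ := by
  set N : Ω → ℝ := fun ω => ∑ i ∈ s, (E i).indicator (fun _ => (1 : ℝ)) ω with hN
  have iE : ∀ F : Set Ω, MeasurableSet F → Integrable (F.indicator (fun _ => (1 : ℝ))) P := fun F hF =>
    (integrable_const 1).indicator hF
  have vE : ∀ F : Set Ω, MeasurableSet F → ∫ ω, F.indicator (fun _ => (1 : ℝ)) ω ∂P = P.real F := fun F hF => by
    rw [integral_indicator hF]; simp
  have hNi : Integrable N P := integrable_finsetSum s fun i _ => iE _ (hE i)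
  have hN1 : ∫ ω, N ω ∂P = μ := by
    rw [hN, integral_finsetSum s fun i _ => iE _ (hE i), ← hμ]
    exact Finset.sum_congr rfl fun i _ => vE _ (hE i)
  have hsq : ∀ ω, N ω ^ 2 = N ω + ∑ i ∈ s, ∑ j ∈ s.erase i, (E i ∩ E j).indicator (fun _ => (1 : ℝ)) ω := by
    intro ω
    rw [hN, sq, Finset.sum_mul_sum, ← Finset.sum_add_distrib]
    refine Finset.sum_congr rfl fun i hi => ?_
    rw [← Finset.add_sum_erase _ _ hi]
    congr 1
    · by_cases h : ω ∈ E i <;> simp [h]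
    · refine Finset.sum_congr rfl fun j _ => ?_
      by_cases h : ω ∈ E i <;> by_cases h' : ω ∈ E j <;> simp [h, h']
  have hDi : Integrable (fun ω => ∑ i ∈ s, ∑ j ∈ s.erase i, (E i ∩ E j).indicator (fun _ => (1 : ℝ)) ω) P :=
    integrable_finsetSum s fun i _ => integrable_finsetSum _ fun j _ => iE _ ((hE i).inter (hE j))
  have hD1 : ∫ ω, ∑ i ∈ s, ∑ j ∈ s.erase i, (E i ∩ E j).indicator (fun _ => (1 : ℝ)) ω ∂P ≤ 1 + μ ^ 2 := by
    rw [integral_finsetSum s fun i _ => integrable_finsetSum _ fun j _ => iE _ ((hE i).inter (hE j))]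
    refine le_trans (le_of_eq ?_) h2
    refine Finset.sum_congr rfl fun i _ => ?_
    rw [integral_finsetSum _ fun j _ => iE _ ((hE i).inter (hE j))]
    exact Finset.sum_congr rfl fun j _ => vE _ ((hE i).inter (hE j))
  have e : ∀ ω, (N ω - μ) ^ 2 = ((N ω + ∑ i ∈ s, ∑ j ∈ s.erase i, (E i ∩ E j).indicator (fun _ => (1 : ℝ)) ω) - 2 * μ * N ω) + μ ^ 2 := by
    intro ω; rw [← hsq]; ring
  have hVi : Integrable (fun ω => (N ω - μ) ^ 2) P := by
    simp only [e]; exact ((hNi.add hDi).sub (hNi.const_mul _)).add (integrable_const _)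
  have hV : ∫ ω, (N ω - μ) ^ 2 ∂P ≤ μ + 1 := by
    simp only [e]
    set F : Ω → ℝ := (fun ω => ∑ i ∈ s, ∑ j ∈ s.erase i, (E i ∩ E j).indicator (fun _ => (1 : ℝ)) ω) with hF
    change ∫ ω, F ω ∂P ≤ _ at hD1
    change ∫ ω, ((N ω + F ω) - 2 * μ * N ω) + μ ^ 2 ∂P ≤ _
    have i1 : Integrable (fun ω => N ω + F ω) P := hNi.add hDi
    have i2 : Integrable (fun ω => 2 * μ * N ω) P := hNi.const_mul _
    have i3 : Integrable (fun ω => (N ω + F ω) - 2 * μ * N ω) P := i1.sub i2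
    rw [integral_add i3 (integrable_const _), integral_sub i1 i2, integral_add hNi hDi, integral_const_mul, hN1]
    simp only [integral_const, probReal_univ, smul_eq_mul, one_mul]
    nlinarith
  have hM := mul_meas_ge_le_integral_of_nonneg (μ := P) (ae_of_all _ fun ω => sq_nonneg (N ω - μ)) hVi ((μ / 2) ^ 2)
  have hsub : P.real {ω | N ω ≤ k} ≤ P.real {ω | (μ / 2) ^ 2 ≤ (N ω - μ) ^ 2} := by
    refine measureReal_mono ?_ (measure_ne_top _ _)
    intro ω hω
    simp only [Set.mem_setOf_eq] at hω ⊢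
    nlinarith
  rw [le_div_iff₀ (by linarith)]
  have h4 : (μ / 2) ^ 2 * P.real {ω | N ω ≤ k} ≤ μ + 1 := (mul_le_mul_of_nonneg_left hsub (sq_nonneg _)).trans (hM.trans hV)
  have h5 : 0 ≤ P.real {ω | N ω ≤ k} := measureReal_nonneg
  by_contra hcon
  push Not at hcon
  nlinarith

lemma bdry_card (d n r : ℕ) (hr : r ≤ n) :
    (((cube d n).filter (fun x => ∃ z ∈ cube d r, x + z ∉ cube d n)).card : ℝ) ≤ (cube d n).card * (2 * r * d / (2 * n + 1)) := by
  classical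
  have hsub : (cube d n).filter (fun x => ∃ z ∈ cube d r, x + z ∉ cube d n) ⊆ cube d n \ cube d (n - r) := by
    intro x hx
    obtain ⟨hx, z, hz, h⟩ := Finset.mem_filter.1 hx
    refine Finset.mem_sdiff.2 ⟨hx, fun h' => h ?_⟩
    rw [mem_cube] at *
    intro i
    have h1 := hz i
    have h2 := h' i
    have h3 := abs_add_le (x i) (z i)
    simp only [Pi.add_apply]
    omega
  have hcc : cube d (n - r) ⊆ cube d n := by
    intro x hx; rw [mem_cube] at *; intro i; have := hx i; omega
  have h1 := Finset.card_le_card hsub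
  rw [Finset.card_sdiff_of_subset hcc] at h1
  have h2 : ((cube d n).card : ℝ) = (2 * n + 1) ^ d := by rw [card_cube]; push_cast; rfl
  have h3 : ((cube d (n - r)).card : ℝ) = (2 * (n - r) + 1) ^ d := by
    rw [card_cube]; push_cast [Nat.cast_sub hr]; rfl
  have h4 := Finset.card_le_card hcc
  have h5 : (((cube d n).filter (fun x => ∃ z ∈ cube d r, x + z ∉ cube d n)).card : ℝ) ≤ (cube d n).card - (cube d (n - r)).card := by
    rw [← Nat.cast_sub h4]; exact_mod_cast h1
  refine h5.trans ?_
  rw [h2, h3]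
  have hn : (0 : ℝ) < 2 * n + 1 := by positivity
  have hrn : (r : ℝ) ≤ n := by exact_mod_cast hr
  have hb := one_add_mul_le_pow (a := -(2 * r / (2 * n + 1) : ℝ)) (by
    have : (2 * r / (2 * n + 1) : ℝ) ≤ 1 := by rw [div_le_one hn]; linarith
    linarith) d
  have e : (2 * ((n : ℝ) - r) + 1) ^ d = (2 * n + 1) ^ d * (1 + -(2 * r / (2 * n + 1) : ℝ)) ^ d := by
    rw [← mul_pow]; congr 1; field_simp; ring
  rw [e]
  have hp : (0 : ℝ) < (2 * n + 1) ^ d := by positivity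
  have := mul_le_mul_of_nonneg_left hb hp.le
  have e2 : (2 * (r : ℝ) * d / (2 * n + 1)) = d * (2 * r / (2 * n + 1)) := by ring
  rw [e2]; nlinarith

namespace GField
variable {d : ℕ} {Ω H : Type*} [MeasurableSpace Ω] [NormedAddCommGroup H] [InnerProductSpace ℝ H]
    {P : Measure Ω} {ξ : Ω → (Fin d → ℤ) → ℝ}
    {u : (Fin d → ℤ) → ℝ} {X : ((Fin d → ℤ) →₀ ℝ) →ₗ[ℝ] (Ω → ℝ)} {T : ((Fin d → ℤ) →₀ ℝ) →ₗ[ℝ] H}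
    {Q : Finset (Fin d → ℤ)} {a D c C0 ε : ℝ}

lemma G5_bd (G : GField P ξ u X T) (n r : ℕ) (R : Reg d (cube d n) u a D c C0 ε) (hr : r ≤ n) (t : ℝ) :
    P.real {ω | ¬ ∀ x ∈ cube d n, a - t / a < ξ ω x → ∀ z ∈ cube d r, x + z ∈ cube d n} ≤
      C0 * Real.exp t * (2 * r * d / (2 * n + 1)) := by
  classical
  have := G.iso.prob
  have ha : 0 < a := by linarith [R.ha]
  refine (union_bd ((cube d n).filter (fun x => ∃ z ∈ cube d r, x + z ∉ cube d n)) (fun x => {ω | a - t / a < ξ ω x}) _ ?_).trans ?_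
  · intro ω hω
    simp only [Set.mem_setOf_eq] at hω
    push Not at hω
    obtain ⟨x, hx, h, z, hz, hzz⟩ := hω
    exact ⟨x, Finset.mem_filter.2 ⟨hx, z, hz, hzz⟩, h⟩
  · have h : ∀ x ∈ ((cube d n).filter (fun x => ∃ z ∈ cube d r, x + z ∉ cube d n)), P.real {ω | a - t / a < ξ ω x} ≤ nphi a / a * Real.exp t := by
      intro x _
      have := G.tail x a (a - t / a) ha
      have e : a * (a - (a - t / a)) = t := by field_simp; ring
      rwa [e] at this
    refine (Finset.sum_le_card_nsmul _ _ _ h).trans ?_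
    rw [nsmul_eq_mul]
    have hp := nphi_pos a
    have hB := bdry_card d n r hr
    calc _ ≤ ((cube d n).card * (2 * r * d / (2 * n + 1)) : ℝ) * (nphi a / a * Real.exp t) := by gcongr
      _ = ((cube d n).card * (nphi a / a)) * Real.exp t * (2 * r * d / (2 * n + 1)) := by ring
      _ ≤ _ := by have := R.NC; gcongr

lemma G3_bd (G : GField P ξ u X T) (R : Reg d Q u a D c C0 ε) (hd : 1 ≤ d) (k : ℕ) (t : ℝ) (t0 : 1 ≤ t) (tk : 2 * (k : ℝ) ≤ t) (ht1 : t ≤ a) (ht2 : t / a ≤ c * a / (16 * D))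
    (hsm : 3 * C0 * 3 ^ d * Real.exp (-a) + C0 * 3 ^ d * Real.exp (2 * t) * Real.exp (-a) ≤ 1 / 2)
    (hsm2 : (Real.exp (48 * d * ε) - 1) * (C0 * Real.exp t) ^ 2 ≤ 1 / 2) :
    P.real {ω | ¬ k + 1 ≤ (Q.filter (fun x => a - t / a < ξ ω x)).card} ≤ 8 / t := by
  classical
  have := G.iso.prob
  have ha : 48 ≤ a := R.ha
  have ha0 : 0 < a := by linarith
  have hp := nphi_pos a
  set W := Set.Ioc (a - t / a) a with hW
  set g := (gaussianReal 0 1).real W with hg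
  have hta : t / a ≤ 1 := by rw [div_le_one ha0]; exact ht1
  have hta0 : 0 ≤ t / a := by positivity
  set E : (Fin d → ℤ) → Set Ω := fun x => {ω | ξ ω x ∈ W} with hE
  have hEm : ∀ x, MeasurableSet (E x) := fun x => (G.measξ x) measurableSet_Ioc
  have hEg : ∀ x, P.real (E x) = g := fun x => G.real_eq x measurableSet_Ioc
  have hμ : ∑ x ∈ Q, P.real (E x) = Q.card * g := by
    simp only [hEg, Finset.sum_const, nsmul_eq_mul]
  have hμl : t ≤ Q.card * g := by
    have h1 := gauss_window_lower (a - t / a) a 0 (by linarith) (by linarith)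
    have h2 : (a - (a - t / a)) * nphi a = t * (nphi a / a) := by field_simp; ring
    rw [h2] at h1
    have h3 : (Q.card : ℝ) * (t * (nphi a / a)) ≤ Q.card * g := by gcongr
    have h4 : (Q.card : ℝ) * (t * (nphi a / a)) = t * (Q.card * (nphi a / a)) := by ring
    nlinarith [R.N1]
  have hμu : Q.card * g ≤ C0 * Real.exp t := by
    have h1 : g ≤ nphi a / a * Real.exp t := by
      have h3 := gauss_tail_upper a (a - t / a) ha0
      have h4 : a * (a - (a - t / a)) = t := by field_simp; ring
      rw [h4] at h3
      refine le_trans (measureReal_mono ?_ (measure_ne_top _ _)) h3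
      exact fun x hx => hx.1
    calc (Q.card : ℝ) * g ≤ Q.card * (nphi a / a * Real.exp t) := by gcongr
      _ = (Q.card * (nphi a / a)) * Real.exp t := by ring
      _ ≤ _ := by have := R.NC; gcongr
  have hpair := G.pair_sum R hd t (by linarith) ht1 ht2 (A := W ×ˢ W) (measurableSet_Ioc.prod measurableSet_Ioc)
    (fun p hp => ⟨hp.1.1, by linarith [hp.1.2], hp.2.1, by linarith [hp.2.2]⟩)
  rw [measureReal_prod_prod] at hpair
  have h2 : ∑ i ∈ Q, ∑ j ∈ Q.erase i, P.real (E i ∩ E j) ≤ 1 + (Q.card * g) ^ 2 := by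
    have e : ∀ i j, E i ∩ E j = {ω | (ξ ω i, ξ ω j) ∈ W ×ˢ W} := fun i j => by
      ext ω; simp [hE]
    simp only [e]
    refine hpair.trans ?_
    have e2 : (Q.card : ℝ) ^ 2 * (g * g) = (Q.card * g) ^ 2 := by ring
    change _ + Real.exp (48 * d * ε) * ((Q.card : ℝ) ^ 2 * (g * g)) ≤ _
    rw [e2]
    have h5 : 1 ≤ Real.exp (48 * d * ε) := Real.one_le_exp (by have := R.e0; positivity)
    have h6 : (Q.card * g) ^ 2 ≤ (C0 * Real.exp t) ^ 2 := pow_le_pow_left₀ (by linarith) hμu 2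
    nlinarith
  have := count_bd (P := P) Q E hEm (Q.card * g) k hμ h2 (by linarith) (by linarith)
  refine le_trans (measureReal_mono ?_ (measure_ne_top _ _)) (this.trans ?_)
  · intro ω hω
    simp only [Set.mem_setOf_eq] at hω ⊢
    push Not at hω
    have h7 : ∑ i ∈ Q, (E i).indicator (fun _ => (1 : ℝ)) ω ≤ ((Q.filter (fun x => a - t / a < ξ ω x)).card : ℝ) := by
      rw [Finset.card_filter]
      push_cast
      refine Finset.sum_le_sum fun i _ => ?_
      by_cases h : ω ∈ E i
      · have h' : a - t / a < ξ ω i := h.1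
        simp [h, h']
      · rw [Set.indicator_of_notMem h]; split_ifs <;> norm_num
    refine h7.trans ?_
    exact_mod_cast Nat.lt_succ_iff.1 hω
  · exact div_le_div_of_nonneg_left (by norm_num) (by linarith) hμl

end GField


lemma Stat.D_norm_eq {d : ℕ} {H H' : Type*} [NormedAddCommGroup H] [InnerProductSpace ℝ H] [NormedAddCommGroup H'] [InnerProductSpace ℝ H']
    {e : (Fin d → ℤ) → H} {e' : (Fin d → ℤ) → H'} {u : (Fin d → ℤ) → ℝ} (h : Stat e u) (h' : Stat e' u) (x : Fin d → ℤ) :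
    ‖Dv e x‖ = ‖Dv e' x‖ := by
  have : ‖Dv e x‖ ^ 2 = ‖Dv e' x‖ ^ 2 := by
    rw [← real_inner_self_eq_norm_sq, ← real_inner_self_eq_norm_sq]
    simp only [Dv, inner_add_left, inner_add_right, inner_sub_left, inner_sub_right, inner_smul_left, inner_smul_right, h.inn, h'.inn]
  rwa [sq_eq_sq₀ (norm_nonneg _) (norm_nonneg _)] at this

lemma LocEig.beta_le {d : ℕ} {C : Finset (Fin d → ℤ)} {w f : (Fin d → ℤ) → ℝ} {a K lam : ℝ} (ha : 0 < a)
    (h : LocEig C (fun x => a * (1 - w x)) K lam f) :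
    ∑ x ∈ C, f x ^ 2 * (1 - w x) ≤ (16 * d ^ 3 + 2 * d) * (1 / (K * a)) := by
  have h1 := h.Senergy_le
  have h2 : ∑ x ∈ C, a * (1 - w x) * f x ^ 2 = a * ∑ x ∈ C, f x ^ 2 * (1 - w x) := by
    rw [Finset.mul_sum]; exact Finset.sum_congr rfl fun x _ => by ring
  rw [h2] at h1
  have hK := h.Kpos
  rw [← div_eq_mul_one_div, le_div_iff₀ (by positivity)]
  rw [le_div_iff₀ hK] at h1
  linarith

namespace GField
variable {d : ℕ} {Ω H : Type*} [MeasurableSpace Ω] [NormedAddCommGroup H] [InnerProductSpace ℝ H]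
    {P : Measure Ω} {ξ : Ω → (Fin d → ℤ) → ℝ}
    {u : (Fin d → ℤ) → ℝ} {X : ((Fin d → ℤ) →₀ ℝ) →ₗ[ℝ] (Ω → ℝ)} {T : ((Fin d → ℤ) →₀ ℝ) →ₗ[ℝ] H}
    {Q : Finset (Fin d → ℤ)} {a D c C0 ε : ℝ}

lemma tau_norm (G : GField P ξ u X T) (C : Finset (Fin d → ℤ)) (v fb : (Fin d → ℤ) → ℝ) (τ : ℝ) (hτ0 : 0 ≤ τ)
    (hτ : τ ^ 2 = variance (fun ω => ∑ x ∈ C.erase 0, fb x ^ 2 * (ξ ω x - ξ ω 0 * v x)) P) :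
    ‖∑ x ∈ C.erase 0, fb x ^ 2 • (T (Finsupp.single (0 + x) 1) - v x • T (Finsupp.single (0 + 0) 1))‖ = τ := by
  have := G.iso.prob
  set cb : (Fin d → ℤ) →₀ ℝ := ∑ x ∈ C.erase 0, fb x ^ 2 • (Finsupp.single x 1 - v x • Finsupp.single 0 1) with hcb
  have h1 : T cb = ∑ x ∈ C.erase 0, fb x ^ 2 • (T (Finsupp.single (0 + x) 1) - v x • T (Finsupp.single (0 + 0) 1)) := by
    rw [hcb, map_sum]
    refine Finset.sum_congr rfl fun x _ => ?_
    rw [map_smul, map_sub, map_smul, zero_add, zero_add]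
  have h2 : (fun ω => ∑ x ∈ C.erase 0, fb x ^ 2 * (ξ ω x - ξ ω 0 * v x)) = X cb := by
    funext ω
    rw [hcb, map_sum, Finset.sum_apply]
    refine Finset.sum_congr rfl fun x _ => ?_
    rw [map_smul, map_sub, map_smul]
    simp only [Pi.sub_apply, Pi.smul_apply, G.Xs, smul_eq_mul]
    ring
  rw [h2, variance_eq_integral (G.iso.meas cb).aemeasurable, G.iso.mean cb] at hτ
  simp only [sub_zero] at hτ
  rw [G.iso.sq cb] at hτ
  rw [← h1]
  exact ((sq_eq_sq₀ hτ0 (norm_nonneg _)).1 hτ).symm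

lemma D_bd (G : GField P ξ u X T) (C : Finset (Fin d → ℤ)) (v fb : (Fin d → ℤ) → ℝ) (τ K lb E : ℝ) (hτ0 : 0 ≤ τ)
    (hτ : τ ^ 2 = variance (fun ω => ∑ x ∈ C.erase 0, fb x ^ 2 * (ξ ω x - ξ ω 0 * v x)) P)
    (ha : 0 < a) (hv0 : v 0 = 1) (hv1 : ∀ x, v x ≤ 1)
    (hb : LocEig C (fun x => a * (1 - v x)) K lb fb) (hfb : ∀ x, 0 ≤ fb x) (hdir : ∀ p, dir p ∈ C)
    (hK1 : 1 ≤ K) (hE : ∀ p : Fin d × Bool, a * (1 - v (dir p)) ≤ K * E) (y : Fin d → ℤ) (p : Fin d × Bool) :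
    ‖Dv (fun x => T (Finsupp.single (y + x) 1)) (dir p)‖ ≤
      4 / 3 * (K * (16 * d ^ 3 + 2 * d + E)) ^ 2 * (2 * τ + 2 * ((16 * d ^ 3 + 2 * d) * (1 / (K * a)))) := by
  rw [Stat.D_norm_eq (G.stat y) (G.stat 0)]
  set e : (Fin d → ℤ) → H := fun x => T (Finsupp.single (0 + x) 1) with he
  have hst := G.stat 0
  have h1 := hst.cross C (fun x => fb x ^ 2) (fun x => sq_nonneg _) (dir p) (hdir p)
  have h2 := hst.star_tau C (fun x => fb x ^ 2) v hv0 (fun x => sq_nonneg _) hv1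
  rw [G.tau_norm C v fb τ hτ0 hτ] at h2
  have h3 := hb.beta_le ha
  have h4 : fb (dir p) ^ 2 * ‖Dv e (dir p)‖ ≤ 2 * τ + 2 * ((16 * d ^ 3 + 2 * d) * (1 / (K * a))) := by
    refine h1.trans (h2.trans ?_)
    linarith
  set c3 : ℝ := 16 * d ^ 3 + 2 * d with hc3
  have hc30 : 0 ≤ c3 := by positivity
  have h5 : fb 0 ≤ fb (dir p) * (K * (c3 + E)) := by
    have e1 := hb.eq (dir p) (hdir p)
    have e2 : fb 0 ≤ nbs fb (dir p) := by
      unfold nbs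
      have := Finset.single_le_sum (f := fun q => fb (dir p + dir q)) (s := Finset.univ) (fun q _ => hfb _) (Finset.mem_univ (p.1, !p.2))
      refine le_trans (le_of_eq ?_) this
      rw [dir_neg, show ((p.1, p.2) : Fin d × Bool) = p from rfl, add_neg_cancel]
    rw [e1] at e2
    refine e2.trans ?_
    rw [mul_comm]
    refine mul_le_mul_of_nonneg_left ?_ (hfb _)
    have e3 := hb.lam_le
    have e4 : c3 / K ≤ K * c3 := by
      rw [div_le_iff₀ (by linarith)]
      have h11 : 1 ≤ K * K := by nlinarith
      nlinarith [mul_le_mul_of_nonneg_left h11 hc30]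
    have := hE p
    linarith
  have h6 : 3 / 4 ≤ fb 0 ^ 2 := by
    have e1 := hb.f0
    have e2 : 8 * (d : ℝ) ^ 2 / K ^ 2 ≤ 1 / 4 := by
      rw [div_le_iff₀ (by positivity)]; linarith [hb.small]
    linarith
  have h7 : 3 / 4 ≤ fb (dir p) ^ 2 * (K * (c3 + E)) ^ 2 := by
    rw [← mul_pow]
    exact h6.trans (pow_le_pow_left₀ (hfb 0) h5 2)
  have hn := norm_nonneg (Dv e (dir p))
  have h8 := mul_le_mul_of_nonneg_right h7 hn
  have h9 := mul_le_mul_of_nonneg_right h4 (sq_nonneg (K * (c3 + E)))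
  nlinarith

lemma s_bd (G : GField P ξ u X T) (C : Finset (Fin d → ℤ)) (v fb : (Fin d → ℤ) → ℝ) (τ K lb E : ℝ) (hτ0 : 0 ≤ τ)
    (hτ : τ ^ 2 = variance (fun ω => ∑ x ∈ C.erase 0, fb x ^ 2 * (ξ ω x - ξ ω 0 * v x)) P)
    (ha : 0 < a) (hv0 : v 0 = 1) (hv1 : ∀ x, v x ≤ 1)
    (hb : LocEig C (fun x => a * (1 - v x)) K lb fb) (hfb : ∀ x, 0 ≤ fb x) (hdir : ∀ p, dir p ∈ C)
    (hK1 : 1 ≤ K) (hE : ∀ p : Fin d × Bool, a * (1 - v (dir p)) ≤ K * E) 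
    (r : ℕ) (f : (Fin d → ℤ) → ℝ) (lt : ℝ) (h : LocEig (cube d r) (fun x => a * (1 - u x)) K lt f) (hfe : ∀ x, f (-x) = f x)
    (c3 : ℝ) (hc3 : c3 = 16 * d ^ 3 + 2 * d) (y : Fin d → ℤ) :
    ‖T (cX (cube d r) f u y)‖ ≤ (32 / 3 * d ^ 2 * (c3 + E) ^ 2 * (1 + c3) + c3) * (τ + 1 / (K * a)) := by
  have h1 := (G.stat y).X_norm (cube d r) (fun x hx => cube_neg hx) (fun x => f x ^ 2) (fun x => sq_nonneg _)
    (fun x => by simp only [hfe]) G.u_le _ (G.D_bd C v fb τ K lb E hτ0 hτ ha hv0 hv1 hb hfb hdir hK1 hE y)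
  rw [G.T_cX]
  have h2 := h.N_le
  have h3 := h.beta_le ha
  rw [← hc3] at h1 h3
  have hc30 : 0 ≤ c3 := by rw [hc3]; positivity
  set q := 1 / (K * a) with hq
  have hq0 : 0 ≤ q := by positivity
  set M := 4 / 3 * (K * (c3 + E)) ^ 2 * (2 * τ + 2 * (c3 * q)) with hM
  have hM0 : 0 ≤ M := by positivity
  have h4 : (∑ x ∈ cube d r, n1 x ^ 2 * f x ^ 2) * M / 2 ≤ (8 * d ^ 2 / K ^ 2) * M / 2 := by gcongr
  have h5 : (8 * d ^ 2 / K ^ 2) * M / 2 = 32 / 3 * d ^ 2 * (c3 + E) ^ 2 * (τ + c3 * q) := by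
    rw [hM]; field_simp; ring
  refine h1.trans ?_
  have h6 : τ + c3 * q ≤ (1 + c3) * (τ + q) := by nlinarith
  have h7 : 32 / 3 * (d : ℝ) ^ 2 * (c3 + E) ^ 2 * (τ + c3 * q) ≤ 32 / 3 * d ^ 2 * (c3 + E) ^ 2 * ((1 + c3) * (τ + q)) := by gcongr
  nlinarith

lemma bad_bd (G : GField P ξ u X T) (n r k : ℕ) (R : Reg d (cube d n) u a D c C0 ε) (hd : 1 ≤ d) (f : (Fin d → ℤ) → ℝ)
    (s t t1 δ e : ℝ) (hr1 : 2 * r + 2 ≤ ⌊Real.exp a⌋₊) (hr2 : r ≤ n) (hs : 0 < s) (hX : ∀ y, ‖T (cX (cube d r) f u y)‖ ≤ s)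
    (hsm : 128 * a ^ 2 * s ^ 2 + 2048 * a / (c * a / (16 * D)) * bet (cube d r) f u ≤ 1) (he : 0 < e)
    (ht1 : 1 ≤ t1) (htk : 2 * (k : ℝ) ≤ t1) (htt : t1 ≤ t) (hta : t ≤ a) (hta2 : t / a ≤ c * a / (16 * D)) (hδ : 0 ≤ δ)
    (hm1 : 3 * C0 * 3 ^ d * Real.exp (-a) + C0 * 3 ^ d * Real.exp (2 * t1) * Real.exp (-a) ≤ 1 / 2)
    (hm2 : (Real.exp (48 * d * ε) - 1) * (C0 * Real.exp t1) ^ 2 ≤ 1 / 2) :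
    P.real {ω | ¬ Good (cube d n) r k f u (ξ ω) a (c * a / (16 * D)) t t1 δ e} ≤
      4 * C0 * Real.exp (-t) + 8 / t1 + Real.exp (48 * d * ε) * (C0 ^ 2 * (2 * δ * Real.exp (2 * t)))
      + (6 * C0 * 3 ^ d + C0 * 3 ^ d * Real.exp (2 * t)) * Real.exp (-a)
      + C0 * Real.exp t * (2 * r * d / (2 * n + 1))
      + C0 * Real.exp t * ((a ^ 2 * s ^ 2 + 16 * a / (c * a / (16 * D)) * bet (cube d r) f u) / e ^ 2) := by
  have := G.iso.prob
  have ha : 48 ≤ a := R.ha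
  have hm : 0 < c * a / (16 * D) := by have := R.c0; have := R.D1; positivity
  have h1 := G.G1_bd R r hr1
  have h2 := G.G2_bd R t
  have h3 := G.G3_bd R hd k t1 ht1 htk (htt.trans hta) (le_trans (by gcongr) hta2) hm1 hm2
  have h4 := G.G4_bd R hd t δ (by linarith) hta hta2 hδ
  have h5 := G.G5_bd n r R hr2 t
  have h6 := G.G6_bd R (cube d r) f _ s t e hm hs hX hsm he
  have h7 := G.G7_bd R (cube d r) f _ s t hm hs hX hsm
  set m := c * a / (16 * D) with hmdef
  have hU : ∀ A B : Set Ω, P.real (A ∪ B) ≤ P.real A + P.real B := fun A B => measureReal_union_le A B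
  set B1 := {ω | ¬ ∀ y ∈ cube d n, ∀ x, x ≠ y → x - y ∈ cube d (2 * r + 2) → ¬ (a - m < ξ ω y ∧ a - m < ξ ω x)}
  set B2 := {ω | ¬ ∀ x ∈ cube d n, ξ ω x ≤ a + t / a}
  set B3 := {ω | ¬ k + 1 ≤ ((cube d n).filter (fun x => a - t1 / a < ξ ω x)).card}
  set B4 := {ω | ¬ ∀ x ∈ cube d n, ∀ z ∈ cube d n, x ≠ z → a - t / a < ξ ω x → a - t / a < ξ ω z → δ / a < |ξ ω x - ξ ω z|}
  set B5 := {ω | ¬ ∀ x ∈ cube d n, a - t / a < ξ ω x → ∀ z ∈ cube d r, x + z ∈ cube d n}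
  set B6 := {ω | ¬ ∀ x ∈ cube d n, a - t / a < ξ ω x → a * YY (cube d r) f u (ξ ω) a m x ≤ e ^ 2}
  set B7 := {ω | ¬ ∀ x ∈ cube d n, ξ ω x ≤ a - t / a → YY (cube d r) f u (ξ ω) a m x ≤ (a - ξ ω x) / 16}
  have hsub : {ω | ¬ Good (cube d n) r k f u (ξ ω) a m t t1 δ e} ⊆ B1 ∪ (B2 ∪ (B3 ∪ (B4 ∪ (B5 ∪ (B6 ∪ B7))))) := by
    intro ω hω
    by_contra hc
    simp only [Set.mem_union, not_or] at hc
    obtain ⟨c1, c2, c3, c4, c5, c6, c7⟩ := hc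
    exact hω ⟨not_not.1 c1, not_not.1 c2, not_not.1 c3, not_not.1 c4, not_not.1 c5, not_not.1 c6, not_not.1 c7⟩
  have h0 := measureReal_mono (μ := P) hsub (measure_ne_top _ _)
  have u1 := hU B1 (B2 ∪ (B3 ∪ (B4 ∪ (B5 ∪ (B6 ∪ B7)))))
  have u2 := hU B2 (B3 ∪ (B4 ∪ (B5 ∪ (B6 ∪ B7))))
  have u3 := hU B3 (B4 ∪ (B5 ∪ (B6 ∪ B7)))
  have u4 := hU B4 (B5 ∪ (B6 ∪ B7))
  have u5 := hU B5 (B6 ∪ B7)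
  have u6 := hU B6 B7
  linarith

end GField


lemma znorm_zero' {d : ℕ} : znorm (0 : Fin d → ℤ) = 0 := by simp [znorm]

lemma znorm_dir {d : ℕ} (p : Fin d × Bool) : znorm (dir p) = 1 := by
  have h : ∀ i, ((dir p i : ℤ) : ℝ) ^ 2 = ((|dir p i| : ℤ) : ℝ) := by
    intro i
    have h2 : |dir p i| ≤ 1 := by
      rw [← sum_abs_dir p]
      exact Finset.single_le_sum (f := fun i => |dir p i|) (fun _ _ => abs_nonneg _) (mem_univ i)
    have : dir p i ^ 2 = |dir p i| := by
      rw [abs_le] at h2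
      obtain ⟨h3, h4⟩ := h2
      interval_cases h5 : dir p i <;> simp
    exact_mod_cast this
  unfold znorm
  simp_rw [h]
  rw [← Int.cast_sum, sum_abs_dir]; simp

lemma QBox_nat (d L : ℕ) : QBox d (L : ℝ) = cube d (L / 2) := by
  have h : ⌊(L : ℝ) / 2⌋ = ((L / 2 : ℕ) : ℤ) := by
    rw [Int.floor_eq_iff]
    have h1 : 2 * (L / 2) ≤ L := Nat.mul_div_le L 2
    have h2 : L < 2 * (L / 2) + 2 := by omega
    have h1' : (2 : ℝ) * ((L / 2 : ℕ) : ℝ) ≤ L := by exact_mod_cast h1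
    have h2' : (L : ℝ) < 2 * ((L / 2 : ℕ) : ℝ) + 2 := by exact_mod_cast h2
    constructor
    · rw [Int.cast_natCast]; linarith
    · rw [Int.cast_natCast]; linarith
  unfold QBox cube
  rw [Int.ceil_neg, h]

namespace GaussSetting
variable {d : ℕ} {Ω : Type} [MeasurableSpace Ω] (S : GaussSetting d Ω) {c c' : ℝ}

lemma base (hSR : S.ShortRangeDecay c c') (L : ℕ) (hL : 2 ≤ L) :
    1 ≤ S.dL L ∧ c ≤ 1 ∧ (∀ x, x ≠ 0 → S.v L x ≤ 1 - c / S.dL L) ∧ (∀ x, S.v L x ≤ 1) ∧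
    (∀ x, x ≠ 0 → usym (S.v L) x ≤ 1 - c / S.dL L) := by
  have hD := S.dL_pos L hL
  obtain ⟨x, hx, hv⟩ := (S.dL_def L hL).1
  have hx0 : x ≠ 0 := by rintro rfl; rw [znorm_zero'] at hx; norm_num at hx
  have h1 := S.v_nonneg L x
  have h2 := (hSR.2.2 L hL x hx0).2
  have h3 : 1 / S.dL L ≤ 1 := by linarith
  have h4 : c / S.dL L ≤ 1 / S.dL L := by linarith
  have h5 : ∀ x, x ≠ 0 → S.v L x ≤ 1 - c / S.dL L := fun x hx => (hSR.2.2 L hL x hx).2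
  refine ⟨?_, ?_, h5, ?_, ?_⟩
  · rwa [div_le_one hD] at h3
  · rwa [div_le_div_iff_of_pos_right hD] at h4
  · intro x
    by_cases h : x = 0
    · rw [h, S.v_zero]
    · have := h5 x h
      have : 0 ≤ c / S.dL L := div_nonneg hSR.1.le hD.le
      linarith [h5 x h]
  · intro x hx
    unfold usym
    linarith [h5 x hx, h5 (-x) (neg_ne_zero.2 hx)]

lemma prob_eq (L : ℕ) (hL : 2 ≤ L) : (gaussianReal 0 1).real (Set.Ioi (S.aL L)) = 1 / (L : ℝ) ^ d := by
  obtain ⟨X, T, G⟩ := S.exists_GField L hL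
  rw [← G.real_eq 0 measurableSet_Ioi]
  have := S.aL_def L hL
  rw [Measure.real, show {ω | S.ξ L ω 0 ∈ Set.Ioi (S.aL L)} = {ω | S.aL L < S.ξ L ω 0} from rfl, this,
    ENNReal.toReal_ofReal (by positivity)]

lemma Lpow (L : ℕ) (hL : 2 ≤ L) (ha : 1 ≤ S.aL L) :
    1 ≤ (L : ℝ) ^ d * (nphi (S.aL L) / S.aL L) ∧ (L : ℝ) ^ d * (nphi (S.aL L) / S.aL L) ≤ Real.exp 2 := by
  have h1 := S.prob_eq L hL
  have h2 := gauss_tail_lower (S.aL L) ha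
  have h3 := gauss_tail_upper (S.aL L) (S.aL L) (by linarith)
  rw [sub_self, mul_zero, Real.exp_zero, mul_one] at h3
  rw [h1] at h2 h3
  have hL0 : (0 : ℝ) < (L : ℝ) ^ d := by
    have : (0 : ℝ) < L := by exact_mod_cast (by omega : 0 < L)
    positivity
  constructor
  · rw [div_le_iff₀ hL0] at h3; linarith
  · rw [le_div_iff₀ hL0] at h2
    have e : Real.exp 2 * Real.exp (-2) = 1 := by rw [← Real.exp_add]; simp
    have := mul_le_mul_of_nonneg_left h2 (Real.exp_pos 2).le
    calc _ = (Real.exp 2 * Real.exp (-2)) * ((L : ℝ) ^ d * (nphi (S.aL L) / S.aL L)) := by rw [e, one_mul]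
      _ = Real.exp 2 * (Real.exp (-2) * (nphi (S.aL L) / S.aL L) * (L : ℝ) ^ d) := by ring
      _ ≤ _ := by linarith

lemma L_le (hd : 1 ≤ d) (L : ℕ) (hL : 2 ≤ L) (ha : 48 ≤ S.aL L) : Real.sqrt (Real.log L) ≤ S.aL L := by
  have h1 := (S.Lpow L hL (by linarith)).2
  set a := S.aL L with haa
  have hL1 : (1 : ℝ) ≤ L := by exact_mod_cast (by omega : 1 ≤ L)
  have h2 : (L : ℝ) ≤ (L : ℝ) ^ d := le_self_pow₀ hL1 (by omega)
  have h3 := exp_le_nphi a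
  have h4 : Real.exp (-a ^ 2 / 2) / 3 / a ≤ nphi a / a := by gcongr; linarith
  have h5 : (L : ℝ) * (Real.exp (-a ^ 2 / 2) / 3 / a) ≤ Real.exp 2 :=
    (mul_le_mul h2 h4 (by positivity) (by positivity)).trans h1
  have h6 : (L : ℝ) ≤ Real.exp (a ^ 2) := by
    have e1 : (L : ℝ) * Real.exp (-a ^ 2 / 2) ≤ Real.exp 2 * (3 * a) := by
      rw [div_div, mul_div_assoc', div_le_iff₀ (by positivity)] at h5; exact h5
    have e2 : (3 : ℝ) ≤ Real.exp 2 := by linarith [Real.add_one_le_exp (2 : ℝ)]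
    have e3 : a ≤ Real.exp a := by linarith [Real.add_one_le_exp a]
    have e4 : Real.exp 2 * (3 * a) ≤ Real.exp 2 * (Real.exp 2 * Real.exp a) := by gcongr
    have e5 : Real.exp 2 * (Real.exp 2 * Real.exp a) ≤ Real.exp (a ^ 2 / 2) := by
      rw [← Real.exp_add, ← Real.exp_add]; apply Real.exp_le_exp.2; nlinarith
    have e6 : (L : ℝ) * Real.exp (-a ^ 2 / 2) * Real.exp (a ^ 2 / 2) = L := by
      rw [mul_assoc, ← Real.exp_add]; ring_nf; simp
    calc (L : ℝ) = (L : ℝ) * Real.exp (-a ^ 2 / 2) * Real.exp (a ^ 2 / 2) := e6.symm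
      _ ≤ Real.exp (a ^ 2 / 2) * Real.exp (a ^ 2 / 2) := by gcongr; linarith
      _ = _ := by rw [← Real.exp_add]; ring_nf
  rw [Real.sqrt_le_left (by linarith)]
  exact (Real.log_le_iff_le_exp (by linarith)).2 h6

lemma le_L (hd : 1 ≤ d) (L : ℕ) (hL : 2 ≤ L) (ha : 48 ≤ S.aL L) (had : 2 * (d : ℝ) ≤ S.aL L) : Real.exp (S.aL L) ≤ L := by
  have h1 := (S.Lpow L hL (by linarith)).1
  set a := S.aL L with haa
  have h2 := nphi_le_exp a
  have h3 : nphi a / a ≤ Real.exp (-a ^ 2 / 2) := by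
    rw [div_le_iff₀ (by linarith)]
    have := Real.exp_pos (-a ^ 2 / 2)
    nlinarith
  have h4 : 1 ≤ (L : ℝ) ^ d * Real.exp (-a ^ 2 / 2) := h1.trans (by gcongr)
  have h5 : Real.exp (a ^ 2 / 2) ≤ (L : ℝ) ^ d := by
    have e6 : (L : ℝ) ^ d * Real.exp (-a ^ 2 / 2) * Real.exp (a ^ 2 / 2) = (L : ℝ) ^ d := by
      rw [mul_assoc, ← Real.exp_add]; ring_nf; simp
    rw [← e6]
    have := Real.exp_pos (a ^ 2 / 2)
    nlinarith
  have h6 : Real.exp a ^ d ≤ (L : ℝ) ^ d := by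
    refine le_trans ?_ h5
    rw [← Real.exp_nat_mul]; apply Real.exp_le_exp.2; nlinarith
  exact le_of_pow_le_pow_left₀ (by omega) (by positivity) h6

lemma mkReg (hd : 1 ≤ d) (hSR : S.ShortRangeDecay c c') (L : ℕ) (hL : 2 ≤ L) (ha : 48 ≤ S.aL L) (ε : ℝ) (e0 : 0 ≤ ε) (e1 : ε ≤ 1 / 2)
    (hK : 8 * ((d : ℝ) + 2) ≤ c * S.aL L / S.dL L)
    (hlr : ∀ x : Fin d → ℤ, Real.exp (Real.sqrt (Real.log L)) ≤ znorm x → S.v L x * Real.log (znorm x) ≤ ε) :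
    Reg d (cube d (L / 2)) (usym (S.v L)) (S.aL L) (S.dL L) c (Real.exp 2 * 2 ^ d) ε := by
  obtain ⟨h1, h2, h3, h4, h5⟩ := S.base hSR L hL
  obtain ⟨h6, h7⟩ := S.Lpow L hL (by linarith)
  have hp : 0 ≤ nphi (S.aL L) / S.aL L := div_nonneg (nphi_pos _).le (by linarith)
  have hc1 : (L : ℝ) ≤ 2 * ((L / 2 : ℕ) : ℝ) + 1 := by exact_mod_cast (by omega : L ≤ 2 * (L / 2) + 1)
  have hc2 : 2 * ((L / 2 : ℕ) : ℝ) + 1 ≤ 2 * L := by exact_mod_cast (by omega : 2 * (L / 2) + 1 ≤ 2 * L)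
  refine ⟨ha, h1, hSR.1, h2, h5, hK, ?_, ?_, e0, e1, ?_⟩
  · rw [card_cube]; push_cast
    refine h6.trans ?_
    gcongr
  · rw [card_cube]; push_cast
    calc _ ≤ (2 * (L : ℝ)) ^ d * (nphi (S.aL L) / S.aL L) := by gcongr
      _ = 2 ^ d * ((L : ℝ) ^ d * (nphi (S.aL L) / S.aL L)) := by rw [mul_pow]; ring
      _ ≤ 2 ^ d * Real.exp 2 := by gcongr
      _ = _ := mul_comm _ _
  · intro x hx
    have h8 : Real.exp (Real.sqrt (Real.log L)) ≤ znorm x := (Real.exp_le_exp.2 (S.L_le hd L hL ha)).trans hx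
    have h9 := hlr x h8
    have h10 := hlr (-x) (by rwa [znorm_neg])
    rw [znorm_neg] at h10
    unfold usym
    linarith

lemma rL_ge (hd : 1 ≤ d) (M : MesoData S) (L : ℕ) (hL : 2 ≤ L) (ha : 48 ≤ S.aL L) : S.aL L ≤ M.rL L := by
  have h := M.rL_lower L hL
  rcases lt_trichotomy (M.rL L) 0 with h0 | h0 | h0
  · exfalso
    have h1 := (M.principal L hL).2.1
    have h2 : QBox d (M.rL L) = ∅ := by
      rw [Finset.eq_empty_iff_forall_notMem]
      intro x hx
      unfold QBox at hx
      rw [Finset.mem_Icc] at hx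
      have a1 := hx.1 ⟨0, hd⟩
      have a2 := hx.2 ⟨0, hd⟩
      have a3 := Int.ceil_le.1 a1
      have a4 := Int.le_floor.1 a2
      linarith
    rw [h2] at h1; simp at h1
  · rw [h0, Real.log_zero] at h
    have := Real.log_pos (show 1 < S.aL L by linarith)
    linarith
  · exact (Real.log_le_log_iff (by linarith) h0).1 h

lemma cube_sub (r : ℝ) (hr : 2 ≤ r) : cube d 1 ⊆ QBox d r := by
  intro x hx
  rw [mem_cube] at hx
  unfold QBox
  rw [Finset.mem_Icc]
  constructor
  · intro i
    have := (abs_le.1 (hx i)).1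
    refine Int.ceil_le.2 ?_
    have h2 : ((-1 : ℤ) : ℝ) ≤ (x i : ℝ) := by exact_mod_cast this
    push_cast at h2; linarith
  · intro i
    have := (abs_le.1 (hx i)).2
    refine Int.le_floor.2 ?_
    have h2 : (x i : ℝ) ≤ ((1 : ℤ) : ℝ) := by exact_mod_cast this
    push_cast at h2; linarith

/-- construction of the even profile and the key norm bound. -/
lemma profile (hd : 1 ≤ d) (hSR : S.ShortRangeDecay c c') (M : MesoData S) (L : ℕ) (hL : 2 ≤ L) (ha : 48 ≤ S.aL L) (K : ℝ)
    (hKd : K = c * S.aL L / S.dL L) (hK1 : 1 ≤ K) (small : 32 * (d : ℝ) ^ 2 ≤ K ^ 2) (r : ℕ)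
    {X : ((Fin d → ℤ) →₀ ℝ) →ₗ[ℝ] (Ω → ℝ)} {T : ((Fin d → ℤ) →₀ ℝ) →ₗ[ℝ] (Lp ℝ 2 S.P)}
    (G : GField S.P (S.ξ L) (usym (S.v L)) X T) (c3 : ℝ) (hc3 : c3 = 16 * d ^ 3 + 2 * d) :
    ∃ lt f, LocEig (cube d r) (fun x => S.aL L * (1 - usym (S.v L) x)) K lt f ∧
      bet (cube d r) f (usym (S.v L)) ≤ c3 * (1 / (K * S.aL L)) ∧ 
      ∀ y, ‖T (GField.cX (cube d r) f (usym (S.v L)) y)‖ ≤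
        (32 / 3 * d ^ 2 * (c3 + Real.exp c' / c) ^ 2 * (1 + c3) + c3) * (M.tau L + 1 / (K * S.aL L)) := by
  obtain ⟨h1, h2, h3, h4, h5⟩ := S.base hSR L hL
  have hc := hSR.1
  have a0 : 0 < S.aL L := by linarith
  have hKv : ∀ w : ℝ, w ≤ 1 - c / S.dL L → K ≤ S.aL L * (1 - w) := by
    intro w hw
    have : K = S.aL L * (c / S.dL L) := by rw [hKd]; ring
    rw [this]; gcongr; linarith
  obtain ⟨lt, f, hf, hfe⟩ := exists_even_LocEig (C := cube d r) (Sh := fun x => S.aL L * (1 - usym (S.v L) x)) (K := K)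
    (by simp [G.zero]) (fun x hx => hKv _ (h5 x hx)) (by linarith) zero_mem_cube small (fun x hx => cube_neg hx)
    (fun x => by rw [G.even])
  refine ⟨lt, f, hf, ?_, ?_⟩
  · have := hf.beta_le a0
    rw [hc3]; exact this
  · have hr := S.rL_ge hd M L hL ha
    have hsub : cube d 1 ⊆ QBox d (M.rL L) := cube_sub _ (by linarith)
    have hb : LocEig (QBox d (M.rL L)) (fun x => S.aL L * (1 - S.v L x)) K (M.lamBar L) (M.phiBar L) :=
      principal_LocEig (M.principal L hL) (by simp [S.v_zero]) (fun x hx => hKv _ (h3 x hx)) (by linarith)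
        (hsub zero_mem_cube) small
    refine G.s_bd (QBox d (M.rL L)) (S.v L) (M.phiBar L) (M.tau L) K (M.lamBar L) (Real.exp c' / c) (M.tau_nonneg L) ?_ a0
      (S.v_zero L) h4 hb (M.principal L hL).2.2.1 (fun p => hsub (dir_mem_cube le_rfl p)) hK1 ?_ r f lt hf hfe c3 hc3
    · rw [M.tau_def L hL]
      congr 1
      funext ω
      simp only [Phi, zeta, add_zero, sub_zero]
    · intro p
      have e1 := (hSR.2.2 L hL (dir p) (dir_ne p)).1
      rw [znorm_dir, mul_one] at e1
      have e2 : K * (Real.exp c' / c) = S.aL L * (Real.exp c' / S.dL L) := by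
        rw [hKd]; field_simp
      rw [e2]; gcongr; linarith

end GaussSetting


namespace GaussSetting
variable {d : ℕ} {Ω : Type} [MeasurableSpace Ω] (S : GaussSetting d Ω) {c c' : ℝ}

lemma num1 {a r : ℝ} (ha : 48 ≤ a) (h : r ≤ a + 1) : 2 * r + 2 ≤ Real.exp a := by
  have := Real.quadratic_le_exp_of_nonneg (show 0 ≤ a by linarith)
  nlinarith

lemma num2 {a b q : ℝ} (ha : 48 ≤ a) (hb : 0 ≤ b) (h : a * b ≤ q) : b ≤ q := by nlinarith

lemma num3 {K d : ℝ} (h : 800 * d ^ 2 ≤ K ^ 2) : 32 * d ^ 2 ≤ K ^ 2 := by nlinarith [sq_nonneg d]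

lemma num4 {K a T : ℝ} (h48 : 48 ≤ K) (h1 : T ≤ K) (h2 : K ≤ a) : T ≤ K / 16 * a := by nlinarith

lemma num5 {K a : ℝ} (h48 : 48 ≤ K) (h2 : K ≤ a) : 1 ≤ K ^ 2 * a := by nlinarith [sq_nonneg K]

lemma num6 {q a : ℝ} (h48 : 48 ≤ a) (h2 : 0 ≤ q) : q ≤ a * q := by nlinarith

set_option maxHeartbeats 2000000 in
lemma step (hd : 1 ≤ d) (hSR : S.ShortRangeDecay c c') (M : MesoData S) (L k : ℕ) (hL : 2 ≤ L)
    (K c3 C2 C0 ε T1 T δ e1 z : ℝ) (hKd : K = c * S.aL L / S.dL L) (hc3 : c3 = 16 * d ^ 3 + 2 * d)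
    (hC2 : C2 = 32 / 3 * d ^ 2 * (c3 + Real.exp c' / c) ^ 2 * (1 + c3) + c3)
    (hC0 : C0 = Real.exp 2 * 2 ^ d)
    (hz : z = C2 * (S.aL L * M.tau L + 1 / K))
    (hK48 : 48 ≤ K) (hKd8 : 8 * ((d : ℝ) + 2) ≤ K) (hKsq : 800 * (d : ℝ) ^ 2 ≤ K ^ 2)
    (hlr : ∀ x : Fin d → ℤ, Real.exp (Real.sqrt (Real.log L)) ≤ znorm x → S.v L x * Real.log (znorm x) ≤ ε)
    (eps0 : 0 ≤ ε) (eps1 : ε ≤ 1 / 2)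
    (hsm : 128 * z ^ 2 + 32768 * (c3 / K ^ 2) ≤ 1)
    (ht1 : 1 ≤ T1) (htk : 2 * (k : ℝ) ≤ T1) (hT : 2 * T1 + 3 ≤ T) (hTK : T ≤ K)
    (hm1 : 3 * C0 * 3 ^ d * Real.exp (-S.aL L) + C0 * 3 ^ d * Real.exp (2 * T1) * Real.exp (-S.aL L) ≤ 1 / 2)
    (hm2 : (Real.exp (48 * d * ε) - 1) * (C0 * Real.exp T1) ^ 2 ≤ 1 / 2)
    (hδ : 0 < δ) (hδ1 : δ ≤ 1) (he0 : 0 < e1) (he1 : e1 ≤ 1 / 4)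
    (hsmall : (k + 1) * ((4 + 12 * T * (k + 1)) / δ) ^ (k + 1) * (4 * e1) ≤ 1 / 100)
    (hK1 : 36 * c3 ≤ K) (hK2 : 9 * T * c3 ≤ e1 * K) (hK3 : 2048 * (d : ℝ) ^ 4 ≤ e1 * K)
    (hK4 : T1 + 1 ≤ K / 64 - 2 * d)
    {lam : Ω → ℕ → ℝ} {phi : Ω → ℕ → (Fin d → ℤ) → ℝ} (hb : ∀ ω, IsDirichletEigenbasis (QBox d (L : ℝ)) (S.ξ L ω) (lam ω) (phi ω))
    (y : Ω → ℕ → (Fin d → ℤ)) (hym : ∀ ω, ∀ j < (QBox d (L : ℝ)).card, y ω j ∈ QBox d (L : ℝ))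
    (hyi : ∀ ω, ∀ i < (QBox d (L : ℝ)).card, ∀ j < (QBox d (L : ℝ)).card, y ω i = y ω j → i = j)
    (hymono : ∀ ω, ∀ i j : ℕ, i ≤ j → j < (QBox d (L : ℝ)).card → S.ξ L ω (y ω j) ≤ S.ξ L ω (y ω i)) :
    S.P.real {ω | ¬ (k < (QBox d (L : ℝ)).card ∧ 1 / 2 < phi ω k (y ω k) ^ 2)} ≤
      4 * C0 * Real.exp (-T) + 8 / T1 + Real.exp (48 * d * ε) * (C0 ^ 2 * (2 * δ * Real.exp (2 * T)))
        + (6 * C0 * 3 ^ d + C0 * 3 ^ d * Real.exp (2 * T)) * Real.exp (-S.aL L)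
        + C0 * Real.exp T * (2 * d) * ((S.aL L + 1) * Real.exp (-S.aL L))
        + C0 * Real.exp T / e1 ^ 2 * (z ^ 2 + 256 * (c3 / K ^ 2)) := by
  have := S.hP
  obtain ⟨h1, h2, h3, h4, h5⟩ := S.base hSR L hL
  have hc := hSR.1
  have K0 : 0 < K := by linarith
  have haK : K ≤ S.aL L := by
    rw [hKd, div_le_iff₀ (by linarith)]
    have : 0 < S.aL L := S.aL_pos L hL
    nlinarith
  have ha : 48 ≤ S.aL L := by linarith
  obtain ⟨X, T', G⟩ := S.exists_GField L hL
  have hm : c * S.aL L / (16 * S.dL L) = K / 16 := by rw [hKd]; field_simp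
  have R := S.mkReg hd hSR L hL ha ε eps0 eps1 (by rw [← hKd]; exact hKd8) hlr
  rw [← hC0] at R
  set r : ℕ := ⌈S.aL L⌉₊ with hr
  obtain ⟨lt, f, hf, hbet, hX⟩ := S.profile hd hSR M L hL ha K hKd (by linarith) (num3 hKsq) r G c3 hc3
  rw [← hC2] at hX
  set a := S.aL L with haa
  have a0 : 0 < a := by linarith
  have had : 2 * (d : ℝ) ≤ a := by linarith
  have hexpL := S.le_L hd L hL ha had
  have hra : a ≤ r := Nat.le_ceil _
  have hra1 : (r : ℝ) ≤ a + 1 := (Nat.ceil_lt_add_one a0.le).le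
  have hr1 : 2 * r + 2 ≤ ⌊Real.exp a⌋₊ := by
    apply Nat.le_floor
    push_cast
    exact num1 ha hra1
  have hr2 : r ≤ L / 2 := by
    have : ⌊Real.exp a⌋₊ ≤ L := Nat.floor_le_of_le hexpL
    omega
  have c30 : 0 < c3 := by
    rw [hc3]
    have : (1 : ℝ) ≤ d := by exact_mod_cast hd
    positivity
  have C20 : 0 < C2 := by rw [hC2]; positivity
  have hs : 0 < C2 * (M.tau L + 1 / (K * a)) := by
    have := M.tau_nonneg L
    positivity
  have hzs : a ^ 2 * (C2 * (M.tau L + 1 / (K * a))) ^ 2 = z ^ 2 := by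
    rw [hz, ← mul_pow]; congr 1; field_simp
  set bt := bet (cube d r) f (usym (S.v L)) with hbt
  have hbt0 : 0 ≤ bt := by
    rw [hbt]; unfold bet
    exact Finset.sum_nonneg fun x _ => mul_nonneg (sq_nonneg _) (by linarith [G.u_le x])
  have hKb : a * bt ≤ c3 / K := by
    calc a * bt ≤ a * (c3 * (1 / (K * a))) := by gcongr
      _ = _ := by field_simp
  have hbK : bt ≤ c3 / K := num2 ha hbt0 hKb
  have hKb2 : ∀ w : ℝ, 0 ≤ w → w * a / (K / 16) * bt ≤ 16 * w * (c3 / K ^ 2) := by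
    intro w hw
    calc w * a / (K / 16) * bt = 16 * w / K * (a * bt) := by field_simp
      _ ≤ 16 * w / K * (c3 / K) := by gcongr
      _ = _ := by field_simp
  have hC00 : 0 < C0 := by rw [hC0]; positivity
  have hbad := G.bad_bd (L / 2) r k R hd f _ T T1 δ e1 hr1 hr2 hs hX
    (by rw [hm, mul_assoc, hzs]
        linarith [hKb2 2048 (by norm_num)]) he0 ht1 htk (by linarith) (by linarith)
    (by rw [hm, div_le_iff₀ a0]; exact num4 hK48 hTK haK) hδ.le hm1 hm2
  rw [hm, hzs, ← hbt] at hbad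
  refine le_trans ?_ (hbad.trans ?_)
  · refine measureReal_mono ?_ (measure_ne_top _ _)
    intro ω hω hG
    apply hω
    rw [QBox_nat]
    have hN : NumC d r k a (K / 16) K bt T T1 δ e1 := by
      refine ⟨a0, by linarith, ?_, ht1, hT, ?_, hδ, hδ1, he0.le, he1, hsmall, hbt0, ?_, ?_, ?_, ?_, ?_⟩
      · exact Nat.one_le_iff_ne_zero.2 (by intro h; rw [h] at hra; simp at hra; linarith)
      · rw [div_le_one a0]; linarith
      · have : 36 * (c3 / K) ≤ 1 := by rw [mul_div_assoc', div_le_one K0]; exact hK1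
        linarith
      · have : 9 * T * (c3 / K) ≤ e1 := by rw [mul_div_assoc', div_le_iff₀ K0]; exact hK2
        have : 9 * T * bt ≤ 9 * T * (c3 / K) := mul_le_mul_of_nonneg_left hbK (by linarith)
        linarith
      · have e2 : (2048 * (d : ℝ) ^ 4) / K ≤ e1 := by rw [div_le_iff₀ K0]; exact hK3
        refine le_trans ?_ e2
        have e3 : a * (4 * (32 * (d : ℝ) ^ 4 / (K ^ 2 * r ^ 2)) / (K / 16)) ≤ a * (4 * (32 * (d : ℝ) ^ 4 / (K ^ 2 * a ^ 2)) / (K / 16)) := by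
          gcongr
        refine e3.trans ?_
        have e4 : a * (4 * (32 * (d : ℝ) ^ 4 / (K ^ 2 * a ^ 2)) / (K / 16)) = 2048 * (d : ℝ) ^ 4 / K * (1 / (K ^ 2 * a)) := by
          field_simp; ring
        rw [e4]
        refine mul_le_of_le_one_right (by positivity) ?_
        rw [div_le_one (by positivity)]
        exact num5 hK48 haK
      · rw [div_le_iff₀ (by positivity)]; linarith
      · have : K / 64 - 2 * d ≤ a * (K / 16 / 4 - 2 * d) := by
          have e5 : 0 ≤ K / 64 - 2 * d := by linarith
          have e6 := num6 ha e5
          rw [show K / 16 / 4 = K / 64 by ring]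
          exact e6
        linarith
    have hbω := hb ω
    have y1 := hym ω
    have y2 := hyi ω
    have y3 := hymono ω
    rw [QBox_nat] at hbω y1 y2 y3
    exact det hf (fun x => G.nonneg x) (fun x => G.u_le x) hN hG hbω (y ω) y1 y2 y3
  · have f1 : 2 * (r : ℝ) * d / (2 * ((L / 2 : ℕ) : ℝ) + 1) ≤ 2 * d * ((a + 1) * Real.exp (-a)) := by
      have hc1 : (L : ℝ) ≤ 2 * ((L / 2 : ℕ) : ℝ) + 1 := by exact_mod_cast (by omega : L ≤ 2 * (L / 2) + 1)
      calc _ ≤ 2 * (a + 1) * d / Real.exp a := by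
            gcongr
            linarith
        _ = _ := by rw [Real.exp_neg]; field_simp
    have f2 : (z ^ 2 + 16 * a / (K / 16) * bt) / e1 ^ 2 ≤ (z ^ 2 + 256 * (c3 / K ^ 2)) / e1 ^ 2 := by
      refine div_le_div_of_nonneg_right ?_ (sq_nonneg _)
      linarith [hKb2 16 (by norm_num)]
    have f3 := mul_le_mul_of_nonneg_left f1 (show 0 ≤ C0 * Real.exp T by positivity)
    have f4 := mul_le_mul_of_nonneg_left f2 (show 0 ≤ C0 * Real.exp T by positivity)
    have f5 : C0 * Real.exp T * ((z ^ 2 + 256 * (c3 / K ^ 2)) / e1 ^ 2) = C0 * Real.exp T / e1 ^ 2 * (z ^ 2 + 256 * (c3 / K ^ 2)) := by ring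
    rw [f5] at f4
    linarith

end GaussSetting


lemma argmax_eq {d : ℕ} {Q : Finset (Fin d → ℤ)} {f : (Fin d → ℤ) → ℝ} (hs : ∑ x ∈ Q, f x * f x = 1) {x y : Fin d → ℤ}
    (hx : x ∈ Q) (hy : y ∈ Q) (h : |f y| ≤ |f x|) (hy2 : 1 / 2 < f y ^ 2) : x = y := by
  classical
  by_contra hne
  have h1 : ∑ z ∈ ({x, y} : Finset (Fin d → ℤ)), f z * f z ≤ ∑ z ∈ Q, f z * f z := by
    refine Finset.sum_le_sum_of_subset_of_nonneg ?_ (fun z _ _ => mul_self_nonneg _)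
    intro z hz
    rw [Finset.mem_insert, Finset.mem_singleton] at hz
    rcases hz with rfl | rfl <;> assumption
  rw [hs, Finset.sum_pair hne] at h1
  have h2 := sq_le_sq.2 h
  nlinarith

lemma params (η C0 : ℝ) (hη : 0 < η) (hC0 : 0 < C0) (d k : ℕ) : ∃ T1 T ε δ e1 : ℝ, 1 ≤ T1 ∧ 2 * (k : ℝ) ≤ T1 ∧ 2 * T1 + 3 ≤ T ∧
    0 < ε ∧ ε ≤ 1 / 2 ∧ (Real.exp (48 * d * ε) - 1) * (C0 * Real.exp T1) ^ 2 ≤ 1 / 2 ∧ 0 < δ ∧ δ ≤ 1 ∧ 0 < e1 ∧ e1 ≤ 1 / 4 ∧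
    (k + 1) * ((4 + 12 * T * (k + 1)) / δ) ^ (k + 1) * (4 * e1) ≤ 1 / 100 ∧
    4 * C0 * Real.exp (-T) + 8 / T1 + Real.exp (48 * d * ε) * (C0 ^ 2 * (2 * δ * Real.exp (2 * T))) ≤ 3 * (η / 4) := by
  obtain ⟨T1, hT1⟩ : ∃ T1 : ℝ, T1 = max (max 1 (2 * (k : ℝ))) (32 / η) := ⟨_, rfl⟩
  have t1 : 1 ≤ T1 := by rw [hT1]; exact (le_max_left _ _).trans (le_max_left _ _)
  have t2 : 2 * (k : ℝ) ≤ T1 := by rw [hT1]; exact (le_max_right _ _).trans (le_max_left _ _)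
  have t3 : 8 / T1 ≤ η / 4 := by
    have : 32 / η ≤ T1 := by rw [hT1]; exact le_max_right _ _
    rw [div_le_iff₀ hη] at this
    rw [div_le_iff₀ (by linarith)]; linarith
  obtain ⟨T, hTa, hTb⟩ : ∃ T : ℝ, 2 * T1 + 3 ≤ T ∧ 4 * C0 * Real.exp (-T) ≤ η / 4 := by
    have h : Tendsto (fun T : ℝ => 4 * C0 * Real.exp (-T)) atTop (nhds 0) := by
      simpa using (Real.tendsto_exp_neg_atTop_nhds_zero).const_mul (4 * C0)
    exact ((eventually_ge_atTop (2 * T1 + 3)).and (h.eventually_le_const (show (0 : ℝ) < η / 4 by positivity))).exists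
  obtain ⟨ε, ⟨hε1, hε2, hε3⟩, hε0⟩ : ∃ ε : ℝ, (ε ≤ 1 / 2 ∧ (Real.exp (48 * d * ε) - 1) * (C0 * Real.exp T1) ^ 2 ≤ 1 / 2 ∧
      Real.exp (48 * d * ε) ≤ 2) ∧ 0 < ε := by
    have h1 : Tendsto (fun ε : ℝ => ε) (nhdsWithin 0 (Set.Ioi 0)) (nhds 0) := tendsto_id.mono_left nhdsWithin_le_nhds
    have h2 : Tendsto (fun ε : ℝ => Real.exp (48 * d * ε)) (nhdsWithin 0 (Set.Ioi 0)) (nhds 1) := by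
      have : Continuous (fun ε : ℝ => Real.exp (48 * d * ε)) := by fun_prop
      have := this.tendsto 0
      simp only [mul_zero, Real.exp_zero] at this
      exact this.mono_left nhdsWithin_le_nhds
    have h3 : Tendsto (fun ε : ℝ => (Real.exp (48 * d * ε) - 1) * (C0 * Real.exp T1) ^ 2) (nhdsWithin 0 (Set.Ioi 0)) (nhds 0) := by
      simpa using (h2.sub_const 1).mul_const ((C0 * Real.exp T1) ^ 2)
    exact (((h1.eventually_le_const (by norm_num)).and ((h3.eventually_le_const (by norm_num)).and (h2.eventually_le_const (by norm_num)))).and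
      self_mem_nhdsWithin).exists
  obtain ⟨δ, hδ⟩ : ∃ δ : ℝ, δ = min 1 (η / (16 * C0 ^ 2 * Real.exp (2 * T))) := ⟨_, rfl⟩
  have d0 : 0 < δ := by rw [hδ]; positivity
  have d1 : δ ≤ 1 := by rw [hδ]; exact min_le_left _ _
  have d2 : δ * (16 * C0 ^ 2 * Real.exp (2 * T)) ≤ η := by
    have : δ ≤ η / (16 * C0 ^ 2 * Real.exp (2 * T)) := by rw [hδ]; exact min_le_right _ _
    rwa [le_div_iff₀ (by positivity)] at this
  have d3 : Real.exp (48 * d * ε) * (C0 ^ 2 * (2 * δ * Real.exp (2 * T))) ≤ η / 4 := by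
    calc _ ≤ 2 * (C0 ^ 2 * (2 * δ * Real.exp (2 * T))) := by gcongr
      _ ≤ _ := by linarith
  obtain ⟨e1, ⟨he1, he2⟩, he0⟩ : ∃ e1 : ℝ, (e1 ≤ 1 / 4 ∧
      (k + 1) * ((4 + 12 * T * (k + 1)) / δ) ^ (k + 1) * (4 * e1) ≤ 1 / 100) ∧ 0 < e1 := by
    have h1 : Tendsto (fun ε : ℝ => ε) (nhdsWithin 0 (Set.Ioi 0)) (nhds 0) := tendsto_id.mono_left nhdsWithin_le_nhds
    have h2 : Tendsto (fun ε : ℝ => (k + 1) * ((4 + 12 * T * (k + 1)) / δ) ^ (k + 1) * (4 * ε)) (nhdsWithin 0 (Set.Ioi 0)) (nhds 0) := by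
      simpa using (h1.const_mul 4).const_mul ((k + 1) * ((4 + 12 * T * (k + 1)) / δ) ^ (k + 1))
    exact (((h1.eventually_le_const (by norm_num)).and (h2.eventually_le_const (by norm_num))).and self_mem_nhdsWithin).exists
  exact ⟨T1, T, ε, δ, e1, t1, t2, hTa, hε0, hε1, hε2, d0, d1, he0, he1, he2, by linarith⟩

/-- Theorem 1.8 (a).
Under Assumptions 1 and 2 (and (I), (II)), if `a_L τ_L → 0`, then for any fixed `k`,
`P(ℓ_L(k) = k) → 1` as `L → ∞`: the localisation centre of the `(k+1)`-th eigenfunction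
is the site of the `(k+1)`-th largest value of the potential (indices are 0-based). -/
theorem rank_coincides_small_tau
    {d : ℕ} (hd : 1 ≤ d) {Ω : Type} [MeasurableSpace Ω] (S : GaussSetting d Ω)
    (c c' : ℝ) (hSR : S.ShortRangeDecay c c')
    (hLR : S.LongRangeDecay)
    (hA1 : S.Assumption1)
    (M : MesoData S) (hA2 : Assumption2 S M)
    (htau : Tendsto (fun L => S.aL L * M.tau L) atTop (nhds 0))
    -- eigenpairs of `Δ + ξ_L` on `Q_L`, eigenvalues in nonincreasing order
    (lam : ℕ → ℕ → Ω → ℝ) (phi : ℕ → ℕ → Ω → (Fin d → ℤ) → ℝ)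
    (hbasis : ∀ L : ℕ, 2 ≤ L → ∀ ω, IsDirichletEigenbasis (QBox d (L : ℝ)) (S.ξ L ω)
      (fun k => lam L k ω) (fun k => phi L k ω))
    -- `xk L k ω` maximises `|φ_{k,L}|` over `Q_L`
    (xk : ℕ → ℕ → Ω → (Fin d → ℤ))
    (hxk_mem : ∀ L : ℕ, 2 ≤ L → ∀ ω, ∀ k < (QBox d (L : ℝ)).card,
      xk L k ω ∈ QBox d (L : ℝ))
    (hxk_max : ∀ L : ℕ, 2 ≤ L → ∀ ω, ∀ k < (QBox d (L : ℝ)).card,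
      ∀ x ∈ QBox d (L : ℝ), |phi L k ω x| ≤ |phi L k ω (xk L k ω)|)
    (hxk_pos : ∀ L : ℕ, 2 ≤ L → ∀ ω, ∀ k < (QBox d (L : ℝ)).card,
      0 < phi L k ω (xk L k ω))
    -- `y L k ω` is the site of `Q_L` where `ξ_L` attains its `(k+1)`-th largest value
    (y : ℕ → ℕ → Ω → (Fin d → ℤ))
    (hy_mem : ∀ L : ℕ, 2 ≤ L → ∀ ω, ∀ k < (QBox d (L : ℝ)).card, y L k ω ∈ QBox d (L : ℝ))
    (hy_inj : ∀ L : ℕ, 2 ≤ L → ∀ ω, ∀ j < (QBox d (L : ℝ)).card,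
      ∀ k < (QBox d (L : ℝ)).card, y L j ω = y L k ω → j = k)
    (hy_mono : ∀ L : ℕ, 2 ≤ L → ∀ ω, ∀ j k : ℕ, j ≤ k → k < (QBox d (L : ℝ)).card →
      S.ξ L ω (y L k ω) ≤ S.ξ L ω (y L j ω))
    -- `ℓ L k ω` is the rank of the maximum of `ξ_L` at which `φ_{k,L}` is localised
    (ℓ : ℕ → ℕ → Ω → ℕ)
    (hℓ : ∀ L : ℕ, 2 ≤ L → ∀ ω, ∀ k < (QBox d (L : ℝ)).card,
      xk L k ω = y L (ℓ L k ω) ω ∧ ℓ L k ω < (QBox d (L : ℝ)).card) :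
    ∀ k : ℕ, Tendsto (fun L : ℕ => S.P {ω | ℓ L k ω = k}) atTop (nhds 1) := by
  intro k
  have hP := S.hP
  have hc := hSR.1
  -- the bad sets
  obtain ⟨bad, hbad⟩ : ∃ bad : ℕ → Set Ω, ∀ L, bad L =
      {ω | ¬ (k < (QBox d (L : ℝ)).card ∧ 1 / 2 < phi L k ω (y L k ω) ^ 2)} := ⟨_, fun _ => rfl⟩
  have hKt : Tendsto (fun L => c * S.aL L / S.dL L) atTop atTop := by
    have h1 : Tendsto (fun L => S.dL L / S.aL L) atTop (nhdsWithin 0 (Set.Ioi 0)) := by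
      refine tendsto_nhdsWithin_of_tendsto_nhds_of_eventually_within _ hA1 ?_
      filter_upwards [eventually_ge_atTop 2] with L hL
      exact div_pos (S.dL_pos L hL) (S.aL_pos L hL)
    have h2 := (h1.inv_tendsto_nhdsGT_zero).const_mul_atTop hc
    refine h2.congr ?_
    intro L
    simp only [Pi.inv_apply, inv_div]; ring
  have hat : Tendsto S.aL atTop atTop := by
    refine tendsto_atTop_mono' _ ?_ hKt
    filter_upwards [eventually_ge_atTop 2] with L hL
    obtain ⟨h1, h2, -⟩ := S.base hSR L hL
    rw [div_le_iff₀ (by linarith)]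
    have := S.aL_pos L hL
    nlinarith
  have hreal : Tendsto (fun L => S.P.real (bad L)) atTop (nhds 0) := by
    have key : ∀ η > (0 : ℝ), ∀ᶠ L in atTop, S.P.real (bad L) ≤ η := by
      intro η hη
      obtain ⟨c3, hc3⟩ : ∃ c3 : ℝ, c3 = 16 * d ^ 3 + 2 * d := ⟨_, rfl⟩
      obtain ⟨C2, hC2⟩ : ∃ C2 : ℝ, C2 = 32 / 3 * d ^ 2 * (c3 + Real.exp c' / c) ^ 2 * (1 + c3) + c3 := ⟨_, rfl⟩
      obtain ⟨C0, hC0⟩ : ∃ C0 : ℝ, C0 = Real.exp 2 * 2 ^ d := ⟨_, rfl⟩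
      have hC0p : 0 < C0 := by rw [hC0]; positivity
      obtain ⟨T1, T, ε, δ, e1, t1, t2, hT, ε0, ε1, hm2, δ0, δ1, e0, e1', hsmall, hsum⟩ := params η C0 hη hC0p d k
      have hKinv : Tendsto (fun L => 1 / (c * S.aL L / S.dL L)) atTop (nhds 0) := by
        refine hKt.inv_tendsto_atTop.congr ?_
        intro L
        rw [one_div]; rfl
      have hz : Tendsto (fun L => C2 * (S.aL L * M.tau L + 1 / (c * S.aL L / S.dL L))) atTop (nhds 0) := by
        simpa using (htau.add hKinv).const_mul C2
      have hq : Tendsto (fun L => c3 / (c * S.aL L / S.dL L) ^ 2) atTop (nhds 0) := by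
        have := (hKinv.pow 2).const_mul c3
        simp only [ne_eq, OfNat.ofNat_ne_zero, not_false_eq_true, zero_pow, mul_zero] at this
        refine this.congr ?_
        intro L
        rw [one_div, inv_pow, ← div_eq_mul_inv]
      have hexp : Tendsto (fun L => Real.exp (-S.aL L)) atTop (nhds 0) := Real.tendsto_exp_neg_atTop_nhds_zero.comp hat
      have hexp2 : Tendsto (fun L => (S.aL L + 1) * Real.exp (-S.aL L)) atTop (nhds 0) := by
        have h1 : Tendsto (fun x : ℝ => x ^ 1 * Real.exp (-x)) atTop (nhds 0) := Real.tendsto_pow_mul_exp_neg_atTop_nhds_zero 1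
        have h2 := (h1.comp hat).add hexp
        simp only [add_zero] at h2
        refine h2.congr ?_
        intro L
        simp only [Function.comp, pow_one]; ring
      have hsm : Tendsto (fun L => 128 * (C2 * (S.aL L * M.tau L + 1 / (c * S.aL L / S.dL L))) ^ 2
          + 32768 * (c3 / (c * S.aL L / S.dL L) ^ 2)) atTop (nhds 0) := by
        simpa using ((hz.pow 2).const_mul 128).add (hq.const_mul 32768)
      have hm1 : Tendsto (fun L => 3 * C0 * 3 ^ d * Real.exp (-S.aL L) + C0 * 3 ^ d * Real.exp (2 * T1) * Real.exp (-S.aL L))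
          atTop (nhds 0) := by
        simpa using (hexp.const_mul (3 * C0 * 3 ^ d)).add (hexp.const_mul (C0 * 3 ^ d * Real.exp (2 * T1)))
      have hrest : Tendsto (fun L => (6 * C0 * 3 ^ d + C0 * 3 ^ d * Real.exp (2 * T)) * Real.exp (-S.aL L)
          + C0 * Real.exp T * (2 * d) * ((S.aL L + 1) * Real.exp (-S.aL L))
          + C0 * Real.exp T / e1 ^ 2 * ((C2 * (S.aL L * M.tau L + 1 / (c * S.aL L / S.dL L))) ^ 2
            + 256 * (c3 / (c * S.aL L / S.dL L) ^ 2))) atTop (nhds 0) := by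
        have h1 := hexp.const_mul (6 * C0 * 3 ^ d + C0 * 3 ^ d * Real.exp (2 * T))
        have h2 := hexp2.const_mul (C0 * Real.exp T * (2 * d))
        have h3 := ((hz.pow 2).add (hq.const_mul 256)).const_mul (C0 * Real.exp T / e1 ^ 2)
        have h4 := (h1.add h2).add h3
        simpa using h4
      have hKge : ∀ B : ℝ, ∀ᶠ L in atTop, B ≤ c * S.aL L / S.dL L := fun B => hKt.eventually_ge_atTop B
      filter_upwards [eventually_ge_atTop 2, hLR ε ε0, hsm.eventually_le_const (show (0 : ℝ) < 1 by norm_num),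
        hm1.eventually_le_const (show (0 : ℝ) < 1 / 2 by norm_num),
        hrest.eventually_le_const (show (0 : ℝ) < η / 4 by positivity),
        hKge 48, hKge (8 * ((d : ℝ) + 2)), hKge (30 * d), hKge T, hKge (36 * c3), hKge (9 * T * c3 / e1),
        hKge (2048 * (d : ℝ) ^ 4 / e1), hKge (64 * (T1 + 1 + 2 * d))] with L hL hlr g1 g2 g3 k1 k2 k3 k4 k5 k6 k7 k8
      have hfin := S.step hd hSR M L k hL (c * S.aL L / S.dL L) c3 C2 C0 ε T1 T δ e1
        (C2 * (S.aL L * M.tau L + 1 / (c * S.aL L / S.dL L))) rfl hc3 hC2 hC0 rfl k1 k2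
        (by
          have h1 := pow_le_pow_left₀ (by positivity) k3 2
          have h2 := sq_nonneg (d : ℝ)
          rw [mul_pow] at h1
          linarith) hlr ε0.le ε1 g1 t1 t2 hT k4 g2 hm2 δ0 δ1 e0 e1' hsmall k5
        (by rw [div_le_iff₀ e0] at k6; linarith) (by rw [div_le_iff₀ e0] at k7; linarith) (by linarith)
        (lam := fun ω j => lam L j ω) (phi := fun ω j => phi L j ω) (hbasis L hL)
        (fun ω j => y L j ω) (hy_mem L hL) (hy_inj L hL) (hy_mono L hL)
      rw [hbad]
      refine hfin.trans ?_
      linarith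
    rw [Metric.tendsto_nhds]
    intro η hη
    filter_upwards [key (η / 2) (by positivity)] with L hL
    rw [Real.dist_eq, sub_zero, abs_of_nonneg measureReal_nonneg]
    linarith
  have hEN : Tendsto (fun L => S.P (bad L)) atTop (nhds 0) := by
    have h := ENNReal.tendsto_ofReal hreal
    rw [ENNReal.ofReal_zero] at h
    refine h.congr ?_
    intro L
    exact ofReal_measureReal (measure_ne_top _ _)
  have hlow : Tendsto (fun L => 1 - S.P (bad L)) atTop (nhds 1) := by
    have h := ENNReal.Tendsto.sub (tendsto_const_nhds (x := (1 : ENNReal)) (f := atTop (α := ℕ))) hEN (Or.inl ENNReal.one_ne_top)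
    simpa using h
  refine tendsto_of_tendsto_of_tendsto_of_le_of_le' hlow tendsto_const_nhds ?_ (Eventually.of_forall fun L => prob_le_one)
  filter_upwards [eventually_ge_atTop 2] with L hL
  rw [tsub_le_iff_right]
  have hcov : (Set.univ : Set Ω) ⊆ {ω | ℓ L k ω = k} ∪ bad L := by
    intro ω _
    by_cases hω : ω ∈ bad L
    · exact Or.inr hω
    · left
      rw [hbad, Set.mem_setOf_eq, not_not] at hω
      obtain ⟨hk, hy2⟩ := hω
      have hn := (hbasis L hL ω).2.2 k hk k hk
      rw [if_pos rfl] at hn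
      have hx := argmax_eq hn (hxk_mem L hL ω k hk) (hy_mem L hL ω k hk) (hxk_max L hL ω k hk _ (hy_mem L hL ω k hk)) hy2
      obtain ⟨l1, l2⟩ := hℓ L hL ω k hk
      exact hy_inj L hL ω _ l2 _ hk (l1.symm.trans hx)
  calc (1 : ENNReal) = S.P Set.univ := measure_univ.symm
    _ ≤ S.P ({ω | ℓ L k ω = k} ∪ bad L) := measure_mono hcov
    _ ≤ _ := measure_union_le _ _
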